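/- For every basepoint x₀ in the complement X₁ = ℙ² ∖ C⁽¹⁾, the fundamental group π₁(X₁, x₀) is isomorphic to the group G₁ with presentation ⟨a, b | a²(ab)² = 1, ab²a⁻¹b⁻² = 1⟩. -/

import Mathlib

noncomputable section

open MvPolynomial

/-- the complex projective plane -/
abbrev P2 := Projectivization ℂ (Fin 3 → ℂ)

instance : TopologicalSpace P2 :=
  inferInstanceAs (TopologicalSpace (Quotient (projectivizationSetoid ℂ (Fin 3 → ℂ))))

/-- the zero locus in ℙ² of a homogeneous polynomial F: the set of points all of whose
representative vectors are zeros of F -/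
def VV (F : MvPolynomial (Fin 3) ℂ) : Set P2 :=
  {P | ∀ (v : Fin 3 → ℂ) (h : v ≠ 0), Projectivization.mk ℂ v h = P → eval v F = 0}

/-- the singular locus of the curve {F = 0}: points at which all three partial
derivatives of F vanish (at every representative vector) -/
def SingLoc (F : MvPolynomial (Fin 3) ℂ) : Set P2 :=
  {P | ∀ (v : Fin 3 → ℂ) (h : v ≠ 0), Projectivization.mk ℂ v h = P →
    ∀ i : Fin 3, eval v (pderiv i F) = 0}

/-- the conic F₁ = 8z²−20yz+36xz+17y²−18xy -/
def F₁ : MvPolynomial (Fin 3) ℂ :=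
  8 * X 2 ^ 2 - 20 * X 1 * X 2 + 36 * X 0 * X 2 + 17 * X 1 ^ 2 - 18 * X 0 * X 1

/-- the quartic Q₁ = 8x²z²−16xy²z+52x²yz−36x³z−37x²y²+18x³y−y⁴+20xy³ -/
def Q₁ : MvPolynomial (Fin 3) ℂ :=
  8 * X 0 ^ 2 * X 2 ^ 2 - 16 * X 0 * X 1 ^ 2 * X 2 + 52 * X 0 ^ 2 * X 1 * X 2
    - 36 * X 0 ^ 3 * X 2 - 37 * X 0 ^ 2 * X 1 ^ 2 + 18 * X 0 ^ 3 * X 1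
    - X 1 ^ 4 + 20 * X 0 * X 1 ^ 3

/-- the conic F₂ = 3x²+2xy+108z² -/
def F₂ : MvPolynomial (Fin 3) ℂ :=
  3 * X 0 ^ 2 + 2 * X 0 * X 1 + 108 * X 2 ^ 2

/-- the quartic Q₂ = 2xy³+3x²y²+108y²z²−x⁴ -/
def Q₂ : MvPolynomial (Fin 3) ℂ :=
  2 * X 0 * X 1 ^ 3 + 3 * X 0 ^ 2 * X 1 ^ 2 + 108 * X 1 ^ 2 * X 2 ^ 2 - X 0 ^ 4

/-- generator a of the free group on two generators -/
def ga : FreeGroup (Fin 2) := FreeGroup.of 0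
/-- generator b of the free group on two generators -/
def gb : FreeGroup (Fin 2) := FreeGroup.of 1

/-- relators of G₁: a²(ab)² and ab²a⁻¹b⁻² -/
def rels1 : Set (FreeGroup (Fin 2)) := {ga ^ 2 * (ga * gb) ^ 2, ga * gb ^ 2 * ga⁻¹ * (gb ^ 2)⁻¹}

/-- the group G₁ = ⟨a, b | a²(ab)² = 1, ab²a⁻¹b⁻² = 1⟩ -/
abbrev G1 := PresentedGroup rels1

/-- relator of G₂: b²((ab)⁴)⁻¹, i.e. the relation b² = (ab)⁴ -/
def rels2 : Set (FreeGroup (Fin 2)) := {gb ^ 2 * ((ga * gb) ^ 4)⁻¹}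

/-- the group G₂ = ⟨a, b | b² = (ab)⁴⟩ -/
abbrev G2 := PresentedGroup rels2

open Set Topology unitInterval

/-- A homomorphism from the fundamental groupoid of `X` to a group `G`. -/
structure PathHom (X G : Type*) [TopologicalSpace X] [Group G] where
  toFun : ∀ {x y : X}, Path.Homotopic.Quotient x y → G
  map_trans : ∀ {x y z : X} (p : Path.Homotopic.Quotient x y) (q : Path.Homotopic.Quotient y z),
    toFun (p.trans q) = toFun p * toFun q

/-- The homotopy class of the image under `f` of a path in a simply connected space. -/
def arr {A X : Type*} [TopologicalSpace A] [TopologicalSpace X] [SimplyConnectedSpace A]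
    (f : C(A, X)) (a b : A) : Path.Homotopic.Quotient (f a) (f b) :=
  (Path.Homotopic.Quotient.mk (PathConnectedSpace.somePath a b)).map f

section arr

variable {A B X Y : Type*} [TopologicalSpace A] [TopologicalSpace B] [TopologicalSpace X]
  [TopologicalSpace Y] [SimplyConnectedSpace A] [SimplyConnectedSpace B]

theorem arr_eq_map (f : C(A, X)) {a b : A} (p : Path.Homotopic.Quotient a b) :
    p.map f = arr f a b :=
  congrArg (fun q => Path.Homotopic.Quotient.map q f) (Subsingleton.elim _ _)

theorem arr_trans (f : C(A, X)) (a b c : A) : (arr f a b).trans (arr f b c) = arr f a c := by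
  rw [← arr_eq_map f (Path.Homotopic.Quotient.mk
    ((PathConnectedSpace.somePath a b).trans (PathConnectedSpace.somePath b c))),
    ← Path.Homotopic.Quotient.mk_map, Path.map_trans]
  rfl

theorem arr_comp (f : C(A, X)) (g : C(B, A)) (a b : B) :
    arr (f.comp g) a b = arr f (g a) (g b) := by
  rw [← arr_eq_map f ((Path.Homotopic.Quotient.mk (PathConnectedSpace.somePath a b)).map g)]
  rfl

end arr

theorem simplyConnectedSpace_of_convex {E : Type*} [AddCommGroup E] [Module ℝ E]
    [TopologicalSpace E] [IsTopologicalAddGroup E] [ContinuousSMul ℝ E] {s : Set E}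
    (hs : Convex ℝ s) (hne : s.Nonempty) : SimplyConnectedSpace s := by
  have := hs.contractibleSpace hne
  infer_instance


namespace PathHom

variable {A B X Y G : Type*} [TopologicalSpace A] [TopologicalSpace B] [TopologicalSpace X]
  [TopologicalSpace Y] [Group G] [SimplyConnectedSpace A] [SimplyConnectedSpace B]

/-- The value of `Φ` on the image under `f` of any path from `a` to `b`. -/
def ev (Φ : PathHom X G) (f : C(A, X)) (a b : A) : G := Φ.toFun (arr f a b)

theorem ev_trans (Φ : PathHom X G) (f : C(A, X)) (a b c : A) :
    Φ.ev f a b * Φ.ev f b c = Φ.ev f a c := by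
  rw [ev, ev, ev, ← Φ.map_trans, arr_trans]

theorem ev_self (Φ : PathHom X G) (f : C(A, X)) (a : A) : Φ.ev f a a = 1 := by
  simpa using Φ.ev_trans f a a a

theorem ev_symm (Φ : PathHom X G) (f : C(A, X)) (a b : A) : (Φ.ev f a b)⁻¹ = Φ.ev f b a := by
  rw [inv_eq_iff_mul_eq_one, ev_trans, ev_self]

theorem ev_comp (Φ : PathHom X G) (f : C(A, X)) (g : C(B, A)) (a b : B) :
    Φ.ev (f.comp g) a b = Φ.ev f (g a) (g b) := by
  rw [ev, ev, arr_comp]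

/-- Precomposition of a groupoid homomorphism with a continuous map. -/
def comap (Φ : PathHom X G) (f : C(Y, X)) : PathHom Y G where
  toFun p := Φ.toFun (p.map f)
  map_trans p q := by
    induction p using Path.Homotopic.Quotient.ind
    induction q using Path.Homotopic.Quotient.ind
    rw [← Path.Homotopic.Quotient.mk_trans, ← Path.Homotopic.Quotient.mk_map,
      ← Path.Homotopic.Quotient.mk_map, ← Path.Homotopic.Quotient.mk_map, Path.map_trans,
      Path.Homotopic.Quotient.mk_trans, Φ.map_trans]

theorem comap_ev (Φ : PathHom X G) (f : C(Y, X)) (g : C(A, Y)) (a b : A) :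
    (Φ.comap f).ev g a b = Φ.ev (f.comp g) a b := rfl

theorem toFun_mk (Φ : PathHom X G) [SimplyConnectedSpace I] {x y : X} (γ : Path x y) :
    Φ.toFun (Path.Homotopic.Quotient.mk γ) = Φ.ev (γ : C(I, X)) 0 1 := by
  rcases γ with ⟨f, rfl, rfl⟩
  exact congrArg Φ.toFun (arr_eq_map f (Path.Homotopic.Quotient.mk
    (⟨ContinuousMap.id I, rfl, rfl⟩ : Path (0 : I) 1)))

section hol

variable {E : Type*} [TopologicalSpace E] {U : Set E}

open Classical in
/-- The value of `Φ` on the curve `f` restricted to `[a, b]`, or `1` if the curve leaves `U`. -/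
def hol (Φ : PathHom U G) (f : ℝ → E) (a b : ℝ) : G :=
  if h : ∃ h : C(ℝ, U), ∀ t ∈ Icc a b, (h t : E) = f t then Φ.ev h.choose a b else 1

/-- The curve `f` restricted to `[a, b]` is continuous with values in `U`. -/
def _root_.CurveIn (U : Set E) (f : ℝ → E) (a b : ℝ) : Prop :=
  ContinuousOn f (Icc a b) ∧ ∀ t ∈ Icc a b, f t ∈ U

theorem ev_congr (Φ : PathHom X G) {f g : C(ℝ, X)} {a b : ℝ} (hab : a ≤ b)
    (h : ∀ t ∈ Icc a b, f t = g t) : Φ.ev f a b = Φ.ev g a b := by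
  have hsc : SimplyConnectedSpace (Icc a b) :=
    simplyConnectedSpace_of_convex (convex_Icc a b) ⟨a, left_mem_Icc.2 hab⟩
  let i : C(Icc a b, ℝ) := ⟨Subtype.val, continuous_subtype_val⟩
  have e : f.comp i = g.comp i := by ext t; exact h t t.2
  have h1 := Φ.ev_comp f i ⟨a, left_mem_Icc.2 hab⟩ ⟨b, right_mem_Icc.2 hab⟩
  have h2 := Φ.ev_comp g i ⟨a, left_mem_Icc.2 hab⟩ ⟨b, right_mem_Icc.2 hab⟩
  rw [e, h2] at h1
  exact h1.symm

theorem hol_eq (Φ : PathHom U G) {f : ℝ → E} {a b : ℝ} (hab : a ≤ b) (h : C(ℝ, U))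
    (hf : ∀ t ∈ Icc a b, (h t : E) = f t) : Φ.hol f a b = Φ.ev h a b := by
  have hex : ∃ h : C(ℝ, U), ∀ t ∈ Icc a b, (h t : E) = f t := ⟨h, hf⟩
  rw [hol, dif_pos hex]
  refine Φ.ev_congr hab fun t ht => Subtype.ext ?_
  rw [hex.choose_spec t ht, hf t ht]

theorem _root_.CurveIn.exists_map {f : ℝ → E} {a b : ℝ} (hf : CurveIn U f a b) (hab : a ≤ b) :
    ∃ h : C(ℝ, U), ∀ t ∈ Icc a b, (h t : E) = f t := by
  refine ⟨⟨fun t => ⟨f (projIcc a b hab t), hf.2 _ (projIcc a b hab t).2⟩, ?_⟩, ?_⟩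
  · exact Continuous.subtype_mk (hf.1.comp_continuous
      (continuous_subtype_val.comp continuous_projIcc) fun t => (projIcc a b hab t).2) _
  · intro t ht
    simp [projIcc_of_mem hab ht]

theorem _root_.CurveIn.mono {f : ℝ → E} {a b c d : ℝ} (hf : CurveIn U f a b) (hac : a ≤ c)
    (hdb : d ≤ b) : CurveIn U f c d :=
  ⟨hf.1.mono (Icc_subset_Icc hac hdb), fun t ht => hf.2 t (Icc_subset_Icc hac hdb ht)⟩

theorem hol_congr (Φ : PathHom U G) {f g : ℝ → E} {a b : ℝ}
    (h : ∀ t ∈ Icc a b, f t = g t) : Φ.hol f a b = Φ.hol g a b := by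
  have : (fun k : C(ℝ, U) => ∀ t ∈ Icc a b, (k t : E) = f t) =
      fun k : C(ℝ, U) => ∀ t ∈ Icc a b, (k t : E) = g t := by
    funext k
    exact propext (forall₂_congr fun t ht => by rw [h t ht])
  have key : ∀ P Q : C(ℝ, U) → Prop, P = Q → ∀ (_ : Decidable (∃ k, P k))
      (_ : Decidable (∃ k, Q k)), (if h : ∃ k, P k then Φ.ev h.choose a b else 1) =
        if h : ∃ k, Q k then Φ.ev h.choose a b else 1 := by
    rintro P _ rfl _ _
    congr
  exact key _ _ this _ _

theorem hol_trans (Φ : PathHom U G) {f : ℝ → E} {a b c : ℝ} (hab : a ≤ b) (hbc : b ≤ c)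
    (hf : CurveIn U f a c) : Φ.hol f a b * Φ.hol f b c = Φ.hol f a c := by
  obtain ⟨h, hh⟩ := hf.exists_map (hab.trans hbc)
  rw [Φ.hol_eq hab h fun t ht => hh t ⟨ht.1, ht.2.trans hbc⟩,
    Φ.hol_eq hbc h fun t ht => hh t ⟨hab.trans ht.1, ht.2⟩, Φ.hol_eq (hab.trans hbc) h hh,
    ev_trans]

/-- The holonomy of a curve factoring through a simply connected space depends only on the
end points. -/
theorem hol_factor (Φ : PathHom U G) {f : ℝ → E} {a b : ℝ} (hab : a ≤ b) (j : C(A, U))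
    {k : ℝ → A} (hk : ContinuousOn k (Icc a b)) (hf : ∀ t ∈ Icc a b, f t = j (k t)) :
    Φ.hol f a b = Φ.ev j (k a) (k b) := by
  let k' : C(ℝ, A) := ⟨fun t => k (projIcc a b hab t), hk.comp_continuous
      (continuous_subtype_val.comp continuous_projIcc) fun t => (projIcc a b hab t).2⟩
  have h1 := Φ.hol_eq (f := f) hab (j.comp k') fun t ht => by
    simp [k', hf t ht, projIcc_of_mem hab ht]
  rw [h1, ev_comp]
  simp [k']

theorem hol_comp (Φ : PathHom U G) {f : ℝ → E} {φ : ℝ → ℝ} {a b : ℝ} (hab : a ≤ b)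
    (hφ : ContinuousOn φ (Icc a b)) {c d : ℝ} (hm : ∀ t ∈ Icc a b, φ t ∈ Icc c d)
    (hcd : c ≤ d) (hf : CurveIn U f c d) (ha : φ a = c) (hb : φ b = d) :
    Φ.hol (fun t => f (φ t)) a b = Φ.hol f c d := by
  obtain ⟨h, hh⟩ := hf.exists_map hcd
  rw [Φ.hol_factor hab h hφ fun t ht => (hh _ (hm t ht)).symm, Φ.hol_eq hcd h hh, ha, hb]

theorem hol_reverse (Φ : PathHom U G) {f : ℝ → E} {φ : ℝ → ℝ} {a b : ℝ} (hab : a ≤ b)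
    (hφ : ContinuousOn φ (Icc a b)) {c d : ℝ} (hm : ∀ t ∈ Icc a b, φ t ∈ Icc c d)
    (hcd : c ≤ d) (hf : CurveIn U f c d) (ha : φ a = d) (hb : φ b = c) :
    Φ.hol (fun t => f (φ t)) a b = (Φ.hol f c d)⁻¹ := by
  obtain ⟨h, hh⟩ := hf.exists_map hcd
  rw [Φ.hol_factor hab h hφ fun t ht => (hh _ (hm t ht)).symm, Φ.hol_eq hcd h hh, ha, hb,
    ev_symm]

theorem hol_square (Φ : PathHom U G) {H : ℝ × ℝ → E} {a b c d : ℝ} (hab : a ≤ b) (hcd : c ≤ d)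
    (hH : ContinuousOn H (Icc a b ×ˢ Icc c d)) (hU : ∀ p ∈ Icc a b ×ˢ Icc c d, H p ∈ U) :
    Φ.hol (fun s => H (s, c)) a b * Φ.hol (fun t => H (b, t)) c d =
      Φ.hol (fun t => H (a, t)) c d * Φ.hol (fun s => H (s, d)) a b := by
  let π : ℝ × ℝ → ℝ × ℝ := fun p => (projIcc a b hab p.1, projIcc c d hcd p.2)
  have hπ : Continuous π :=
    (continuous_subtype_val.comp (continuous_projIcc.comp continuous_fst)).prodMk
      (continuous_subtype_val.comp (continuous_projIcc.comp continuous_snd))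
  have hm : ∀ p, π p ∈ Icc a b ×ˢ Icc c d := fun p =>
    ⟨(projIcc a b hab p.1).2, (projIcc c d hcd p.2).2⟩
  have hid : ∀ p ∈ Icc a b ×ˢ Icc c d, π p = p := fun p hp => by
    simp [π, projIcc_of_mem hab hp.1, projIcc_of_mem hcd hp.2]
  let j : C(ℝ × ℝ, U) := ⟨fun p => ⟨H (π p), hU _ (hm p)⟩,
    Continuous.subtype_mk (hH.comp_continuous hπ hm) _⟩
  have hj : ∀ p ∈ Icc a b ×ˢ Icc c d, H p = j p := fun p hp => by simp [j, hid p hp]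
  have e1 : ∀ y ∈ Icc c d, Φ.hol (fun s => H (s, y)) a b = Φ.ev j (a, y) (b, y) := fun y hy =>
    Φ.hol_factor hab j (k := fun s => (s, y)) (by fun_prop) fun t ht => hj _ ⟨ht, hy⟩
  have e2 : ∀ x ∈ Icc a b, Φ.hol (fun t => H (x, t)) c d = Φ.ev j (x, c) (x, d) := fun x hx =>
    Φ.hol_factor hcd j (k := fun t => (x, t)) (by fun_prop) fun t ht => hj _ ⟨hx, ht⟩
  rw [e1 _ (left_mem_Icc.2 hcd), e1 _ (right_mem_Icc.2 hcd), e2 _ (left_mem_Icc.2 hab),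
    e2 _ (right_mem_Icc.2 hab), ev_trans, ev_trans]

/-- Sliding a curve with end points moving through curves of trivial holonomy. -/
theorem hol_slide (Φ : PathHom U G) {H : ℝ × ℝ → E} {a b c d : ℝ} (hab : a ≤ b) (hcd : c ≤ d)
    (hH : ContinuousOn H (Icc a b ×ˢ Icc c d)) (hU : ∀ p ∈ Icc a b ×ˢ Icc c d, H p ∈ U)
    (h1 : Φ.hol (fun s => H (s, c)) a b = 1) (h2 : Φ.hol (fun s => H (s, d)) a b = 1) :
    Φ.hol (fun t => H (a, t)) c d = Φ.hol (fun t => H (b, t)) c d := by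
  have := Φ.hol_square hab hcd hH hU
  rwa [h1, h2, one_mul, mul_one, eq_comm] at this

end hol

end PathHom

theorem PathHom.hol_mem_of_potential {E G : Type*} [TopologicalSpace E] [Group G] {U : Set E}
    (Φ : PathHom U G) (S : Subgroup G) {f : ℝ → E} {a b : ℝ} (hab : a ≤ b)
    (hf : CurveIn U f a b) (V : ℝ → Set G) (hne : ∀ t ∈ Icc a b, (V t).Nonempty)
    (hloc : ∀ t ∈ Icc a b, ∃ W ∈ 𝓝 t, ∀ s ∈ Icc a b ∩ W, ∀ s' ∈ Icc a b ∩ W, s ≤ s' →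
      ∀ v ∈ V s, ∀ v' ∈ V s', v⁻¹ * Φ.hol f s s' * v' ∈ S) :
    ∀ v ∈ V a, ∀ v' ∈ V b, v⁻¹ * Φ.hol f a b * v' ∈ S := by
  choose! W hW hS using hloc
  obtain ⟨t, ht0, hmono, ⟨n, hn⟩, hsub⟩ := exists_monotone_Icc_subset_open_cover_Icc hab
    (c := fun x : Icc a b => Subtype.val ⁻¹' interior (W x))
    (fun x => isOpen_interior.preimage continuous_subtype_val)
    (fun s _ => mem_iUnion.2 ⟨s, mem_interior_iff_mem_nhds.2 (hW _ s.2)⟩)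
  have key : ∀ m, ∀ v ∈ V a, ∀ v' ∈ V (t m), v⁻¹ * Φ.hol f a (t m) * v' ∈ S := by
    intro m
    induction m with
    | zero =>
      rw [ht0]
      intro v hv v' hv'
      have ha := left_mem_Icc.2 hab
      have haW := mem_of_mem_nhds (hW a ha)
      exact hS a ha a ⟨ha, haW⟩ a ⟨ha, haW⟩ le_rfl v hv v' hv'
    | succ m ih =>
      intro v hv v' hv'
      obtain ⟨w, hw⟩ := hsub m
      have hle := hmono m.le_succ
      obtain ⟨v₁, hv₁⟩ := hne (t m) (t m).2
      have h1 := ih v hv v₁ hv₁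
      have h2 := hS w w.2 (t m) ⟨(t m).2, interior_subset (hw ⟨le_rfl, hle⟩)⟩
        (t (m + 1)) ⟨(t (m + 1)).2, interior_subset (hw ⟨hle, le_rfl⟩)⟩ hle v₁ hv₁ v' hv'
      have h3 := S.mul_mem h1 h2
      rw [← Φ.hol_trans (t m).2.1 hle (hf.mono le_rfl (t (m + 1)).2.2)]
      convert h3 using 1
      group
  have := key n
  rwa [hn n le_rfl] at this

/-- The two quadratic factors cutting out the branch curve in the coordinates `(M, T)`. -/
def DD (M T : ℂ) : ℂ := ((M + 1) ^ 2 - T ^ 2 * (3 - 4 * T)) * ((M - 1) ^ 2 - T ^ 2 * (3 + 4 * T))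

/-- The complement of the branch curve, in the coordinates `(M, log T)`. -/
def UU : Set (ℂ × ℂ) := {p | DD p.1 (Complex.exp p.2) ≠ 0}

/-- A height above all the roots of the fibre over `θ`. -/
def topH (θ : ℂ) : ℝ := 2 + 2 * Real.exp θ.re + Real.exp θ.re ^ 2

/-- A convex region above all the roots of all the fibres. -/
def Far : Set (ℂ × ℂ) := {p | topH p.2 - 1 < p.1.im}

theorem continuous_topH : Continuous topH := by
  unfold topH
  fun_prop

theorem norm_le_of_sq_eq {A T : ℂ} (s : ℂ) (hs : ‖s‖ ≤ 4) (h : A ^ 2 = T ^ 2 * (3 + s * T)) :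
    ‖A‖ ≤ 2 * ‖T‖ + ‖T‖ ^ 2 := by
  have h1 : ‖A‖ ^ 2 = ‖T‖ ^ 2 * ‖3 + s * T‖ := by rw [← norm_pow, h, norm_mul, norm_pow]
  have h2 : ‖3 + s * T‖ ≤ 3 + 4 * ‖T‖ := by
    refine (norm_add_le _ _).trans ?_
    rw [norm_mul]
    have : ‖(3 : ℂ)‖ = 3 := by simp
    nlinarith [norm_nonneg T]
  have h0 := norm_nonneg T
  refine abs_le_of_sq_le_sq' ?_ (by positivity) |>.2
  rw [h1]
  nlinarith [mul_le_mul_of_nonneg_left h2 (sq_nonneg ‖T‖), sq_nonneg (‖T‖ ^ 2), sq_nonneg ‖T‖]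

theorem norm_root_le {M θ : ℂ} (h : DD M (Complex.exp θ) = 0) : ‖M‖ ≤ topH θ - 1 := by
  have hT : ‖Complex.exp θ‖ = Real.exp θ.re := Complex.norm_exp θ
  unfold topH
  rw [← hT]
  rcases mul_eq_zero.1 h with h | h
  · have := norm_le_of_sq_eq (A := M + 1) (T := Complex.exp θ) (-4) (by simp) (by linear_combination h)
    have h3 := norm_sub_le (M + 1) 1
    simp only [add_sub_cancel_right, norm_one] at h3
    linarith
  · have := norm_le_of_sq_eq (A := M - 1) (T := Complex.exp θ) 4 (by simp) (by linear_combination h)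
    have h3 := norm_add_le (M - 1) 1
    simp only [sub_add_cancel, norm_one] at h3
    linarith

theorem topH_pos (θ : ℂ) : 2 < topH θ := by
  have := Real.exp_pos θ.re
  unfold topH
  nlinarith

theorem far_subset : Far ⊆ UU := by
  intro p hp h
  have h1 := norm_root_le h
  have h2 := (Complex.abs_im_le_norm p.1)
  have h3 := le_abs_self p.1.im
  have : topH p.2 - 1 < p.1.im := hp
  linarith


theorem convex_far : Convex ℝ Far := by
  have h1 : ConvexOn ℝ univ fun x : ℝ => 1 + 2 * Real.exp x + Real.exp (2 * x) := by
    have h2 : ConvexOn ℝ univ fun x : ℝ => Real.exp (2 * x) :=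
      convexOn_exp.comp_linearMap (2 • LinearMap.id : ℝ →ₗ[ℝ] ℝ) |>.congr fun x _ => by simp
    have h3 := (convexOn_const (1 : ℝ) convex_univ).add
      ((convexOn_exp.smul (zero_le_two (α := ℝ))).add h2)
    refine h3.congr fun x _ => ?_
    simp [add_assoc]
  intro p hp q hq a b ha hb hab
  have h2 := h1.2 (mem_univ p.2.re) (mem_univ q.2.re) ha hb hab
  have e : ∀ x : ℝ, Real.exp (2 * x) = Real.exp x ^ 2 := fun x => by
    rw [← Real.exp_nat_mul]; norm_num
  simp only [Far, topH, mem_ofPred_eq, smul_eq_mul, Prod.snd_add, Prod.fst_add, Prod.smul_fst,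
    Prod.smul_snd, Complex.add_im, Complex.add_re, Complex.real_smul, Complex.re_ofReal_mul,
    Complex.im_ofReal_mul, e] at h2 hp hq ⊢
  rcases ha.eq_or_lt with rfl | ha'
  · obtain rfl : b = 1 := by linarith
    linarith
  · nlinarith [mul_lt_mul_of_pos_left hp ha', mul_le_mul_of_nonneg_left hq.le hb]

/-- `Φ` vanishes on curves in the far region. -/
def FarTrivial {G : Type*} [Group G] (Φ : PathHom UU G) : Prop :=
  ∀ (f : ℝ → ℂ × ℂ) (a b : ℝ), a ≤ b → CurveIn Far f a b → Φ.hol f a b = 1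

/-- The complex number with given real and imaginary parts. -/
def pt (x y : ℝ) : ℂ := ⟨x, y⟩

@[simp] theorem pt_re (x y : ℝ) : (pt x y).re = x := rfl
@[simp] theorem pt_im (x y : ℝ) : (pt x y).im = y := rfl

@[fun_prop] theorem continuous_pt : Continuous fun p : ℝ × ℝ => pt p.1 p.2 :=
  Complex.equivRealProdCLM.symm.continuous

@[fun_prop] theorem ContinuousOn.pt' {A : Type*} [TopologicalSpace A] {f g : A → ℝ} {s : Set A}
    (hf : ContinuousOn f s) (hg : ContinuousOn g s) : ContinuousOn (fun a => pt (f a) (g a)) s :=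
  continuous_pt.comp_continuousOn (hf.prodMk hg)

@[fun_prop] theorem Continuous.pt' {A : Type*} [TopologicalSpace A] {f g : A → ℝ}
    (hf : Continuous f) (hg : Continuous g) : Continuous (fun a => pt (f a) (g a)) :=
  continuous_pt.comp (hf.prodMk hg)

/-- Clamping to the unit interval. -/
def clamp (x : ℝ) : ℝ := max 0 (min x 1)

@[fun_prop] theorem continuous_clamp : Continuous clamp := by
  unfold clamp; fun_prop

theorem clamp_of_nonpos {x : ℝ} (h : x ≤ 0) : clamp x = 0 :=
  max_eq_left ((min_le_left _ _).trans h)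

theorem clamp_of_one_le {x : ℝ} (h : 1 ≤ x) : clamp x = 1 := by
  rw [clamp, min_eq_right h, max_eq_right zero_le_one]

theorem clamp_of_mem {x : ℝ} (h : 0 ≤ x) (h' : x ≤ 1) : clamp x = x := by
  rw [clamp, min_eq_left h', max_eq_right h]

/-- The U-shaped curve in the fibre over `θ` coming down the line `Re M = l`, running along the
height `h`, and going up the line `Re M = l'`. -/
def box (l l' h : ℝ) (θ : ℂ) (t : ℝ) : ℂ × ℂ :=
  (pt (l + (l' - l) * clamp (t - 1)) (h + (topH θ - h) * (1 - clamp t + clamp (t - 2))), θ)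

/-- No root of the fibre over `θ` lies on the U-shaped curve. -/
def Clear (l l' h : ℝ) (θ : ℂ) : Prop :=
  ∀ M, DD M (Complex.exp θ) = 0 → (M.re = l → M.im < h) ∧ (M.re = l' → M.im < h) ∧
    (M.im = h → ¬(l ≤ M.re ∧ M.re ≤ l'))

theorem im_lt_topH {M θ : ℂ} (h : DD M (Complex.exp θ) = 0) : M.im < topH θ - 1 / 2 := by
  have h1 := norm_root_le h
  have h2 := Complex.abs_im_le_norm M
  have h3 := le_abs_self M.im
  linarith

theorem box_mem {l l' h : ℝ} {θ : ℂ} (hl : l ≤ l') (hc : Clear l l' h θ) {t : ℝ}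
    (h0 : 0 ≤ t) (h3 : t ≤ 3) : box l l' h θ t ∈ UU := by
  intro hD
  obtain ⟨c1, c2, c3⟩ := hc _ hD
  have c4 := im_lt_topH hD
  simp only [box, pt_re, pt_im] at c1 c2 c3 c4
  rcases le_total t 1 with h1 | h1
  · rw [clamp_of_nonpos (by linarith : t - 1 ≤ 0), clamp_of_mem h0 h1,
      clamp_of_nonpos (by linarith : t - 2 ≤ 0)] at *
    have := c1 (by ring)
    rcases le_total (topH θ) h with h2 | h2
    · nlinarith [mul_nonneg (sub_nonneg.2 h2) h0]
    · nlinarith [mul_nonneg (sub_nonneg.2 h2) (sub_nonneg.2 h1)]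
  rcases le_total t 2 with h2 | h2
  · rw [clamp_of_mem (by linarith : 0 ≤ t - 1) (by linarith), clamp_of_one_le h1,
      clamp_of_nonpos (by linarith : t - 2 ≤ 0)] at *
    refine c3 (by ring) ⟨?_, ?_⟩ <;> nlinarith
  · rw [clamp_of_one_le (by linarith : 1 ≤ t - 1), clamp_of_one_le h1,
      clamp_of_mem (by linarith : 0 ≤ t - 2) (by linarith)] at *
    have := c2 (by ring)
    rcases le_total (topH θ) h with h4 | h4
    · nlinarith [mul_nonneg (sub_nonneg.2 h4) (by linarith : 0 ≤ 3 - t)]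
    · nlinarith [mul_nonneg (sub_nonneg.2 h4) (sub_nonneg.2 h2)]

theorem box_zero (l l' h : ℝ) (θ : ℂ) : box l l' h θ 0 = (pt l (topH θ), θ) := by
  simp [box, clamp_of_nonpos]

theorem box_three (l l' h : ℝ) (θ : ℂ) : box l l' h θ 3 = (pt l' (topH θ), θ) := by
  rw [box, clamp_of_one_le, clamp_of_one_le, clamp_of_one_le] <;> norm_num

theorem curveIn_box {l l' h : ℝ} {θ : ℂ} (hl : l ≤ l') (hc : Clear l l' h θ) :
    CurveIn UU (box l l' h θ) 0 3 :=
  ⟨by unfold box; fun_prop, fun _ ht => box_mem hl hc ht.1 ht.2⟩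

section

variable {G : Type*} [Group G] (Φ : PathHom UU G)

/-- The value of `Φ` on a U-shaped curve. -/
def bx (l l' h : ℝ) (θ : ℂ) : G := Φ.hol (box l l' h θ) 0 3

variable {Φ}

theorem bx_slide (hΦ : FarTrivial Φ) {l l' h : ℝ → ℝ} {θ : ℝ → ℂ}
    (hl : ContinuousOn l (Icc 0 1)) (hl' : ContinuousOn l' (Icc 0 1))
    (hh : ContinuousOn h (Icc 0 1)) (hθ : ContinuousOn θ (Icc 0 1))
    (hle : ∀ s ∈ Icc (0 : ℝ) 1, l s ≤ l' s)
    (hc : ∀ s ∈ Icc (0 : ℝ) 1, Clear (l s) (l' s) (h s) (θ s)) :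
    bx Φ (l 0) (l' 0) (h 0) (θ 0) = bx Φ (l 1) (l' 1) (h 1) (θ 1) := by
  have hfst : ∀ {X : Type} [TopologicalSpace X] {k : ℝ → X}, ContinuousOn k (Icc 0 1) →
      ContinuousOn (fun p : ℝ × ℝ => k p.1) (Icc 0 1 ×ˢ Icc 0 3) := fun hk =>
    hk.comp continuous_fst.continuousOn fun p hp => hp.1
  have h1 := hfst hl
  have h2 := hfst hl'
  have h3 := hfst hh
  have h4 := hfst hθ
  have h5 : ContinuousOn (fun p : ℝ × ℝ => topH (θ p.1)) (Icc 0 1 ×ˢ Icc 0 3) :=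
    continuous_topH.comp_continuousOn h4
  have h6 : ContinuousOn (fun s => topH (θ s)) (Icc 0 1) := continuous_topH.comp_continuousOn hθ
  refine Φ.hol_slide (H := fun p => box (l p.1) (l' p.1) (h p.1) (θ p.1) p.2) zero_le_one
    (by norm_num) ?_ ?_ ?_ ?_
  · have key : ∀ (L L' h k : ℝ × ℝ → ℝ) (θ : ℝ × ℝ → ℂ) (s : Set (ℝ × ℝ)), ContinuousOn L s →
        ContinuousOn L' s → ContinuousOn h s → ContinuousOn k s → ContinuousOn θ s →
        ContinuousOn (fun p => (pt (L p + (L' p - L p) * clamp (p.2 - 1))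
          (h p + (k p - h p) * (1 - clamp p.2 + clamp (p.2 - 2))), θ p)) s := by
      intros
      fun_prop
    exact key _ _ _ _ _ _ h1 h2 h3 h5 h4
  · exact fun p hp => box_mem (hle _ hp.1) (hc _ hp.1) hp.2.1 hp.2.2
  · simp only [box_zero]
    refine hΦ _ _ _ zero_le_one ⟨by fun_prop, fun t _ => ?_⟩
    simp [Far]
  · simp only [box_three]
    refine hΦ _ _ _ zero_le_one ⟨by fun_prop, fun t _ => ?_⟩
    simp [Far]

end

section

variable {G : Type*} [Group G] {Φ : PathHom UU G}

theorem Clear.mono {l l' h k k' : ℝ} {θ : ℂ} (hc : Clear l l' h θ)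
    (hk : Clear k k h θ) (hk' : Clear k' k' h θ) (h1 : l ≤ k) (h2 : k' ≤ l') :
    Clear k k' h θ := fun M hM =>
  ⟨(hk M hM).1, (hk' M hM).1, fun e i => (hc M hM).2.2 e ⟨h1.trans i.1, i.2.trans h2⟩⟩

theorem Clear.left {l l' h : ℝ} {θ : ℂ} (hc : Clear l l' h θ) : Clear l l h θ := fun M hM =>
  ⟨(hc M hM).1, (hc M hM).1, fun e i => by
    have := (hc M hM).1 (le_antisymm i.2 i.1); linarith⟩

theorem Clear.right {l l' h : ℝ} {θ : ℂ} (hc : Clear l l' h θ) : Clear l' l' h θ := fun M hM =>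
  ⟨(hc M hM).2.1, (hc M hM).2.1, fun e i => by
    have := (hc M hM).2.1 (le_antisymm i.2 i.1); linarith⟩

theorem Clear.curveIn {l l' h : ℝ} {θ : ℂ} (hc : Clear l l' h θ) :
    CurveIn UU (fun x : ℝ => (pt x h, θ)) l l' :=
  ⟨by fun_prop, fun t ht hD => (hc _ hD).2.2 rfl ht⟩

theorem bx_eq {l l' h : ℝ} {θ : ℂ} (hl : l ≤ l') (hc : Clear l l' h θ) :
    bx Φ l l' h θ = Φ.hol (box l l h θ) 0 1 * Φ.hol (fun x : ℝ => (pt x h, θ)) l l' *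
      (Φ.hol (box l' l' h θ) 0 1)⁻¹ := by
  have hC := curveIn_box hl hc
  rw [bx, ← Φ.hol_trans (by norm_num : (0 : ℝ) ≤ 2) (by norm_num) hC,
    ← Φ.hol_trans zero_le_one (by norm_num) (hC.mono le_rfl (by norm_num : (2 : ℝ) ≤ 3))]
  congr 2
  · refine Φ.hol_congr fun t ht => ?_
    simp [box, clamp_of_nonpos (show t - 1 ≤ 0 by linarith [ht.2])]
  · rw [← Φ.hol_comp (φ := fun t => l + (l' - l) * (t - 1)) (by norm_num : (1 : ℝ) ≤ 2)
      (by fun_prop) (fun t ht => ⟨?_, ?_⟩) hl hc.curveIn (by ring) (by ring)]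
    · refine Φ.hol_congr fun t ht => ?_
      simp [box, clamp_of_one_le ht.1, clamp_of_nonpos (show t - 2 ≤ 0 by linarith [ht.2]),
        clamp_of_mem (show 0 ≤ t - 1 by linarith [ht.1]) (by linarith [ht.2])]
    · have := ht.1
      have := ht.2
      nlinarith
    · have := ht.1
      have := ht.2
      nlinarith
  · rw [← Φ.hol_reverse (φ := fun t => 3 - t) (by norm_num : (2 : ℝ) ≤ 3) (by fun_prop)
      (fun t ht => ⟨by linarith [ht.2], by linarith [ht.1]⟩) zero_le_one
      ((curveIn_box le_rfl hc.right).mono le_rfl (by norm_num)) (by norm_num) (by norm_num)]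
    refine Φ.hol_congr fun t ht => ?_
    have h1 := ht.1
    have h2 := ht.2
    rw [box, box, clamp_of_one_le (by linarith : 1 ≤ t - 1), clamp_of_one_le (by linarith : 1 ≤ t),
      clamp_of_mem (by linarith : 0 ≤ t - 2) (by linarith),
      clamp_of_mem (by linarith : 0 ≤ 3 - t) (by linarith),
      clamp_of_nonpos (by linarith : 3 - t - 2 ≤ 0)]
    congr 2 <;> ring

theorem bx_mul {l l' l'' h : ℝ} {θ : ℂ} (hl : l ≤ l') (hl' : l' ≤ l'') (hc : Clear l l' h θ)
    (hc' : Clear l' l'' h θ) : bx Φ l l' h θ * bx Φ l' l'' h θ = bx Φ l l'' h θ := by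
  have hc'' : Clear l l'' h θ := fun M hM =>
    ⟨(hc M hM).1, (hc' M hM).2.1, fun e i => by
      rcases le_total M.re l' with h | h
      · exact (hc M hM).2.2 e ⟨i.1, h⟩
      · exact (hc' M hM).2.2 e ⟨h, i.2⟩⟩
  rw [bx_eq hl hc, bx_eq hl' hc', bx_eq (hl.trans hl') hc'',
    ← Φ.hol_trans hl hl' hc''.curveIn]
  group

/-- The roots of the fibre over `θ`, listed with possible repetitions. -/
def IsRoots (θ : ℂ) (z : Fin 4 → ℂ) : Prop :=
  ∀ M, DD M (Complex.exp θ) = 0 ↔ ∃ i, M = z i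

/-- The half-strip of width `η` around the vertical ray above `z` contains no root but `z`. -/
def Alone (θ z : ℂ) (η : ℝ) : Prop :=
  ∀ M, DD M (Complex.exp θ) = 0 → M ≠ z → -η ≤ M.im - z.im → η < |M.re - z.re|

theorem Alone.mono {θ z : ℂ} {η η' : ℝ} (h : Alone θ z η) (hη : η' ≤ η) : Alone θ z η' :=
  fun M hM hne hi => hη.trans_lt (h M hM hne (by linarith))

theorem Alone.clear {θ z : ℂ} {η : ℝ} (h : Alone θ z η) (hη : 0 < η) :
    Clear (z.re - η) (z.re + η) (z.im - η) θ := by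
  intro M hM
  by_cases e : M = z
  · subst e
    exact ⟨fun h => by linarith, fun h => by linarith, fun h => by linarith⟩
  have h1 := h M hM e
  refine ⟨fun hr => ?_, fun hr => ?_, fun hi i => ?_⟩
  · by_contra! hlt
    have := h1 (by linarith)
    rw [show M.re - z.re = -η by linarith, abs_neg, abs_of_pos hη] at this
    exact lt_irrefl _ this
  · by_contra! hlt
    have := h1 (by linarith)
    rw [show M.re - z.re = η by linarith, abs_of_pos hη] at this
    exact lt_irrefl _ this
  · exact absurd (abs_le.2 ⟨by linarith [i.1], by linarith [i.2]⟩) (h1 (by linarith)).not_ge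

variable (Φ) in
/-- `g` is the value of `Φ` on the meridian of the root `z` in the fibre over `θ` with tail going
vertically upwards. -/
def Mer (θ z : ℂ) (g : G) : Prop :=
  ∃ η > 0, Alone θ z η ∧ bx Φ (z.re - η) (z.re + η) (z.im - η) θ = g

theorem bx_eq_of_alone (hΦ : FarTrivial Φ) {θ z : ℂ} {η η' : ℝ} (h0 : 0 < η') (hη : η' ≤ η)
    (h : Alone θ z η) : bx Φ (z.re - η) (z.re + η) (z.im - η) θ =
      bx Φ (z.re - η') (z.re + η') (z.im - η') θ := by
  have key := bx_slide hΦ (l := fun s => z.re - (η + s * (η' - η)))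
    (l' := fun s => z.re + (η + s * (η' - η))) (h := fun s => z.im - (η + s * (η' - η)))
    (θ := fun _ => θ) (by fun_prop) (by fun_prop) (by fun_prop) (by fun_prop)
    (fun s hs => ?_) (fun s hs => ?_)
  · simpa using key
  · have := hs.1; have := hs.2
    nlinarith
  · have := hs.1; have := hs.2
    exact (h.mono (by nlinarith)).clear (by nlinarith)

theorem Mer.bx_eq (hΦ : FarTrivial Φ) {θ z : ℂ} {g : G} (h : Mer Φ θ z g) {η : ℝ} (h0 : 0 < η)
    (hη : Alone θ z η) : bx Φ (z.re - η) (z.re + η) (z.im - η) θ = g := by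
  obtain ⟨η', h0', hη', rfl⟩ := h
  rcases le_total η η' with h | h
  · rw [bx_eq_of_alone hΦ h0 h hη']
  · rw [bx_eq_of_alone hΦ h0' h hη]

theorem Mer.unique (hΦ : FarTrivial Φ) {θ z : ℂ} {g g' : G} (h : Mer Φ θ z g)
    (h' : Mer Φ θ z g') : g = g' := by
  obtain ⟨η, h0, hη, rfl⟩ := h
  exact h'.bx_eq hΦ h0 hη

/-- The root `b` is not on the vertical ray above `a`. -/
def NotAbove (a b : ℂ) : Prop := b.re = a.re → b.im < a.im

theorem exists_alone {θ : ℝ → ℂ} {z : Fin 4 → ℝ → ℂ} (hz : ∀ i, ContinuousOn (z i) (Icc 0 1))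
    (hr : ∀ s ∈ Icc (0 : ℝ) 1, IsRoots (θ s) fun i => z i s) (i : Fin 4)
    (h : ∀ s ∈ Icc (0 : ℝ) 1, ∀ j ≠ i, NotAbove (z i s) (z j s)) :
    ∃ η > 0, ∀ s ∈ Icc (0 : ℝ) 1, Alone (θ s) (z i s) η := by
  have h1 : ∀ j, ∃ η > 0, j ≠ i → ∀ s ∈ Icc (0 : ℝ) 1,
      η < max |(z j s).re - (z i s).re| ((z i s).im - (z j s).im) := by
    intro j
    by_cases hj : j = i
    · exact ⟨1, one_pos, fun h => absurd hj h⟩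
    have hcont : ContinuousOn (fun s => max |(z j s).re - (z i s).re| ((z i s).im - (z j s).im))
        (Icc (0 : ℝ) 1) := by
      have h1 := Complex.continuous_re.comp_continuousOn (hz i)
      have h2 := Complex.continuous_re.comp_continuousOn (hz j)
      have h3 := Complex.continuous_im.comp_continuousOn (hz i)
      have h4 := Complex.continuous_im.comp_continuousOn (hz j)
      exact (h2.sub h1).abs.sup (h3.sub h4)
    obtain ⟨s₀, hs₀, hmin⟩ := isCompact_Icc.exists_isMinOn ⟨0, by simp⟩ hcont
    have hpos : 0 < max |(z j s₀).re - (z i s₀).re| ((z i s₀).im - (z j s₀).im) := by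
      by_cases e : (z j s₀).re = (z i s₀).re
      · exact lt_max_of_lt_right (sub_pos.2 (h s₀ hs₀ j hj e))
      · exact lt_max_of_lt_left (abs_pos.2 (sub_ne_zero.2 e))
    exact ⟨_, half_pos hpos, fun _ s hs => (half_lt_self hpos).trans_le (hmin hs)⟩
  choose η h0 hη using h1
  obtain ⟨k, hk⟩ := Finite.exists_min η
  refine ⟨η k, h0 k, fun s hs M hM hne hi => ?_⟩
  obtain ⟨j, rfl⟩ := (hr s hs M).1 hM
  have hj : j ≠ i := fun e => hne (by rw [e])
  have := hη j hj s hs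
  rcases lt_max_iff.1 this with h | h
  · exact (hk j).trans_lt h
  · linarith [hk j]

theorem Mer.transport (hΦ : FarTrivial Φ) {θ : ℝ → ℂ} {z : Fin 4 → ℝ → ℂ}
    (hθ : ContinuousOn θ (Icc 0 1)) (hz : ∀ i, ContinuousOn (z i) (Icc 0 1))
    (hr : ∀ s ∈ Icc (0 : ℝ) 1, IsRoots (θ s) fun i => z i s) (i : Fin 4)
    (h : ∀ s ∈ Icc (0 : ℝ) 1, ∀ j ≠ i, NotAbove (z i s) (z j s)) {g : G}
    (hg : Mer Φ (θ 0) (z i 0) g) : Mer Φ (θ 1) (z i 1) g := by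
  obtain ⟨η, h0, hη⟩ := exists_alone hz hr i h
  refine ⟨η, h0, hη 1 (by simp), ?_⟩
  rw [← hg.bx_eq hΦ h0 (hη 0 (by simp))]
  have h1 := Complex.continuous_re.comp_continuousOn (hz i)
  have h2 := Complex.continuous_im.comp_continuousOn (hz i)
  exact (bx_slide hΦ (h1.sub continuousOn_const) (h1.add continuousOn_const)
    (h2.sub continuousOn_const) hθ (fun s hs => by simp; linarith)
    fun s hs => (hη s hs).clear h0).symm

theorem exists_mer (Φ : PathHom UU G) {θ : ℂ} {z : Fin 4 → ℂ} (hr : IsRoots θ z) (i : Fin 4)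
    (h : ∀ j ≠ i, NotAbove (z i) (z j)) : ∃ g, Mer Φ θ (z i) g := by
  obtain ⟨η, h0, hη⟩ := exists_alone (θ := fun _ => θ) (z := fun i _ => z i)
    (fun i => continuousOn_const) (fun _ _ => hr) i fun _ _ => h
  exact ⟨_, η, h0, hη 0 (by simp), rfl⟩

theorem Mer.bx_eq_of_unique (hΦ : FarTrivial Φ) {θ z : ℂ} {g : G} (hg : Mer Φ θ z g)
    {l l' h : ℝ} (hl : l < z.re) (hl' : z.re < l') (hh : h < z.im)
    (ho : ∀ M, DD M (Complex.exp θ) = 0 → M ≠ z → l ≤ M.re → M.re ≤ l' → M.im < h) :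
    bx Φ l l' h θ = g := by
  obtain ⟨η₀, h0, ha, -⟩ := hg.imp fun _ h => h
  obtain ⟨η, h0, hη, h1, h2, h3⟩ : ∃ η > 0, Alone θ z η ∧ l < z.re - η ∧ z.re + η < l' ∧
      h < z.im - η := by
    refine ⟨min η₀ (min (z.re - l) (min (l' - z.re) (z.im - h)) / 2), ?_,
      ha.mono (min_le_left _ _), ?_, ?_, ?_⟩
    · simp [h0, hl, hl', hh]
    all_goals
      have e1 := min_le_right η₀ (min (z.re - l) (min (l' - z.re) (z.im - h)) / 2)
      have e2 := min_le_left (z.re - l) (min (l' - z.re) (z.im - h))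
      have e3 := (min_le_right (z.re - l) (min (l' - z.re) (z.im - h))).trans (min_le_left _ _)
      have e4 := (min_le_right (z.re - l) (min (l' - z.re) (z.im - h))).trans (min_le_right _ _)
      linarith
  rw [← hg.bx_eq hΦ h0 hη]
  have key := bx_slide hΦ (l := fun s => l + s * (z.re - η - l))
    (l' := fun s => l' + s * (z.re + η - l')) (h := fun s => h + s * (z.im - η - h))
    (θ := fun _ => θ) (by fun_prop) (by fun_prop) (by fun_prop) (by fun_prop)
    (fun s hs => ?_) (fun s hs M hM => ?_)
  · simpa using key
  · have := hs.1; have := hs.2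
    nlinarith
  · have hs0 := hs.1; have hs1 := hs.2
    have b1 : l ≤ l + s * (z.re - η - l) := by nlinarith
    have b2 : l + s * (z.re - η - l) < z.re := by nlinarith
    have b3 : l' + s * (z.re + η - l') ≤ l' := by nlinarith
    have b4 : z.re < l' + s * (z.re + η - l') := by nlinarith
    have b5 : h ≤ h + s * (z.im - η - h) := by nlinarith
    have b6 : h + s * (z.im - η - h) < z.im := by nlinarith
    by_cases e : M = z
    · subst e
      exact ⟨fun h => by linarith, fun h => by linarith, fun h => by linarith⟩
    · have := ho M hM e
      refine ⟨fun hr => ?_, fun hr => ?_, fun hi i => ?_⟩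
      · exact (this (by linarith) (by linarith)).trans_le b5
      · exact (this (by linarith) (by linarith)).trans_le b5
      · linarith [this (by linarith [i.1]) (by linarith [i.2])]

variable (Φ) in
/-- The value of `Φ` on a large loop around all roots. -/
def total (θ : ℂ) : G := bx Φ (-topH θ) (topH θ) (-topH θ) θ

theorem root_bounds {M θ : ℂ} (h : DD M (Complex.exp θ) = 0) :
    -topH θ < M.re ∧ M.re < topH θ ∧ -topH θ < M.im := by
  have h1 := norm_root_le h
  have h2 := abs_le.1 (Complex.abs_im_le_norm M)
  have h3 := abs_le.1 (Complex.abs_re_le_norm M)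
  refine ⟨?_, ?_, ?_⟩ <;> linarith

theorem total_eq (hΦ : FarTrivial Φ) (θ θ' : ℂ) : total Φ θ = total Φ θ' := by
  have hθ : ContinuousOn (fun s : ℝ => θ + s * (θ' - θ)) (Icc 0 1) := by fun_prop
  have ht := continuous_topH.comp_continuousOn hθ
  have := bx_slide hΦ ht.neg ht ht.neg hθ (fun s hs => ?_) fun s hs M hM => ?_
  · simpa [total] using this
  · have := topH_pos (θ + s * (θ' - θ))
    show -topH (θ + s * (θ' - θ)) ≤ topH (θ + s * (θ' - θ))
    linarith
  · obtain ⟨h1, h2, h3⟩ := root_bounds hM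
    exact ⟨fun h => absurd h h1.ne', fun h => absurd h h2.ne, fun h => absurd h h3.ne'⟩

theorem mer_prod (hΦ : FarTrivial Φ) {θ z₀ z₁ z₂ z₃ : ℂ} (hr : IsRoots θ ![z₀, z₁, z₂, z₃])
    (h01 : z₀.re < z₁.re) (h12 : z₁.re < z₂.re) (h23 : z₂.re < z₃.re) {g₀ g₁ g₂ g₃ : G}
    (h0 : Mer Φ θ z₀ g₀) (h1 : Mer Φ θ z₁ g₁) (h2 : Mer Φ θ z₂ g₂) (h3 : Mer Φ θ z₃ g₃) :
    g₀ * g₁ * g₂ * g₃ = total Φ θ := by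
  have hcases : ∀ M, DD M (Complex.exp θ) = 0 → M = z₀ ∨ M = z₁ ∨ M = z₂ ∨ M = z₃ := by
    intro M hM
    obtain ⟨i, hi⟩ := (hr M).1 hM
    fin_cases i <;> simp at hi <;> simp [hi]
  have b0 := root_bounds ((hr _).2 ⟨0, rfl⟩)
  have b1 := root_bounds ((hr _).2 ⟨1, rfl⟩)
  have b2 := root_bounds ((hr _).2 ⟨2, rfl⟩)
  have b3 := root_bounds ((hr _).2 ⟨3, rfl⟩)
  simp only [Matrix.cons_val] at b0 b1 b2 b3
  have hC : ∀ l l', (∀ M, DD M (Complex.exp θ) = 0 → M.re ≠ l) →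
      (∀ M, DD M (Complex.exp θ) = 0 → M.re ≠ l') → Clear l l' (-topH θ) θ := fun l l' h h' M hM =>
    ⟨fun e => absurd e (h M hM), fun e => absurd e (h' M hM),
      fun e => absurd e (root_bounds hM).2.2.ne'⟩
  have n0 : ∀ M, DD M (Complex.exp θ) = 0 → M.re ≠ -topH θ := fun M hM => (root_bounds hM).1.ne'
  have n4 : ∀ M, DD M (Complex.exp θ) = 0 → M.re ≠ topH θ := fun M hM => (root_bounds hM).2.1.ne
  have n1 : ∀ M, DD M (Complex.exp θ) = 0 → M.re ≠ (z₀.re + z₁.re) / 2 := fun M hM e => by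
    rcases hcases M hM with rfl | rfl | rfl | rfl <;> linarith
  have n2 : ∀ M, DD M (Complex.exp θ) = 0 → M.re ≠ (z₁.re + z₂.re) / 2 := fun M hM e => by
    rcases hcases M hM with rfl | rfl | rfl | rfl <;> linarith
  have n3 : ∀ M, DD M (Complex.exp θ) = 0 → M.re ≠ (z₂.re + z₃.re) / 2 := fun M hM e => by
    rcases hcases M hM with rfl | rfl | rfl | rfl <;> linarith
  rw [← h0.bx_eq_of_unique hΦ (l := -topH θ) (l' := (z₀.re + z₁.re) / 2) (h := -topH θ)
      (by linarith) (by linarith) (by linarith) ?_,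
    ← h1.bx_eq_of_unique hΦ (l := (z₀.re + z₁.re) / 2) (l' := (z₁.re + z₂.re) / 2)
      (h := -topH θ) (by linarith) (by linarith) (by linarith) ?_,
    ← h2.bx_eq_of_unique hΦ (l := (z₁.re + z₂.re) / 2) (l' := (z₂.re + z₃.re) / 2)
      (h := -topH θ) (by linarith) (by linarith) (by linarith) ?_,
    ← h3.bx_eq_of_unique hΦ (l := (z₂.re + z₃.re) / 2) (l' := topH θ)
      (h := -topH θ) (by linarith) (by linarith) (by linarith) ?_,
    bx_mul (by linarith) (by linarith) (hC _ _ n0 n1) (hC _ _ n1 n2),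
    bx_mul (by linarith) (by linarith) (hC _ _ n0 n2) (hC _ _ n2 n3),
    bx_mul (by linarith) (by linarith) (hC _ _ n0 n3) (hC _ _ n3 n4), total]
  all_goals
    intro M hM hne hl hl'
    rcases hcases M hM with rfl | rfl | rfl | rfl
    all_goals first | exact absurd rfl hne | (exfalso; linarith)

end

/-- The principal square root. -/
def csq (z : ℂ) : ℂ := Complex.exp (Complex.log z / 2)

theorem csq_sq {z : ℂ} (h : z ≠ 0) : csq z ^ 2 = z := by
  rw [csq, ← Complex.exp_nat_mul]
  push_cast
  rw [mul_div_cancel₀ _ two_ne_zero, Complex.exp_log h]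

theorem continuousAt_csq {z : ℂ} (h : z ∈ Complex.slitPlane) : ContinuousAt csq z := by
  unfold csq
  exact ((continuousAt_clog h).div_const 2).cexp

theorem ContinuousOn.csq' {A : Type*} [TopologicalSpace A] {f : A → ℂ} {s : Set A}
    (hf : ContinuousOn f s) (h : ∀ a ∈ s, f a ∈ Complex.slitPlane) :
    ContinuousOn (fun a => csq (f a)) s := fun a ha =>
  (continuousAt_csq (h a ha)).comp_continuousWithinAt (hf a ha)

theorem csq_re_pos {z : ℂ} (h : z ∈ Complex.slitPlane) : 0 < (csq z).re := by
  rw [csq, Complex.exp_re]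
  refine mul_pos (Real.exp_pos _) (Real.cos_pos_of_mem_Ioo ?_)
  have h1 := Complex.neg_pi_lt_arg z
  have h2 := (Complex.arg_le_pi z).lt_of_ne (Complex.slitPlane_arg_ne_pi h)
  rw [show (Complex.log z / 2).im = z.arg / 2 by
    rw [Complex.div_ofNat_im, Complex.log_im]]
  constructor <;> linarith

theorem eq_of_sq_eq_of_re_pos {a b : ℂ} (h : a ^ 2 = b ^ 2) (ha : 0 < a.re) (hb : 0 < b.re) :
    a = b := by
  rcases sq_eq_sq_iff_eq_or_eq_neg.1 h with h | h
  · exact h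
  · rw [h, Complex.neg_re] at ha
    linarith

theorem csq_eq {z b : ℂ} (hz : z ∈ Complex.slitPlane) (hb : 0 < b.re) (h : b ^ 2 = z) :
    csq z = b :=
  eq_of_sq_eq_of_re_pos ((csq_sq (Complex.slitPlane_ne_zero hz)).trans h.symm) (csq_re_pos hz) hb

theorem csq_ofReal {x : ℝ} (hx : 0 < x) : csq x = (√x : ℝ) :=
  csq_eq (Complex.ofReal_mem_slitPlane.2 hx) (by simpa using hx)
    (by rw [← Complex.ofReal_pow, Real.sq_sqrt hx.le])

theorem isRoots_log {T u w : ℂ} (hT : T ≠ 0) (hu : u ^ 2 = 3 - 4 * T) (hw : w ^ 2 = 3 + 4 * T) :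
    IsRoots (Complex.log T) ![-1 - T * u, -1 + T * u, 1 + T * w, 1 - T * w] := by
  intro M
  rw [Complex.exp_log hT, show DD M T = (M - (-1 - T * u)) * (M - (-1 + T * u)) *
    ((M - (1 + T * w)) * (M - (1 - T * w))) by
      rw [DD, ← hu, ← hw]; ring]
  simp [Fin.exists_fin_succ, sub_eq_zero, or_assoc, mul_eq_zero]

theorem IsRoots.comp_equiv {θ : ℂ} {z : Fin 4 → ℂ} (h : IsRoots θ z) (e : Fin 4 ≃ Fin 4) :
    IsRoots θ (z ∘ e) := fun M => (h M).trans
  ⟨fun ⟨i, hi⟩ => ⟨e.symm i, by simpa⟩, fun ⟨i, hi⟩ => ⟨e i, hi⟩⟩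

theorem IsRoots.swap12 {θ a b c d : ℂ} (h : IsRoots θ ![a, b, c, d]) : IsRoots θ ![a, c, b, d] := by
  have := h.comp_equiv (Equiv.swap 1 2)
  convert this using 1
  ext i
  fin_cases i <;> rfl

theorem IsRoots.swap23 {θ a b c d : ℂ} (h : IsRoots θ ![a, b, c, d]) : IsRoots θ ![a, b, d, c] := by
  have := h.comp_equiv (Equiv.swap 2 3)
  convert this using 1
  ext i
  fin_cases i <;> rfl

section

variable {G : Type*} [Group G] {Φ : PathHom UU G}

theorem notAbove_of_re_ne {a b : ℂ} (h : b.re ≠ a.re) : NotAbove a b := fun h' => absurd h' h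

/-- The roots of the fibre over `θ`, ordered by their real parts, together with the values of `Φ`
on their meridians. -/
structure Quad (Φ : PathHom UU G) (θ : ℂ) (z₀ z₁ z₂ z₃ : ℂ) (g₀ g₁ g₂ g₃ : G) : Prop where
  roots : IsRoots θ ![z₀, z₁, z₂, z₃]
  h01 : z₀.re < z₁.re
  h12 : z₁.re < z₂.re
  h23 : z₂.re < z₃.re
  m0 : Mer Φ θ z₀ g₀
  m1 : Mer Φ θ z₁ g₁
  m2 : Mer Φ θ z₂ g₂
  m3 : Mer Φ θ z₃ g₃

theorem Quad.prod (hΦ : FarTrivial Φ) {θ z₀ z₁ z₂ z₃ : ℂ} {g₀ g₁ g₂ g₃ : G}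
    (h : Quad Φ θ z₀ z₁ z₂ z₃ g₀ g₁ g₂ g₃) : g₀ * g₁ * g₂ * g₃ = total Φ θ :=
  mer_prod hΦ h.roots h.h01 h.h12 h.h23 h.m0 h.m1 h.m2 h.m3

theorem exists_quad (Φ : PathHom UU G) {θ z₀ z₁ z₂ z₃ : ℂ} (hr : IsRoots θ ![z₀, z₁, z₂, z₃])
    (h01 : z₀.re < z₁.re) (h12 : z₁.re < z₂.re) (h23 : z₂.re < z₃.re) :
    ∃ g₀ g₁ g₂ g₃, Quad Φ θ z₀ z₁ z₂ z₃ g₀ g₁ g₂ g₃ := by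
  have key : ∀ i, ∃ g, Mer Φ θ ((![z₀, z₁, z₂, z₃] : Fin 4 → ℂ) i) g := fun i =>
    exists_mer Φ hr i fun j hj => notAbove_of_re_ne <| by
      fin_cases i <;> fin_cases j <;>
        first
          | exact absurd rfl hj
          | (simp only [Fin.reduceFinMk, Matrix.cons_val, Fin.zero_eta, Fin.mk_one, Fin.isValue]
             intro h; linarith)
  obtain ⟨g₀, h0⟩ := key 0
  obtain ⟨g₁, h1⟩ := key 1
  obtain ⟨g₂, h2⟩ := key 2
  obtain ⟨g₃, h3⟩ := key 3
  exact ⟨g₀, g₁, g₂, g₃, hr, h01, h12, h23, h0, h1, h2, h3⟩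

/-- A continuous family of fibres with a continuous listing of the roots. -/
structure Family (θ z₀ z₁ z₂ z₃ : ℝ → ℂ) : Prop where
  cθ : ContinuousOn θ (Icc 0 1)
  c0 : ContinuousOn z₀ (Icc 0 1)
  c1 : ContinuousOn z₁ (Icc 0 1)
  c2 : ContinuousOn z₂ (Icc 0 1)
  c3 : ContinuousOn z₃ (Icc 0 1)
  roots : ∀ s ∈ Icc (0 : ℝ) 1, IsRoots (θ s) ![z₀ s, z₁ s, z₂ s, z₃ s]

variable {θ z₀ z₁ z₂ z₃ : ℝ → ℂ} {g₀ g₁ g₂ g₃ : G}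

theorem Family.swap12 (F : Family θ z₀ z₁ z₂ z₃) : Family θ z₀ z₂ z₁ z₃ :=
  ⟨F.cθ, F.c0, F.c2, F.c1, F.c3, fun s hs => (F.roots s hs).swap12⟩

theorem Family.swap23 (F : Family θ z₀ z₁ z₂ z₃) : Family θ z₀ z₁ z₃ z₂ :=
  ⟨F.cθ, F.c0, F.c1, F.c3, F.c2, fun s hs => (F.roots s hs).swap23⟩

theorem Family.transport (F : Family θ z₀ z₁ z₂ z₃) (hΦ : FarTrivial Φ) (i : Fin 4)
    (h : ∀ s ∈ Icc (0 : ℝ) 1, ∀ j ≠ i,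
      NotAbove ((![z₀ s, z₁ s, z₂ s, z₃ s] : Fin 4 → ℂ) i) ((![z₀ s, z₁ s, z₂ s, z₃ s] : Fin 4 → ℂ) j))
    {g : G} (hg : Mer Φ (θ 0) ((![z₀ 0, z₁ 0, z₂ 0, z₃ 0] : Fin 4 → ℂ) i) g) :
    Mer Φ (θ 1) ((![z₀ 1, z₁ 1, z₂ 1, z₃ 1] : Fin 4 → ℂ) i) g := by
  refine Mer.transport hΦ F.cθ (z := fun i s => (![z₀ s, z₁ s, z₂ s, z₃ s] : Fin 4 → ℂ) i)
    (fun j => ?_) F.roots i h hg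
  fin_cases j
  exacts [F.c0, F.c1, F.c2, F.c3]

theorem Family.transport0 (F : Family θ z₀ z₁ z₂ z₃) (hΦ : FarTrivial Φ)
    (h : ∀ s ∈ Icc (0 : ℝ) 1, NotAbove (z₀ s) (z₁ s) ∧ NotAbove (z₀ s) (z₂ s) ∧
      NotAbove (z₀ s) (z₃ s)) (hg : Mer Φ (θ 0) (z₀ 0) g₀) : Mer Φ (θ 1) (z₀ 1) g₀ := by
  refine F.transport hΦ 0 (fun s hs j hj => ?_) hg
  obtain ⟨h1, h2, h3⟩ := h s hs
  fin_cases j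
  exacts [absurd rfl hj, h1, h2, h3]

theorem Family.transport1 (F : Family θ z₀ z₁ z₂ z₃) (hΦ : FarTrivial Φ)
    (h : ∀ s ∈ Icc (0 : ℝ) 1, NotAbove (z₁ s) (z₀ s) ∧ NotAbove (z₁ s) (z₂ s) ∧
      NotAbove (z₁ s) (z₃ s)) (hg : Mer Φ (θ 0) (z₁ 0) g₁) : Mer Φ (θ 1) (z₁ 1) g₁ := by
  refine F.transport hΦ 1 (fun s hs j hj => ?_) hg
  obtain ⟨h1, h2, h3⟩ := h s hs
  fin_cases j
  exacts [h1, absurd rfl hj, h2, h3]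

theorem Family.transport2 (F : Family θ z₀ z₁ z₂ z₃) (hΦ : FarTrivial Φ)
    (h : ∀ s ∈ Icc (0 : ℝ) 1, NotAbove (z₂ s) (z₀ s) ∧ NotAbove (z₂ s) (z₁ s) ∧
      NotAbove (z₂ s) (z₃ s)) (hg : Mer Φ (θ 0) (z₂ 0) g₂) : Mer Φ (θ 1) (z₂ 1) g₂ :=
  F.swap12.transport1 hΦ h hg

theorem Family.transport3 (F : Family θ z₀ z₁ z₂ z₃) (hΦ : FarTrivial Φ)
    (h : ∀ s ∈ Icc (0 : ℝ) 1, NotAbove (z₃ s) (z₀ s) ∧ NotAbove (z₃ s) (z₁ s) ∧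
      NotAbove (z₃ s) (z₂ s)) (hg : Mer Φ (θ 0) (z₃ 0) g₃) : Mer Φ (θ 1) (z₃ 1) g₃ :=
  F.swap23.transport2 hΦ h hg

theorem Family.slide (F : Family θ z₀ z₁ z₂ z₃) (hΦ : FarTrivial Φ)
    (h01 : ∀ s ∈ Icc (0 : ℝ) 1, (z₀ s).re < (z₁ s).re)
    (h12 : ∀ s ∈ Icc (0 : ℝ) 1, (z₁ s).re < (z₂ s).re)
    (h23 : ∀ s ∈ Icc (0 : ℝ) 1, (z₂ s).re < (z₃ s).re)
    (h : Quad Φ (θ 0) (z₀ 0) (z₁ 0) (z₂ 0) (z₃ 0) g₀ g₁ g₂ g₃) :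
    Quad Φ (θ 1) (z₀ 1) (z₁ 1) (z₂ 1) (z₃ 1) g₀ g₁ g₂ g₃ := by
  refine ⟨F.roots 1 (by simp), h01 1 (by simp), h12 1 (by simp), h23 1 (by simp),
    F.transport0 hΦ (fun s hs => ?_) h.m0, F.transport1 hΦ (fun s hs => ?_) h.m1,
    F.transport2 hΦ (fun s hs => ?_) h.m2, F.transport3 hΦ (fun s hs => ?_) h.m3⟩
  all_goals
    have := h01 s hs
    have := h12 s hs
    have := h23 s hs
    refine ⟨notAbove_of_re_ne ?_, notAbove_of_re_ne ?_, notAbove_of_re_ne ?_⟩ <;>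
    · intro; linarith

/-- The middle two roots make a half turn, the right one passing above. -/
theorem Family.swap_right (F : Family θ z₀ z₁ z₂ z₃) (hΦ : FarTrivial Φ)
    (h01 : ∀ s ∈ Icc (0 : ℝ) 1, (z₀ s).re < (z₁ s).re ∧ (z₀ s).re < (z₂ s).re)
    (h23 : ∀ s ∈ Icc (0 : ℝ) 1, (z₁ s).re < (z₃ s).re ∧ (z₂ s).re < (z₃ s).re)
    (htop : ∀ s ∈ Icc (0 : ℝ) 1, NotAbove (z₂ s) (z₁ s)) (h1 : (z₂ 1).re < (z₁ 1).re)
    (h : Quad Φ (θ 0) (z₀ 0) (z₁ 0) (z₂ 0) (z₃ 0) g₀ g₁ g₂ g₃) :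
    Quad Φ (θ 1) (z₀ 1) (z₂ 1) (z₁ 1) (z₃ 1) g₀ g₂ (g₂⁻¹ * g₁ * g₂) g₃ := by
  have m0 : Mer Φ (θ 1) (z₀ 1) g₀ := F.transport0 hΦ (fun s hs => by
    obtain ⟨a, b⟩ := h01 s hs
    obtain ⟨c, d⟩ := h23 s hs
    exact ⟨notAbove_of_re_ne a.ne', notAbove_of_re_ne b.ne',
      notAbove_of_re_ne (a.trans c).ne'⟩) h.m0
  have m3 : Mer Φ (θ 1) (z₃ 1) g₃ := F.transport3 hΦ (fun s hs => by
    obtain ⟨a, b⟩ := h01 s hs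
    obtain ⟨c, d⟩ := h23 s hs
    exact ⟨notAbove_of_re_ne (a.trans c).ne, notAbove_of_re_ne c.ne, notAbove_of_re_ne d.ne⟩) h.m3
  have m2 : Mer Φ (θ 1) (z₂ 1) g₂ := F.transport2 hΦ (fun s hs => by
    obtain ⟨a, b⟩ := h01 s hs
    obtain ⟨c, d⟩ := h23 s hs
    exact ⟨notAbove_of_re_ne b.ne, htop s hs, notAbove_of_re_ne d.ne'⟩) h.m2
  obtain ⟨k₀, k₂, k₁, k₃, hk⟩ := exists_quad Φ (F.swap12.roots 1 (by simp)) (h01 1 (by simp)).2 h1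
    (h23 1 (by simp)).1
  obtain rfl := hk.m0.unique hΦ m0
  obtain rfl := hk.m3.unique hΦ m3
  obtain rfl := hk.m1.unique hΦ m2
  have e := (h.prod hΦ).trans ((total_eq hΦ _ _).trans (hk.prod hΦ).symm)
  have e2 : g₁ * k₂ = k₂ * k₁ := mul_right_cancel (b := k₃) (by simpa [mul_assoc] using e)
  rwa [mul_assoc, e2, inv_mul_cancel_left]

/-- The middle two roots make a half turn, the left one passing above. -/
theorem Family.swap_left (F : Family θ z₀ z₁ z₂ z₃) (hΦ : FarTrivial Φ)
    (h01 : ∀ s ∈ Icc (0 : ℝ) 1, (z₀ s).re < (z₁ s).re ∧ (z₀ s).re < (z₂ s).re)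
    (h23 : ∀ s ∈ Icc (0 : ℝ) 1, (z₁ s).re < (z₃ s).re ∧ (z₂ s).re < (z₃ s).re)
    (htop : ∀ s ∈ Icc (0 : ℝ) 1, NotAbove (z₁ s) (z₂ s)) (h1 : (z₂ 1).re < (z₁ 1).re)
    (h : Quad Φ (θ 0) (z₀ 0) (z₁ 0) (z₂ 0) (z₃ 0) g₀ g₁ g₂ g₃) :
    Quad Φ (θ 1) (z₀ 1) (z₂ 1) (z₁ 1) (z₃ 1) g₀ (g₁ * g₂ * g₁⁻¹) g₁ g₃ := by
  have m0 : Mer Φ (θ 1) (z₀ 1) g₀ := F.transport0 hΦ (fun s hs => by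
    obtain ⟨a, b⟩ := h01 s hs
    obtain ⟨c, d⟩ := h23 s hs
    exact ⟨notAbove_of_re_ne a.ne', notAbove_of_re_ne b.ne',
      notAbove_of_re_ne (a.trans c).ne'⟩) h.m0
  have m3 : Mer Φ (θ 1) (z₃ 1) g₃ := F.transport3 hΦ (fun s hs => by
    obtain ⟨a, b⟩ := h01 s hs
    obtain ⟨c, d⟩ := h23 s hs
    exact ⟨notAbove_of_re_ne (a.trans c).ne, notAbove_of_re_ne c.ne, notAbove_of_re_ne d.ne⟩) h.m3
  have m1 : Mer Φ (θ 1) (z₁ 1) g₁ := F.transport1 hΦ (fun s hs => by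
    obtain ⟨a, b⟩ := h01 s hs
    obtain ⟨c, d⟩ := h23 s hs
    exact ⟨notAbove_of_re_ne a.ne, htop s hs, notAbove_of_re_ne c.ne'⟩) h.m1
  obtain ⟨k₀, k₂, k₁, k₃, hk⟩ := exists_quad Φ (F.swap12.roots 1 (by simp)) (h01 1 (by simp)).2 h1
    (h23 1 (by simp)).1
  obtain rfl := hk.m0.unique hΦ m0
  obtain rfl := hk.m3.unique hΦ m3
  obtain rfl := hk.m2.unique hΦ m1
  have e := (h.prod hΦ).trans ((total_eq hΦ _ _).trans (hk.prod hΦ).symm)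
  have e2 : k₁ * g₂ = k₂ * k₁ := mul_right_cancel (b := k₃) (by simpa [mul_assoc] using e)
  rwa [e2, mul_inv_cancel_right]

end

/-- The first of the four roots of the fibre over `log T`. -/
def pm (T : ℂ) : ℂ := -1 - T * csq (3 - 4 * T)
/-- The second root of the fibre over `log T`. -/
def pp (T : ℂ) : ℂ := -1 + T * csq (3 - 4 * T)
/-- The third root of the fibre over `log T`. -/
def qp (T : ℂ) : ℂ := 1 + T * csq (3 + 4 * T)
/-- The fourth root of the fibre over `log T`. -/
def qm (T : ℂ) : ℂ := 1 - T * csq (3 + 4 * T)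

/-- The domain on which the four roots are given by principal square roots. -/
def Dom : Set ℂ := {T | T ∈ Complex.slitPlane ∧ 3 - 4 * T ∈ Complex.slitPlane ∧
  3 + 4 * T ∈ Complex.slitPlane}

theorem mem_dom_of_im {T : ℂ} (h : T.im ≠ 0) : T ∈ Dom := by
  refine ⟨Or.inr h, Or.inr ?_, Or.inr ?_⟩ <;> simpa

theorem mem_dom_of_re {T : ℂ} (h : 0 < T.re) (h' : T.re < 3 / 4) : T ∈ Dom := by
  refine ⟨Or.inl h, Or.inl ?_, Or.inl ?_⟩ <;> simp <;> linarith

theorem csq_sub_sq {T : ℂ} (h : T ∈ Dom) : csq (3 - 4 * T) ^ 2 = 3 - 4 * T :=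
  csq_sq (Complex.slitPlane_ne_zero h.2.1)

theorem csq_add_sq {T : ℂ} (h : T ∈ Dom) : csq (3 + 4 * T) ^ 2 = 3 + 4 * T :=
  csq_sq (Complex.slitPlane_ne_zero h.2.2)

theorem isRoots_of_dom {T : ℂ} (h : T ∈ Dom) :
    IsRoots (Complex.log T) ![pm T, pp T, qp T, qm T] :=
  isRoots_log (Complex.slitPlane_ne_zero h.1) (csq_sub_sq h) (csq_add_sq h)

theorem family_of_dom {T : ℝ → ℂ} (hT : ContinuousOn T (Icc 0 1))
    (h : ∀ s ∈ Icc (0 : ℝ) 1, T s ∈ Dom) :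
    Family (fun s => Complex.log (T s)) (fun s => pm (T s)) (fun s => pp (T s))
      (fun s => qp (T s)) (fun s => qm (T s)) := by
  have hu : ContinuousOn (fun s => csq (3 - 4 * T s)) (Icc 0 1) :=
    ContinuousOn.csq' (by fun_prop) fun s hs => (h s hs).2.1
  have hw : ContinuousOn (fun s => csq (3 + 4 * T s)) (Icc 0 1) :=
    ContinuousOn.csq' (by fun_prop) fun s hs => (h s hs).2.2
  unfold pm pp qp qm
  exact ⟨hT.clog fun s hs => (h s hs).1, by fun_prop, by fun_prop, by fun_prop, by fun_prop,
    fun s hs => isRoots_of_dom (h s hs)⟩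

theorem prod_roots_diff {T u w : ℂ} (hu : u ^ 2 = 3 - 4 * T) (hw : w ^ 2 = 3 + 4 * T) :
    (4 - T ^ 2 * (u - w) ^ 2) * (4 - T ^ 2 * (u + w) ^ 2) =
      16 * (T ^ 2 + 1) * (2 * T ^ 2 - 1) ^ 2 := by
  have h1 : u ^ 2 + w ^ 2 = 6 := by rw [hu, hw]; ring
  have h2 : u ^ 2 - w ^ 2 = -8 * T := by rw [hu, hw]; ring
  linear_combination (-8 * T ^ 2) * h1 + T ^ 4 * (u ^ 2 - w ^ 2 - 8 * T) * h2

theorem im_pos_of_eq_mul {Z h g : ℂ} (hg : g = Z * h) (hZ : 0 ≤ Z.im) (hZ0 : Z ≠ 0)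
    (hh : 0 < h.re) (h0 : g.re = 0) : 0 < g.im := by
  have e : Z.im * (h.re ^ 2 + h.im ^ 2) = g.im * h.re - g.re * h.im := by
    rw [hg]; simp only [Complex.mul_re, Complex.mul_im]; ring
  rw [h0] at e
  have hg0 : g ≠ 0 := by
    rw [hg]
    exact mul_ne_zero hZ0 fun h => by simp [h] at hh
  have h1 : 0 ≤ g.im * h.re := by nlinarith [sq_nonneg h.re, sq_nonneg h.im]
  have h2 : 0 ≤ g.im := nonneg_of_mul_nonneg_left h1 hh
  exact h2.lt_of_ne fun h3 => hg0 (Complex.ext h0 h3.symm)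

theorem notAbove_of_diff {a b Z h : ℂ} (e : b - a = Z * h) (hZ : Z.im ≤ 0) (hZ0 : Z ≠ 0)
    (hh : 0 < h.re) : NotAbove a b := fun h0 => by
  have := im_pos_of_eq_mul (Z := -Z) (h := h) (g := a - b) (by linear_combination -e)
    (by simpa) (neg_ne_zero.2 hZ0) hh (by simp [h0])
  simpa using this

theorem quarter {T : ℂ} (h : T ∈ Dom) (hre : 0 ≤ T.re) (him : 0 ≤ T.im) :
    0 < (T * csq (3 - 4 * T)).re ∧ 0 ≤ (T * csq (3 + 4 * T)).im ∧
      ((T * csq (3 + 4 * T)).re ≤ 0 → 0 < (T * csq (3 + 4 * T)).im) := by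
  have hu := csq_sub_sq h
  have hw := csq_add_sq h
  have hu0 := csq_re_pos h.2.1
  have hw0 := csq_re_pos h.2.2
  generalize csq (3 - 4 * T) = u at *
  generalize csq (3 + 4 * T) = w at *
  have e1 : 2 * (u.re * u.im) = -4 * T.im := by
    have := congrArg Complex.im hu
    simp [sq, Complex.mul_im] at this
    linarith
  have e2 : 2 * (w.re * w.im) = 4 * T.im := by
    have := congrArg Complex.im hw
    simp [sq, Complex.mul_im] at this
    linarith
  have hui : u.im ≤ 0 := by by_contra! hc; nlinarith [mul_pos hu0 hc]
  have hwi : 0 ≤ w.im := by by_contra! hc; nlinarith [mul_pos hw0 (neg_pos.2 hc)]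
  have hT0 : T ≠ 0 := Complex.slitPlane_ne_zero h.1
  have hcase : 0 < T.re ∨ 0 < T.im := by
    by_contra! hc
    exact hT0 (Complex.ext (le_antisymm hc.1 hre) (le_antisymm hc.2 him))
  simp only [Complex.mul_re, Complex.mul_im]
  refine ⟨?_, by positivity, fun hle => ?_⟩
  · rcases hcase with hc | hc
    · nlinarith [mul_pos hc hu0, mul_nonneg him (neg_nonneg.2 hui)]
    · have : u.im < 0 := by by_contra! h'; nlinarith [mul_nonneg hu0.le h']
      nlinarith [mul_nonneg hre hu0.le, mul_pos hc (neg_pos.2 this)]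
  · rcases him.eq_or_lt with hc | hc
    · rw [← hc] at hle hcase
      have := hcase.resolve_right (lt_irrefl _)
      nlinarith [mul_pos this hw0]
    · nlinarith [mul_nonneg hre hwi, mul_pos hc hw0]

theorem imaginary_axis {y : ℝ} (h0 : 0 < y) (h1 : y < 1) :
    (pm (y * Complex.I)).re < (pp (y * Complex.I)).re ∧
    (pp (y * Complex.I)).re < (qp (y * Complex.I)).re ∧
    (qp (y * Complex.I)).re < (qm (y * Complex.I)).re := by
  have hD : (y * Complex.I : ℂ) ∈ Dom := mem_dom_of_im (by simpa using h0.ne')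
  obtain ⟨hp, -, -⟩ := quarter hD (by simp) (by simpa using h0.le)
  have hw : csq (3 + 4 * (y * Complex.I)) = (starRingEnd ℂ) (csq (3 - 4 * (y * Complex.I))) := by
    refine csq_eq hD.2.2 (by simpa using csq_re_pos hD.2.1) ?_
    rw [← map_pow, csq_sub_sq hD]
    apply Complex.ext <;> simp
  have hu := csq_sub_sq hD
  have hu0 := csq_re_pos hD.2.1
  rw [pm, pp, qp, qm, hw]
  generalize csq (3 - 4 * (y * Complex.I)) = u at *
  have e1 : u.re * u.im = -2 * y := by
    have := congrArg Complex.im hu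
    simp [sq, Complex.mul_im] at this
    linarith
  have e2 : u.re ^ 2 - u.im ^ 2 = 3 := by
    have := congrArg Complex.re hu
    simp [sq, Complex.mul_re] at this
    linarith
  simp only [Complex.sub_re, Complex.add_re, Complex.neg_re, Complex.one_re, Complex.mul_re,
    Complex.mul_im, Complex.ofReal_re, Complex.ofReal_im, Complex.I_re, Complex.I_im,
    Complex.conj_re, Complex.conj_im] at hp ⊢
  have key : -u.im * y < 1 := by
    by_contra! hc
    have hb : 1 < -u.im := by nlinarith
    have ha : 2 < u.re := by nlinarith
    nlinarith
  refine ⟨?_, ?_, ?_⟩ <;> linarith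

/-- The circle arguments used for the half turns. -/
def arcpt (c : ℂ) (k : ℝ) (s : ℝ) : ℂ := c * Complex.exp (k * s * Real.pi * Complex.I)

theorem continuous_arcpt (c : ℂ) (k : ℝ) : Continuous (arcpt c k) := by
  unfold arcpt; fun_prop

theorem norm_arcpt (c : ℂ) (k s : ℝ) : ‖arcpt c k s‖ = ‖c‖ := by
  rw [arcpt, norm_mul, Complex.norm_exp]
  simp

theorem arcpt_zero (c : ℂ) (k : ℝ) : arcpt c k 0 = c := by simp [arcpt]

theorem arcpt_ne_zero {c : ℂ} (hc : c ≠ 0) (k s : ℝ) : arcpt c k s ≠ 0 :=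
  mul_ne_zero hc (Complex.exp_ne_zero _)

theorem arcpt_one_one (c : ℂ) : arcpt c 1 1 = -c := by
  simp [arcpt, Complex.exp_pi_mul_I]

theorem arcpt_one_neg (c : ℂ) : arcpt c (-1) 1 = -c := by
  simp [arcpt, Complex.exp_neg, Complex.exp_pi_mul_I]

theorem arcpt_half_sq (c : ℂ) (k s : ℝ) : arcpt c (k / 2) s ^ 2 = arcpt (c ^ 2) k s := by
  rw [arcpt, arcpt, mul_pow, ← Complex.exp_nat_mul]
  congr 2
  push_cast
  ring

theorem arcpt_im {r k s : ℝ} : (arcpt r k s).im = r * Real.sin (k * s * Real.pi) := by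
  rw [arcpt, Complex.im_ofReal_mul, ← Complex.ofReal_mul, ← Complex.ofReal_mul,
    Complex.exp_ofReal_mul_I_im]

theorem sin_nonneg {s : ℝ} (h : s ∈ Icc (0 : ℝ) 1) : 0 ≤ Real.sin (s * Real.pi) :=
  Real.sin_nonneg_of_nonneg_of_le_pi (mul_nonneg h.1 Real.pi_pos.le)
    (mul_le_of_le_one_left Real.pi_pos.le h.2)

theorem arcpt_im_nonneg {r s : ℝ} (hr : 0 ≤ r) (h : s ∈ Icc (0 : ℝ) 1) :
    0 ≤ (arcpt r 1 s).im := by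
  rw [arcpt_im, one_mul]
  exact mul_nonneg hr (sin_nonneg h)

theorem arcpt_neg (c : ℂ) (k s : ℝ) : arcpt (-c) k s = -arcpt c k s := by
  rw [arcpt, arcpt, neg_mul]

theorem arcpt_im_neg {r s : ℝ} (hr : 0 ≤ r) (h : s ∈ Icc (0 : ℝ) 1) :
    (arcpt r (-1) s).im ≤ 0 := by
  rw [arcpt_im, neg_one_mul, neg_mul, Real.sin_neg, mul_neg]
  exact neg_nonpos.2 (mul_nonneg hr (sin_nonneg h))

theorem continuousAt_roots {T : ℂ} (h : T ∈ Dom) :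
    ContinuousAt (fun T => csq (3 - 4 * T)) T ∧ ContinuousAt (fun T => csq (3 + 4 * T)) T :=
  ⟨(continuousAt_csq h.2.1).comp (f := fun T : ℂ => 3 - 4 * T) (by fun_prop),
    (continuousAt_csq h.2.2).comp (f := fun T : ℂ => 3 + 4 * T) (by fun_prop)⟩

theorem node_local : ∃ r > 0, r < (1 / 2 : ℝ) ∧ ∀ Z : ℂ, ‖Z‖ ≤ r →
    0 < (csq (1 - Z)).re ∧
    (pm (csq (1 - Z) * Complex.I)).re < -1 ∧ 1 < (qm (csq (1 - Z) * Complex.I)).re ∧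
    |(pp (csq (1 - Z) * Complex.I)).re| < 1 ∧ |(qp (csq (1 - Z) * Complex.I)).re| < 1 ∧
    ∃ h : ℂ, 0 < h.re ∧ qp (csq (1 - Z) * Complex.I) - pp (csq (1 - Z) * Complex.I) = Z * h := by
  have s1 : csq 1 = 1 := csq_eq (by simp) (by simp) (by simp)
  have c1 : ContinuousAt (fun Z : ℂ => csq (1 - Z)) 0 :=
    ContinuousAt.comp (g := csq) (f := fun Z : ℂ => 1 - Z)
      (by simpa using continuousAt_csq (by simp)) (by fun_prop)
  have hD : Complex.I ∈ Dom := mem_dom_of_im (by simp)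
  have cT : ContinuousAt (fun Z : ℂ => csq (1 - Z) * Complex.I) 0 := c1.mul continuousAt_const
  have T0 : csq (1 - 0) * Complex.I = Complex.I := by simp [s1]
  obtain ⟨cu, cw⟩ := continuousAt_roots hD
  have cu : ContinuousAt (fun Z : ℂ => csq (3 - 4 * (csq (1 - Z) * Complex.I))) 0 :=
    ContinuousAt.comp (g := fun T => csq (3 - 4 * T)) (by rwa [T0]) cT
  have cw : ContinuousAt (fun Z : ℂ => csq (3 + 4 * (csq (1 - Z) * Complex.I))) 0 :=
    ContinuousAt.comp (g := fun T => csq (3 + 4 * T)) (by rwa [T0]) cT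
  have eu : csq (3 - 4 * Complex.I) = 2 - Complex.I := csq_eq hD.2.1 (by simp) (by
    linear_combination Complex.I_sq)
  have ew : csq (3 + 4 * Complex.I) = 2 + Complex.I := csq_eq hD.2.2 (by simp) (by
    linear_combination Complex.I_sq)
  have cpm : ContinuousAt (fun Z : ℂ => (pm (csq (1 - Z) * Complex.I)).re) 0 := by
    unfold pm; exact Complex.continuous_re.continuousAt.comp (by fun_prop)
  have cpp : ContinuousAt (fun Z : ℂ => |(pp (csq (1 - Z) * Complex.I)).re|) 0 := by
    unfold pp
    exact continuous_abs.continuousAt.comp (Complex.continuous_re.continuousAt.comp (by fun_prop))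
  have cqp : ContinuousAt (fun Z : ℂ => |(qp (csq (1 - Z) * Complex.I)).re|) 0 := by
    unfold qp
    exact continuous_abs.continuousAt.comp (Complex.continuous_re.continuousAt.comp (by fun_prop))
  have cqm : ContinuousAt (fun Z : ℂ => (qm (csq (1 - Z) * Complex.I)).re) 0 := by
    unfold qm; exact Complex.continuous_re.continuousAt.comp (by fun_prop)
  set H : ℂ → ℂ → ℂ → ℂ := fun T u w => 16 * (2 * T ^ 2 - 1) ^ 2 /
    ((2 - T * (w - u)) * (4 - T ^ 2 * (u + w) ^ 2)) with hH
  have I2 := Complex.I_sq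
  have d0 : (2 - Complex.I * ((2 + Complex.I) - (2 - Complex.I))) *
      (4 - Complex.I ^ 2 * ((2 - Complex.I) + (2 + Complex.I)) ^ 2) = 80 := by
    linear_combination (32 * Complex.I ^ 2 - 72) * I2
  have cH : ContinuousAt (fun Z : ℂ => (H (csq (1 - Z) * Complex.I)
      (csq (3 - 4 * (csq (1 - Z) * Complex.I))) (csq (3 + 4 * (csq (1 - Z) * Complex.I)))).re) 0 := by
    refine Complex.continuous_re.continuousAt.comp (ContinuousAt.div (by fun_prop) (by fun_prop) ?_)
    rw [T0, eu, ew, d0]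
    norm_num
  have n1 : ∀ᶠ Z : ℂ in 𝓝 0, 0 < (csq (1 - Z)).re :=
    (Complex.continuous_re.continuousAt.comp c1).eventually_const_lt (by simp [s1])
  have n2 := cpm.eventually_lt_const (u := -1) (by simp [s1, pm, eu])
  have n3 := cqm.eventually_const_lt (u := 1) (by simp [s1, qm, ew])
  have n4 := cpp.eventually_lt_const (u := 1) (by simp [s1, pp, eu])
  have n5 := cqp.eventually_lt_const (u := 1) (by simp [s1, qp, ew])
  have n6 := cH.eventually_const_lt (u := 0) (by
    beta_reduce
    rw [T0, eu, ew, hH]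
    simp only
    rw [d0, I2]
    norm_num)
  have n7 := ((((n1.and n2).and n3).and n4).and n5).and n6
  obtain ⟨r, hr, hb⟩ := Metric.eventually_nhds_iff.1 n7
  refine ⟨min (r / 2) (1 / 4), by positivity, (min_le_right _ _).trans_lt (by norm_num),
    fun Z hZ => ?_⟩
  obtain ⟨⟨⟨⟨⟨a1, a2⟩, a3⟩, a4⟩, a5⟩, a6⟩ := hb (y := Z)
    (by rw [dist_zero_right]; exact hZ.trans_lt ((min_le_left _ _).trans_lt (by linarith)))
  refine ⟨a1, a2, a3, a4, a5, _, a6, ?_⟩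
  have hD' : csq (1 - Z) * Complex.I ∈ Dom := mem_dom_of_im (by simpa using a1.ne')
  have hZ1 : 1 - Z ≠ 0 := by
    intro h
    have : ‖Z‖ = 1 := by rw [← sub_eq_zero.1 h]; simp
    have := hZ.trans (min_le_right _ _)
    linarith
  have hT : (csq (1 - Z) * Complex.I) ^ 2 + 1 = Z := by
    rw [mul_pow, csq_sq hZ1, I2]; ring
  have hid := prod_roots_diff (csq_sub_sq hD') (csq_add_sq hD')
  rw [hT] at hid
  rw [qp, pp]
  generalize csq (3 - 4 * (csq (1 - Z) * Complex.I)) = u at *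
  generalize csq (3 + 4 * (csq (1 - Z) * Complex.I)) = w at *
  generalize csq (1 - Z) * Complex.I = T at *
  have hden : (2 - T * (w - u)) * (4 - T ^ 2 * (u + w) ^ 2) ≠ 0 := by
    intro h0
    simp [hH, h0] at a6
  rw [hH]
  simp only
  rw [mul_div_assoc', eq_div_iff hden]
  linear_combination hid

theorem tacnode_local : ∃ r > 0, r < (1 / 8 : ℝ) ∧ ∀ Z : ℂ, ‖Z‖ ≤ r →
    0 < (csq ((1 + Z) / 2)).re ∧ (csq ((1 + Z) / 2)).re < 3 / 4 ∧
    (pm (csq ((1 + Z) / 2))).re < -1 ∧ 1 < (qp (csq ((1 + Z) / 2))).re ∧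
    |(pp (csq ((1 + Z) / 2))).re| < 1 ∧ |(qm (csq ((1 + Z) / 2))).re| < 1 ∧
    ∃ h : ℂ, 0 < h.re ∧ qm (csq ((1 + Z) / 2)) - pp (csq ((1 + Z) / 2)) = Z ^ 2 * h := by
  set t : ℝ := √(1 / 2) with ht
  have t2 : t ^ 2 = 1 / 2 := Real.sq_sqrt (by norm_num)
  have tp : 0 < t := Real.sqrt_pos.2 (by norm_num)
  have t1 : t < 3 / 4 := by nlinarith
  have t3 : 1 / 2 < t := by nlinarith
  have t2' : (t : ℂ) ^ 2 = 1 / 2 := by rw [← Complex.ofReal_pow, t2]; norm_num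
  have hD : (t : ℂ) ∈ Dom := mem_dom_of_re (by simpa) (by simpa)
  have hslit : ((1 + 0) / 2 : ℂ) ∈ Complex.slitPlane := Or.inl (by norm_num)
  have T0 : csq ((1 + 0) / 2) = t :=
    csq_eq hslit (by simpa) (by rw [t2']; norm_num)
  have cT : ContinuousAt (fun Z : ℂ => csq ((1 + Z) / 2)) 0 :=
    ContinuousAt.comp (g := csq) (f := fun Z : ℂ => (1 + Z) / 2) (continuousAt_csq hslit)
      (by fun_prop)
  obtain ⟨cu, cw⟩ := continuousAt_roots hD
  have cu : ContinuousAt (fun Z : ℂ => csq (3 - 4 * csq ((1 + Z) / 2))) 0 :=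
    ContinuousAt.comp (g := fun T => csq (3 - 4 * T)) (by rwa [T0]) cT
  have cw : ContinuousAt (fun Z : ℂ => csq (3 + 4 * csq ((1 + Z) / 2))) 0 :=
    ContinuousAt.comp (g := fun T => csq (3 + 4 * T)) (by rwa [T0]) cT
  have eu : csq (3 - 4 * t) = 2 * t - 1 := csq_eq hD.2.1 (by simp; linarith) (by
    linear_combination 4 * t2')
  have ew : csq (3 + 4 * t) = 2 * t + 1 := csq_eq hD.2.2 (by simp; linarith) (by
    linear_combination 4 * t2')
  have vpm : (pm t).re = -2 + t := by
    rw [pm, eu, show (-1 - t * (2 * t - 1) : ℂ) = ((-2 + t : ℝ) : ℂ) by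
      push_cast; linear_combination -2 * t2', Complex.ofReal_re]
  have vpp : (pp t).re = -t := by
    rw [pp, eu, show (-1 + t * (2 * t - 1) : ℂ) = ((-t : ℝ) : ℂ) by
      push_cast; linear_combination 2 * t2', Complex.ofReal_re]
  have vqm : (qm t).re = -t := by
    rw [qm, ew, show (1 - t * (2 * t + 1) : ℂ) = ((-t : ℝ) : ℂ) by
      push_cast; linear_combination -2 * t2', Complex.ofReal_re]
  have vqp : (qp t).re = 2 + t := by
    rw [qp, ew, show (1 + t * (2 * t + 1) : ℂ) = ((2 + t : ℝ) : ℂ) by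
      push_cast; linear_combination 2 * t2', Complex.ofReal_re]
  have cpm : ContinuousAt (fun Z : ℂ => (pm (csq ((1 + Z) / 2))).re) 0 := by
    unfold pm; exact Complex.continuous_re.continuousAt.comp (by fun_prop)
  have cpp : ContinuousAt (fun Z : ℂ => |(pp (csq ((1 + Z) / 2))).re|) 0 := by
    unfold pp
    exact continuous_abs.continuousAt.comp (Complex.continuous_re.continuousAt.comp (by fun_prop))
  have cqm : ContinuousAt (fun Z : ℂ => |(qm (csq ((1 + Z) / 2))).re|) 0 := by
    unfold qm
    exact continuous_abs.continuousAt.comp (Complex.continuous_re.continuousAt.comp (by fun_prop))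
  have cqp : ContinuousAt (fun Z : ℂ => (qp (csq ((1 + Z) / 2))).re) 0 := by
    unfold qp; exact Complex.continuous_re.continuousAt.comp (by fun_prop)
  set H : ℂ → ℂ → ℂ → ℂ := fun T u w => 16 * (T ^ 2 + 1) /
    ((2 + T * (u + w)) * (4 - T ^ 2 * (u - w) ^ 2)) with hH
  have d0 : (2 + (t : ℂ) * ((2 * t - 1) + (2 * t + 1))) *
      (4 - (t : ℂ) ^ 2 * ((2 * t - 1) - (2 * t + 1)) ^ 2) = 8 := by
    linear_combination (-16 * (t : ℂ) ^ 2) * t2'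
  have cH : ContinuousAt (fun Z : ℂ => (H (csq ((1 + Z) / 2))
      (csq (3 - 4 * csq ((1 + Z) / 2))) (csq (3 + 4 * csq ((1 + Z) / 2)))).re) 0 := by
    refine Complex.continuous_re.continuousAt.comp (ContinuousAt.div (by fun_prop) (by fun_prop) ?_)
    rw [T0, eu, ew, d0]
    norm_num
  have n0 : ∀ᶠ Z : ℂ in 𝓝 0, 0 < (csq ((1 + Z) / 2)).re :=
    (Complex.continuous_re.continuousAt.comp cT).eventually_const_lt (by
      simp only [Function.comp]; rw [T0]; simpa)
  have n1 : ∀ᶠ Z : ℂ in 𝓝 0, (csq ((1 + Z) / 2)).re < 3 / 4 :=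
    (Complex.continuous_re.continuousAt.comp cT).eventually_lt_const (by
      simp only [Function.comp]; rw [T0]; simpa)
  have n2 := cpm.eventually_lt_const (u := -1) (by beta_reduce; rw [T0, vpm]; linarith)
  have n3 := cqp.eventually_const_lt (u := 1) (by beta_reduce; rw [T0, vqp]; linarith)
  have n4 := cpp.eventually_lt_const (u := 1) (by beta_reduce; rw [T0, vpp, abs_neg, abs_of_pos tp]; linarith)
  have n5 := cqm.eventually_lt_const (u := 1) (by beta_reduce; rw [T0, vqm, abs_neg, abs_of_pos tp]; linarith)
  have n6 := cH.eventually_const_lt (u := 0) (by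
    beta_reduce
    rw [T0, eu, ew, hH]
    simp only
    rw [d0, t2']
    norm_num)
  have n7 := (((((n0.and n1).and n2).and n3).and n4).and n5).and n6
  obtain ⟨r, hr, hb⟩ := Metric.eventually_nhds_iff.1 n7
  refine ⟨min (r / 2) (1 / 16), by positivity, (min_le_right _ _).trans_lt (by norm_num),
    fun Z hZ => ?_⟩
  obtain ⟨⟨⟨⟨⟨⟨a0, a1⟩, a2⟩, a3⟩, a4⟩, a5⟩, a6⟩ := hb (y := Z)
    (by rw [dist_zero_right]; exact hZ.trans_lt ((min_le_left _ _).trans_lt (by linarith)))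
  refine ⟨a0, a1, a2, a3, a4, a5, _, a6, ?_⟩
  have hD' : csq ((1 + Z) / 2) ∈ Dom := mem_dom_of_re a0 a1
  have hZ1 : (1 + Z) / 2 ≠ 0 := by
    intro h
    have h1 : Z = -1 := by linear_combination 2 * h
    have : ‖Z‖ = 1 := by rw [h1]; simp
    have := hZ.trans (min_le_right _ _)
    linarith
  have hT : 2 * (csq ((1 + Z) / 2)) ^ 2 - 1 = Z := by
    rw [csq_sq hZ1]; ring
  have hid := prod_roots_diff (csq_sub_sq hD') (csq_add_sq hD')
  rw [hT] at hid
  rw [qm, pp]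
  generalize csq (3 - 4 * csq ((1 + Z) / 2)) = u at *
  generalize csq (3 + 4 * csq ((1 + Z) / 2)) = w at *
  generalize csq ((1 + Z) / 2) = T at *
  have hden : (2 + T * (u + w)) * (4 - T ^ 2 * (u - w) ^ 2) ≠ 0 := by
    intro h0
    simp [hH, h0] at a6
  rw [hH]
  simp only
  rw [mul_div_assoc', eq_div_iff hden]
  linear_combination hid

theorem arcpt_arcpt_half (c : ℂ) : arcpt (arcpt c (1 / 2) 1) (1 / 2) 1 = -c := by
  rw [← arcpt_one_one c]
  simp only [arcpt]
  rw [mul_assoc, ← Complex.exp_add]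
  congr 2
  push_cast
  ring

theorem arcpt_arcpt_neg_half (c : ℂ) : arcpt (arcpt c (-1 / 2) 1) (-1 / 2) 1 = -c := by
  rw [← arcpt_one_neg c]
  simp only [arcpt]
  rw [mul_assoc, ← Complex.exp_add]
  congr 2
  push_cast
  ring

section

variable {G : Type*} [Group G] {Φ : PathHom UU G}

/-- The base value of the coordinate `T`. -/
def baseT : ℂ := (1 / 10 : ℝ) * Complex.I

theorem quad_commute (hΦ : FarTrivial Φ) {x₁ x₂ x₃ x₄ : G}
    (h : Quad Φ (Complex.log baseT) (pm baseT) (pp baseT) (qp baseT) (qm baseT) x₁ x₂ x₃ x₄) :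
    x₂ * x₃ = x₃ * x₂ := by
  obtain ⟨r, hr, hr2, hloc⟩ := node_local
  have hr0 : (r : ℂ) ≠ 0 := by exact_mod_cast hr.ne'
  have hnr : ‖(r : ℂ)‖ ≤ r := by simp [abs_of_pos hr]
  set y := √(1 - r) with hy
  have hy0 : 0 < y := Real.sqrt_pos.2 (by linarith)
  have hy1 : y < 1 := by
    rw [hy, Real.sqrt_lt' one_pos]
    linarith
  have hcy : csq (1 - (r : ℂ)) = (y : ℂ) := by
    rw [hy, ← csq_ofReal (by linarith)]
    push_cast
    rfl
  have hA : Quad Φ (Complex.log (y * Complex.I)) (pm (y * Complex.I)) (pp (y * Complex.I))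
      (qp (y * Complex.I)) (qm (y * Complex.I)) x₁ x₂ x₃ x₄ := by
    have hord : ∀ s ∈ Icc (0 : ℝ) 1, 0 < 1 / 10 + s * (y - 1 / 10) ∧
        1 / 10 + s * (y - 1 / 10) < 1 := fun s hs => by
      have := hs.1; have := hs.2
      constructor <;> nlinarith
    have F := family_of_dom (T := fun s : ℝ => ((1 / 10 + s * (y - 1 / 10) : ℝ) : ℂ) * Complex.I)
      (by fun_prop) fun s hs => mem_dom_of_im (by simpa using (hord s hs).1.ne')
    have := F.slide hΦ (fun s hs => (imaginary_axis (hord s hs).1 (hord s hs).2).1)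
      (fun s hs => (imaginary_axis (hord s hs).1 (hord s hs).2).2.1)
      (fun s hs => (imaginary_axis (hord s hs).1 (hord s hs).2).2.2)
      (by simpa only [zero_mul, add_zero, baseT] using h)
    simpa only [one_mul, add_sub_cancel] using this
  have hnorm : ∀ s, ‖arcpt r 1 s‖ ≤ r := fun s => (norm_arcpt _ _ _).trans_le hnr
  have hnorm' : ∀ s, ‖arcpt (-r) 1 s‖ ≤ r := fun s => by rw [norm_arcpt, norm_neg]; exact hnr
  have hfam : ∀ c : ℂ, (∀ s, ‖arcpt c 1 s‖ ≤ r) → ContinuousOn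
      (fun s : ℝ => csq (1 - arcpt c 1 s) * Complex.I) (Icc 0 1) := fun c hc =>
    (ContinuousOn.csq' (continuous_const.sub (continuous_arcpt _ _)).continuousOn fun s _ =>
      Or.inl (by
        have := Complex.re_le_norm (arcpt c 1 s)
        have := hc s
        simp; linarith)).mul continuousOn_const
  have hdom : ∀ Z : ℂ, ‖Z‖ ≤ r → csq (1 - Z) * Complex.I ∈ Dom := fun Z hZ =>
    mem_dom_of_im (by simpa using (hloc Z hZ).1.ne')
  have F := family_of_dom (hfam r hnorm) fun s _ => hdom _ (hnorm s)
  have hB := F.swap_right hΦ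
    (fun s _ => by
      obtain ⟨-, h1, h2, h3, h4, -⟩ := hloc _ (hnorm s)
      exact ⟨h1.trans (abs_lt.1 h3).1, h1.trans (abs_lt.1 h4).1⟩)
    (fun s _ => by
      obtain ⟨-, h1, h2, h3, h4, -⟩ := hloc _ (hnorm s)
      exact ⟨(abs_lt.1 h3).2.trans h2, (abs_lt.1 h4).2.trans h2⟩)
    (fun s hs => by
      obtain ⟨-, -, -, -, -, k, hk, e⟩ := hloc _ (hnorm s)
      exact notAbove_of_diff (Z := -arcpt r 1 s) (h := k) (by linear_combination -e)
        (by simpa using arcpt_im_nonneg hr.le hs) (neg_ne_zero.2 (arcpt_ne_zero hr0 _ _)) hk)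
    (by
      obtain ⟨-, -, -, -, -, k, hk, e⟩ := hloc _ (hnorm 1)
      have := congrArg Complex.re e
      rw [arcpt_one_one] at this ⊢
      simp only [Complex.sub_re, Complex.mul_re, Complex.neg_re, Complex.neg_im,
        Complex.ofReal_re, Complex.ofReal_im] at this
      nlinarith [mul_pos hr hk])
    (by simpa only [arcpt_zero, hcy] using hA)
  have F' := (family_of_dom (hfam (-r) hnorm') fun s _ => hdom _ (hnorm' s)).swap12
  have hC := F'.transport2 hΦ
    (fun s hs => by
      obtain ⟨-, h1, h2, h3, h4, k, hk, e⟩ := hloc _ (hnorm' s)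
      refine ⟨notAbove_of_re_ne (h1.trans (abs_lt.1 h3).1).ne,
        notAbove_of_diff e ?_ (arcpt_ne_zero (neg_ne_zero.2 hr0) _ _) hk,
        notAbove_of_re_ne ((abs_lt.1 h3).2.trans h2).ne'⟩
      rw [arcpt_neg, Complex.neg_im]
      exact neg_nonpos.2 (arcpt_im_nonneg hr.le hs))
    (by simpa only [arcpt_zero, arcpt_one_one] using hB.m2)
  rw [arcpt_one_one, neg_neg, hcy] at hC
  have := hC.unique hΦ hA.m1
  rwa [mul_assoc, inv_mul_eq_iff_eq_mul] at this

theorem real_order {t : ℝ} (h0 : 0 < t) (h1 : t < 3 / 4) (h2 : 2 * t ^ 2 ≠ 1) :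
    (pm t).re < (pp t).re ∧ (pp t).re < (qm t).re ∧ (qm t).re < (qp t).re := by
  have e1 : csq (3 - 4 * t) = (√(3 - 4 * t) : ℝ) := by
    rw [← csq_ofReal (by linarith)]; push_cast; rfl
  have e2 : csq (3 + 4 * t) = (√(3 + 4 * t) : ℝ) := by
    rw [← csq_ofReal (by linarith)]; push_cast; rfl
  have hu := Real.sq_sqrt (show 0 ≤ 3 - 4 * t by linarith)
  have hw := Real.sq_sqrt (show 0 ≤ 3 + 4 * t by linarith)
  have hu0 := Real.sqrt_pos.2 (show 0 < 3 - 4 * t by linarith)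
  have hw0 := Real.sqrt_pos.2 (show 0 < 3 + 4 * t by linarith)
  rw [pm, pp, qp, qm, e1, e2]
  generalize √(3 - 4 * t) = u at *
  generalize √(3 + 4 * t) = w at *
  have hid : (4 - t ^ 2 * (u - w) ^ 2) * (4 - t ^ 2 * (u + w) ^ 2) =
      16 * (t ^ 2 + 1) * (2 * t ^ 2 - 1) ^ 2 := by
    exact_mod_cast prod_roots_diff (T := t) (u := u) (w := w) (by exact_mod_cast hu)
      (by exact_mod_cast hw)
  have hp : 0 < 16 * (t ^ 2 + 1) * (2 * t ^ 2 - 1) ^ 2 := by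
    have := sq_pos_of_ne_zero (sub_ne_zero.2 h2)
    positivity
  have huw := mul_pos hu0 hw0
  have h4 : 0 < 4 - t ^ 2 * (u - w) ^ 2 := by
    have : (u - w) ^ 2 ≤ 6 := by nlinarith
    have : t ^ 2 < 9 / 16 := by nlinarith
    nlinarith [sq_nonneg t]
  have h5 : 0 < 4 - t ^ 2 * (u + w) ^ 2 := by
    rw [← hid] at hp
    exact pos_of_mul_pos_right hp h4.le
  have h6 : t * (u + w) < 2 := by
    refine lt_of_pow_lt_pow_left₀ 2 (by norm_num) ?_
    rw [mul_pow]
    linarith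
  have htu := mul_pos h0 hu0
  have htw := mul_pos h0 hw0
  simp only [← Complex.ofReal_mul, Complex.sub_re, Complex.add_re, Complex.neg_re,
    Complex.one_re, Complex.ofReal_re]
  refine ⟨?_, ?_, ?_⟩ <;> linarith

theorem slide_real (hΦ : FarTrivial Φ) {t t' : ℝ} (h : ∀ x ∈ uIcc t t', 0 < x ∧ x < 3 / 4 ∧ 2 * x ^ 2 ≠ 1)
    {a b c d : G} (hq : Quad Φ (Complex.log t) (pm t) (pp t) (qm t) (qp t) a b c d) :
    Quad Φ (Complex.log t') (pm t') (pp t') (qm t') (qp t') a b c d := by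
  have hm : ∀ s ∈ Icc (0 : ℝ) 1, t + s * (t' - t) ∈ uIcc t t' := fun s hs => by
    rw [← segment_eq_uIcc]
    exact ⟨1 - s, s, by linarith [hs.2], hs.1, by ring, by simp; ring⟩
  have hord := fun s hs => real_order (h _ (hm s hs)).1 (h _ (hm s hs)).2.1 (h _ (hm s hs)).2.2
  have F := (family_of_dom (T := fun s : ℝ => ((t + s * (t' - t) : ℝ) : ℂ))
    (by fun_prop) fun s hs => mem_dom_of_re (by simpa using (h _ (hm s hs)).1)
      (by simpa using (h _ (hm s hs)).2.1)).swap23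
  have := F.slide hΦ (fun s hs => (hord s hs).1) (fun s hs => (hord s hs).2.1)
    (fun s hs => (hord s hs).2.2) (by simpa only [zero_mul, add_zero] using hq)
  simpa only [one_mul, add_sub_cancel] using this

theorem quad_tangent (hΦ : FarTrivial Φ) {a b c d : G} {t : ℝ} (h0 : 0 < t) (h1 : t < 3 / 4)
    (h2 : 1 < 2 * t ^ 2) (h : Quad Φ (Complex.log t) (pm t) (pp t) (qm t) (qp t) a b c d) :
    a = b := by
  set t' : ℝ := (3 - (1 / 10) ^ 2) / 4 with ht'
  have h' : Quad Φ (Complex.log t') (pm t') (pp t') (qm t') (qp t') a b c d := by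
    refine slide_real hΦ (fun x hx => ?_) h
    have ht1 : t' = 299 / 400 := by rw [ht']; norm_num
    clear_value t'
    rcases mem_uIcc.1 hx with ⟨hx, hx'⟩ | ⟨hx, hx'⟩
    · exact ⟨by linarith, by linarith, by nlinarith⟩
    · exact ⟨by linarith, by linarith, by nlinarith⟩
  set u : ℝ → ℂ := arcpt (1 / 10 : ℝ) 1 with hu
  have hnu : ∀ s, ‖u s‖ = 1 / 10 := fun s => by
    rw [hu, norm_arcpt, Complex.norm_real]; norm_num
  have hcu : Continuous u := continuous_arcpt _ _
  set T : ℝ → ℂ := fun s => (3 - u s ^ 2) / 4 with hT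
  have hn2 : ∀ s, ‖u s ^ 2‖ = 1 / 100 := fun s => by rw [norm_pow, hnu]; norm_num
  have hre : ∀ s, -(1 / 100) ≤ (u s ^ 2).re ∧ (u s ^ 2).re ≤ 1 / 100 := fun s => by
    have := Complex.abs_re_le_norm (u s ^ 2)
    rw [hn2] at this
    exact abs_le.1 this
  have hTre : ∀ s, 0 < (T s).re := fun s => by
    have := hre s
    rw [show T s = (3 - u s ^ 2) / 4 from rfl, show (3 - u s ^ 2) / 4 = ((1 / 4 : ℝ) : ℂ) * (3 - u s ^ 2) by push_cast; ring,
      Complex.re_ofReal_mul, Complex.sub_re, Complex.re_ofNat]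
    linarith
  have hTn : ∀ s, ‖T s‖ ≤ 301 / 400 := fun s => by
    rw [show T s = (3 - u s ^ 2) / 4 from rfl, norm_div]
    have := norm_sub_le 3 (u s ^ 2)
    rw [hn2] at this
    simp only [Complex.norm_ofNat] at this ⊢
    linarith
  have hw6 : ∀ s, 3 + 4 * T s ∈ Complex.slitPlane := fun s => Or.inl (by
    have := hTre s
    simp; linarith)
  have hwn : ∀ s, ‖csq (3 + 4 * T s)‖ < 2.452 := fun s => by
    refine lt_of_pow_lt_pow_left₀ 2 (by norm_num) ?_
    rw [← norm_pow, csq_sq (Complex.slitPlane_ne_zero (hw6 s))]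
    refine (norm_add_le _ _).trans_lt ?_
    rw [norm_mul]
    have := hTn s
    simp only [Complex.norm_ofNat]
    linarith
  have hTw : ∀ s, |(T s * csq (3 + 4 * T s)).re| < 1.85 := fun s => by
    refine (Complex.abs_re_le_norm _).trans_lt ?_
    rw [norm_mul]
    nlinarith [hTn s, hwn s, norm_nonneg (T s), norm_nonneg (csq (3 + 4 * T s))]
  have hTu : ∀ s, |(T s * u s).re| < 0.08 := fun s => by
    refine (Complex.abs_re_le_norm _).trans_lt ?_
    rw [norm_mul, hnu]
    linarith [hTn s]
  have hcT : Continuous T := by fun_prop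
  have hcw : ContinuousOn (fun s => csq (3 + 4 * T s)) (Icc 0 1) :=
    ContinuousOn.csq' (by fun_prop) fun s _ => hw6 s
  have F : Family (fun s => Complex.log (T s)) (fun s => -1 - T s * u s)
      (fun s => -1 + T s * u s) (fun s => 1 + T s * csq (3 + 4 * T s))
      (fun s => 1 - T s * csq (3 + 4 * T s)) :=
    ⟨hcT.continuousOn.clog fun s _ => Or.inl (hTre s), by fun_prop, by fun_prop, by fun_prop,
      by fun_prop, fun s _ => isRoots_log (Complex.slitPlane_ne_zero (Or.inl (hTre s)))
        (by rw [hT]; ring) (csq_sq (Complex.slitPlane_ne_zero (hw6 s)))⟩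
  have u0 : u 0 = (1 / 10 : ℝ) := arcpt_zero _ _
  have u1 : u 1 = -(1 / 10 : ℝ) := arcpt_one_one _
  have T0 : T 0 = t' := by rw [hT, ht']; simp only [u0]; push_cast; ring
  have T1 : T 1 = t' := by rw [hT, ht']; simp only [u1]; push_cast; ring
  have cu : csq (3 - 4 * t') = (1 / 10 : ℝ) := csq_eq
    (by rw [ht', show (3 - 4 * ((3 - (1 / 10) ^ 2) / 4 : ℝ) : ℂ) = ((1 / 100 : ℝ) : ℂ) by
          push_cast; ring]
        exact Complex.ofReal_mem_slitPlane.2 (by norm_num))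
    (by rw [Complex.ofReal_re]; norm_num) (by rw [ht']; push_cast; ring)
  have m := F.transport1 hΦ (fun s hs => by
      have a1 := abs_lt.1 (hTw s)
      have a2 := abs_lt.1 (hTu s)
      refine ⟨notAbove_of_diff (Z := -u s) (h := 2 * T s) (by ring) ?_ ?_ ?_,
        notAbove_of_re_ne ?_, notAbove_of_re_ne ?_⟩
      · rw [Complex.neg_im]
        exact neg_nonpos.2 (arcpt_im_nonneg (by norm_num) hs)
      · rw [neg_ne_zero, ← norm_ne_zero_iff, hnu]
        norm_num
      · have := hTre s
        simpa
      · simp only [Complex.add_re, Complex.neg_re, Complex.one_re]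
        intro h; linarith
      · simp only [Complex.add_re, Complex.sub_re, Complex.neg_re, Complex.one_re]
        intro h; linarith)
    (g₁ := b) (by rw [T0, u0, ← cu]; exact h'.m1)
  rw [T1, u1, ← cu, mul_neg, ← sub_eq_add_neg] at m
  exact h'.m0.unique hΦ m

end

section

variable {G : Type*} [Group G] {Φ : PathHom UU G}

theorem csq_norm_lt {z : ℂ} {b : ℝ} (hz : z ≠ 0) (hb : 0 ≤ b) (h : ‖z‖ < b ^ 2) : ‖csq z‖ < b := by
  refine lt_of_pow_lt_pow_left₀ 2 hb ?_
  rwa [← norm_pow, csq_sq hz]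

theorem quad_two_fifths (hΦ : FarTrivial Φ) {x₁ x₂ x₃ x₄ : G}
    (h : Quad Φ (Complex.log baseT) (pm baseT) (pp baseT) (qp baseT) (qm baseT) x₁ x₂ x₃ x₄) :
    Quad Φ (Complex.log (2 / 5 : ℝ)) (pm (2 / 5 : ℝ)) (pp (2 / 5 : ℝ)) (qm (2 / 5 : ℝ))
      (qp (2 / 5 : ℝ)) x₁ x₂ (x₃ * x₄ * x₃⁻¹) x₃ := by
  set T : ℝ → ℂ := fun s => (1 - s : ℝ) * baseT + s * (2 / 5 : ℝ) with hT
  have T0 : T 0 = baseT := by simp [hT]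
  have T1 : T 1 = (2 / 5 : ℝ) := by simp [hT]
  have hre : ∀ s, (T s).re = s * (2 / 5) := fun s => by simp [hT, baseT]
  have him : ∀ s, (T s).im = (1 - s) * (1 / 10) := fun s => by simp [hT, baseT]
  have hD : ∀ s ∈ Icc (0 : ℝ) 1, T s ∈ Dom := fun s hs => by
    rcases hs.1.eq_or_lt with h0 | h0
    · exact mem_dom_of_im (by rw [him, ← h0]; norm_num)
    · exact mem_dom_of_re (by rw [hre]; positivity) (by rw [hre]; linarith [hs.2])
  have hn : ∀ s ∈ Icc (0 : ℝ) 1, ‖T s‖ ≤ 2 / 5 := fun s hs => by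
    refine (norm_add_le _ _).trans ?_
    rw [norm_mul, norm_mul, baseT, norm_mul, Complex.norm_I, Complex.norm_of_nonneg hs.1,
      Complex.norm_of_nonneg (sub_nonneg.2 hs.2), Complex.norm_of_nonneg (by norm_num),
      Complex.norm_of_nonneg (by norm_num)]
    linarith [hs.2]
  have bound : ∀ s ∈ Icc (0 : ℝ) 1, |(T s * csq (3 - 4 * T s)).re| < 1 ∧
      |(T s * csq (3 + 4 * T s)).re| < 1 := fun s hs => by
    have h4 : ‖4 * T s‖ ≤ 1.6 := by
      rw [norm_mul, Complex.norm_ofNat]; linarith [hn s hs]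
    have h3 : ‖(3 : ℂ)‖ = 3 := by simp
    have hu := csq_norm_lt (b := 2.2) (Complex.slitPlane_ne_zero (hD s hs).2.1) (by norm_num)
      ((norm_sub_le _ _).trans_lt (by norm_num at h4 ⊢; linarith))
    have hw := csq_norm_lt (b := 2.2) (Complex.slitPlane_ne_zero (hD s hs).2.2) (by norm_num)
      ((norm_add_le _ _).trans_lt (by norm_num at h4 ⊢; linarith))
    have := hn s hs
    constructor <;> refine (Complex.abs_re_le_norm _).trans_lt ?_ <;> rw [norm_mul] <;>
      nlinarith [norm_nonneg (T s), norm_nonneg (csq (3 - 4 * T s)),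
        norm_nonneg (csq (3 + 4 * T s))]
  have hq := fun (s : ℝ) (hs : s ∈ Icc (0 : ℝ) 1) =>
    quarter (hD s hs) (by rw [hre]; exact mul_nonneg hs.1 (by norm_num))
      (by rw [him]; exact mul_nonneg (sub_nonneg.2 hs.2) (by norm_num))
  have F := family_of_dom (T := T) (by fun_prop) hD
  have hord : ∀ s ∈ Icc (0 : ℝ) 1, (pm (T s)).re < (pp (T s)).re ∧
      (pp (T s)).re < (qp (T s)).re ∧ (pp (T s)).re < (qm (T s)).re ∧
      NotAbove (qp (T s)) (qm (T s)) := fun s hs => by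
    obtain ⟨b1, b2⟩ := bound s hs
    obtain ⟨c1, -, c3⟩ := hq s hs
    have b1 := abs_lt.1 b1
    have b2 := abs_lt.1 b2
    simp only [pm, pp, qp, qm, NotAbove, Complex.sub_re, Complex.add_re, Complex.neg_re,
      Complex.one_re, Complex.sub_im, Complex.add_im, Complex.one_im]
    refine ⟨by linarith, by linarith, by linarith, fun h => ?_⟩
    have := c3 (by linarith)
    linarith
  have m0 := F.transport0 hΦ (g₀ := x₁) (fun s hs => by
    obtain ⟨a, b, c, -⟩ := hord s hs
    exact ⟨notAbove_of_re_ne a.ne', notAbove_of_re_ne (a.trans b).ne',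
      notAbove_of_re_ne (a.trans c).ne'⟩) (by rw [T0]; exact h.m0)
  have m1 := F.transport1 hΦ (g₁ := x₂) (fun s hs => by
    obtain ⟨a, b, c, -⟩ := hord s hs
    exact ⟨notAbove_of_re_ne a.ne, notAbove_of_re_ne b.ne',
      notAbove_of_re_ne c.ne'⟩) (by rw [T0]; exact h.m1)
  have m2 := F.transport2 hΦ (g₂ := x₃) (fun s hs => by
    obtain ⟨a, b, c, d⟩ := hord s hs
    exact ⟨notAbove_of_re_ne (a.trans b).ne, notAbove_of_re_ne b.ne, d⟩)
    (by rw [T0]; exact h.m2)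
  rw [T1] at m0 m1 m2
  obtain ⟨o1, o2, o3⟩ := real_order (t := 2 / 5) (by norm_num) (by norm_num) (by norm_num)
  obtain ⟨g₀, g₁, g₂, g₃, hg⟩ := exists_quad Φ
    (isRoots_of_dom (mem_dom_of_re (T := ((2 / 5 : ℝ) : ℂ)) (by simp) (by
      rw [Complex.ofReal_re]; norm_num))).swap23 o1 o2 o3
  have e := (hg.prod hΦ).trans ((total_eq hΦ _ _).trans (h.prod hΦ).symm)
  obtain rfl := hg.m0.unique hΦ m0
  obtain rfl := hg.m1.unique hΦ m1
  obtain rfl := hg.m3.unique hΦ m2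
  have : g₂ = g₃ * x₄ * g₃⁻¹ := by
    rw [eq_mul_inv_iff_mul_eq]
    simpa only [mul_assoc, mul_right_inj] using e
  rwa [this] at hg

set_option maxHeartbeats 400000 in
theorem quad_tacnode (hΦ : FarTrivial Φ) {a b c d : G}
    (h : Quad Φ (Complex.log (2 / 5 : ℝ)) (pm (2 / 5 : ℝ)) (pp (2 / 5 : ℝ)) (qm (2 / 5 : ℝ))
      (qp (2 / 5 : ℝ)) a b c d) :
    a = c⁻¹ * b * c ∧ a = b * c * b⁻¹ * b * (b * c * b⁻¹)⁻¹ := by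
  obtain ⟨r, hr, hr2, hloc⟩ := tacnode_local
  have hr0 : (r : ℂ) ≠ 0 := by exact_mod_cast hr.ne'
  have hnr : ‖(r : ℂ)‖ = r := by simp [abs_of_pos hr]
  have hcs : ∀ x : ℝ, -1 < x → csq ((1 + (x : ℂ)) / 2) = (√((1 + x) / 2) : ℝ) := fun x hx => by
    rw [← csq_ofReal (by linarith)]
    push_cast
    rfl
  have hsm := Real.sq_sqrt (show 0 ≤ (1 + -r) / 2 by linarith)
  have hsp := Real.sq_sqrt (show 0 ≤ (1 + r) / 2 by linarith)
  have hcm := hcs (-r) (by linarith)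
  have hcp := hcs r (by linarith)
  have hpm := Real.sqrt_pos.2 (show 0 < (1 + -r) / 2 by linarith)
  have hpp := Real.sqrt_pos.2 (show 0 < (1 + r) / 2 by linarith)
  rw [Complex.ofReal_neg] at hcm
  rw [← sub_eq_add_neg 1 r] at hsm hpm hcm
  set tm := √((1 - r) / 2)
  set tp := √((1 + r) / 2)
  have h' : Quad Φ (Complex.log tm) (pm tm) (pp tm) (qm tm) (qp tm) a b c d := by
    refine slide_real hΦ (fun x hx => ?_) h
    have htm : tm < 3 / 4 := by nlinarith
    have htm' : 2 / 5 < tm := by nlinarith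
    rcases mem_uIcc.1 hx with ⟨hx, hx'⟩ | ⟨hx, hx'⟩
    · exact ⟨by linarith, by linarith, by nlinarith⟩
    · exact ⟨by linarith, by linarith, by nlinarith⟩
  have hdom : ∀ Z : ℂ, ‖Z‖ ≤ r → csq ((1 + Z) / 2) ∈ Dom := fun Z hZ =>
    mem_dom_of_re (hloc Z hZ).1 (hloc Z hZ).2.1
  have fam := fun (e : ℂ) (k : ℝ) (he : ‖e‖ = r) =>
    (family_of_dom (T := fun s => csq ((1 + arcpt e k s) / 2))
      (ContinuousOn.csq' (by have := continuous_arcpt e k; fun_prop) fun s _ => Or.inl (by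
        have h1 := Complex.abs_re_le_norm (arcpt e k s)
        rw [norm_arcpt, he] at h1
        have := (abs_le.1 h1).1
        rw [show (1 + arcpt e k s) / 2 = ((1 / 2 : ℝ) : ℂ) * (1 + arcpt e k s) by push_cast; ring,
          Complex.re_ofReal_mul, Complex.add_re, Complex.one_re]
        linarith)) fun s _ => hdom _ ((norm_arcpt e k s).trans he).le).swap23
  have loc := fun (e : ℂ) (k : ℝ) (he : ‖e‖ = r) (s : ℝ) =>
    hloc (arcpt e k s) ((norm_arcpt e k s).trans he).le
  have lo : ∀ (e : ℂ) (k : ℝ), ‖e‖ = r → ∀ s,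
      (pm (csq ((1 + arcpt e k s) / 2))).re < (pp (csq ((1 + arcpt e k s) / 2))).re ∧
      (pm (csq ((1 + arcpt e k s) / 2))).re < (qm (csq ((1 + arcpt e k s) / 2))).re :=
    fun e k he s => by
      obtain ⟨-, -, h1, h2, h3, h4, -⟩ := loc e k he s
      exact ⟨h1.trans (abs_lt.1 h3).1, h1.trans (abs_lt.1 h4).1⟩
  have hi : ∀ (e : ℂ) (k : ℝ), ‖e‖ = r → ∀ s,
      (pp (csq ((1 + arcpt e k s) / 2))).re < (qp (csq ((1 + arcpt e k s) / 2))).re ∧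
      (qm (csq ((1 + arcpt e k s) / 2))).re < (qp (csq ((1 + arcpt e k s) / 2))).re :=
    fun e k he s => by
      obtain ⟨-, -, h1, h2, h3, h4, -⟩ := loc e k he s
      exact ⟨(abs_lt.1 h3).2.trans h2, (abs_lt.1 h4).2.trans h2⟩
  have above : ∀ (e : ℂ) (k : ℝ), ‖e‖ = r → ∀ s, 0 ≤ (arcpt (e ^ 2) (2 * k) s).im →
      NotAbove (qm (csq ((1 + arcpt e k s) / 2))) (pp (csq ((1 + arcpt e k s) / 2))) :=
    fun e k he s hs => by
      obtain ⟨-, -, -, -, -, -, g, hg, e'⟩ := loc e k he s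
      rw [← mul_div_cancel_left₀ k (two_ne_zero' ℝ), arcpt_half_sq,
        mul_div_cancel_left₀ k (two_ne_zero' ℝ)] at e'
      refine notAbove_of_diff (Z := -arcpt (e ^ 2) (2 * k) s) (h := g) (by linear_combination -e')
        (by simpa using hs) (neg_ne_zero.2 (arcpt_ne_zero (pow_ne_zero 2 ?_) _ _)) hg
      rw [← norm_ne_zero_iff, he]
      exact hr.ne'
  have below : ∀ (e : ℂ) (k : ℝ), ‖e‖ = r → ∀ s, (arcpt (e ^ 2) (2 * k) s).im ≤ 0 →
      NotAbove (pp (csq ((1 + arcpt e k s) / 2))) (qm (csq ((1 + arcpt e k s) / 2))) :=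
    fun e k he s hs => by
      obtain ⟨-, -, -, -, -, -, g, hg, e'⟩ := loc e k he s
      rw [← mul_div_cancel_left₀ k (two_ne_zero' ℝ), arcpt_half_sq,
        mul_div_cancel_left₀ k (two_ne_zero' ℝ)] at e'
      refine notAbove_of_diff (Z := arcpt (e ^ 2) (2 * k) s) (h := g) e' hs
        (arcpt_ne_zero (pow_ne_zero 2 ?_) _ _) hg
      rw [← norm_ne_zero_iff, he]
      exact hr.ne'
  have n1 : ‖-(r : ℂ)‖ = r := by rw [norm_neg, hnr]
  have n2 : ∀ k, ‖arcpt (-(r : ℂ)) k 1‖ = r := fun k => by rw [norm_arcpt, n1]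
  have q1 : (-(r : ℂ)) ^ 2 = ((r ^ 2 : ℝ) : ℂ) := by push_cast; ring
  have q2 : ∀ k : ℝ, arcpt (-(r : ℂ)) k 1 ^ 2 = arcpt ((r ^ 2 : ℝ) : ℂ) (2 * k) 1 := fun k => by
    rw [← q1, ← arcpt_half_sq, mul_div_cancel_left₀ k (two_ne_zero' ℝ)]
  have start : ∀ k, Quad Φ (Complex.log (csq ((1 + arcpt (-(r : ℂ)) k 0) / 2)))
      (pm (csq ((1 + arcpt (-(r : ℂ)) k 0) / 2))) (pp (csq ((1 + arcpt (-(r : ℂ)) k 0) / 2)))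
      (qm (csq ((1 + arcpt (-(r : ℂ)) k 0) / 2))) (qp (csq ((1 + arcpt (-(r : ℂ)) k 0) / 2)))
      a b c d := fun k => by
    rw [arcpt_zero, hcm]
    exact h'
  have mid : ∀ k : ℝ, arcpt ((r ^ 2 : ℝ) : ℂ) (2 * k) 1 = -((r ^ 2 : ℝ) : ℂ) →
      (qm (csq ((1 + arcpt (-(r : ℂ)) k 1) / 2))).re <
        (pp (csq ((1 + arcpt (-(r : ℂ)) k 1) / 2))).re := fun k hk => by
    obtain ⟨-, -, -, -, -, -, g, hg, e'⟩ := loc _ k n1 1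
    rw [q2, hk] at e'
    have := congrArg Complex.re e'
    rw [neg_mul, Complex.neg_re, Complex.re_ofReal_mul, Complex.sub_re] at this
    nlinarith [mul_pos (pow_pos hr 2) hg]
  have fin : ∀ e : ℂ, e = r → (pp (csq ((1 + e) / 2))).re < (qm (csq ((1 + e) / 2))).re :=
    fun e he => by
      rw [he]
      obtain ⟨-, -, -, -, -, -, g, hg, e'⟩ := hloc r hnr.le
      have := congrArg Complex.re e'
      rw [← Complex.ofReal_pow, Complex.re_ofReal_mul, Complex.sub_re] at this
      nlinarith [mul_pos (pow_pos hr 2) hg]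
  have sq0 : 0 ≤ r ^ 2 := sq_nonneg r
  have htp : tp < 3 / 4 := by nlinarith
  have htp' : 1 < 2 * tp ^ 2 := by linarith
  constructor
  · have hk : 2 * (1 / 2 : ℝ) = 1 := by norm_num
    have A := (fam _ (1 / 2) n1).swap_right hΦ (fun s _ => lo _ _ n1 s) (fun s _ => hi _ _ n1 s)
      (fun s hs => above _ _ n1 s (by rw [q1, hk]; exact arcpt_im_nonneg sq0 hs))
      (mid _ (by rw [hk, arcpt_one_one])) (start _)
    have e1 := arcpt_arcpt_half (-(r : ℂ))
    rw [neg_neg] at e1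
    have B := (fam _ (1 / 2) (n2 (1 / 2))).swap12.swap_right hΦ (fun s _ => (lo _ _ (n2 _) s).symm)
      (fun s _ => (hi _ _ (n2 _) s).symm)
      (fun s hs => below _ _ (n2 _) s (by
        rw [q2, hk, arcpt_one_one, arcpt_neg, Complex.neg_im]
        exact neg_nonpos.2 (arcpt_im_nonneg sq0 hs)))
      (fin (arcpt (arcpt (-(r : ℂ)) (1 / 2) 1) (1 / 2) 1) e1) (by rw [arcpt_zero]; exact A)
    rw [e1, hcp] at B
    exact quad_tangent hΦ hpp htp htp' B
  · have hk : 2 * (-1 / 2 : ℝ) = -1 := by norm_num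
    have A := (fam _ (-1 / 2) n1).swap_left hΦ (fun s _ => lo _ _ n1 s) (fun s _ => hi _ _ n1 s)
      (fun s hs => below _ _ n1 s (by rw [q1, hk]; exact arcpt_im_neg sq0 hs))
      (mid _ (by rw [hk, arcpt_one_neg])) (start _)
    have e1 := arcpt_arcpt_neg_half (-(r : ℂ))
    rw [neg_neg] at e1
    have B := (fam _ (-1 / 2) (n2 (-1 / 2))).swap12.swap_left hΦ
      (fun s _ => (lo _ _ (n2 _) s).symm) (fun s _ => (hi _ _ (n2 _) s).symm)
      (fun s hs => above _ _ (n2 _) s (by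
        rw [q2, hk, arcpt_one_neg, arcpt_neg, Complex.neg_im]
        exact neg_nonneg.2 (arcpt_im_neg sq0 hs)))
      (fin (arcpt (arcpt (-(r : ℂ)) (-1 / 2) 1) (-1 / 2) 1) e1) (by rw [arcpt_zero]; exact A)
    rw [e1, hcp] at B
    exact quad_tangent hΦ hpp htp htp' B

end

section

/-- The antiholomorphic reflection `(M, T) ↦ (-M̄, -T̄)`, lifted to the logarithm of `T`. -/
def mirror (p : ℂ × ℂ) : ℂ × ℂ :=
  (-(starRingEnd ℂ) p.1, (starRingEnd ℂ) p.2 + Real.pi * Complex.I)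

theorem continuous_mirror : Continuous mirror := by
  unfold mirror
  have := Complex.continuous_conj
  fun_prop

theorem dd_mirror (M θ : ℂ) : DD (-(starRingEnd ℂ) M)
    (Complex.exp ((starRingEnd ℂ) θ + Real.pi * Complex.I)) =
      (starRingEnd ℂ) (DD M (Complex.exp θ)) := by
  rw [Complex.exp_add, Complex.exp_pi_mul_I, Complex.exp_conj, DD, DD]
  simp only [map_mul, map_sub, map_add, map_pow, map_one, map_ofNat]
  ring

theorem dd_mirror_eq_zero {M θ : ℂ} : DD (-(starRingEnd ℂ) M)
    (Complex.exp ((starRingEnd ℂ) θ + Real.pi * Complex.I)) = 0 ↔ DD M (Complex.exp θ) = 0 := by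
  rw [dd_mirror, map_eq_zero]

theorem dd_mirror_eq_zero' {M θ : ℂ} :
    DD M (Complex.exp ((starRingEnd ℂ) θ + Real.pi * Complex.I)) = 0 ↔
      DD (-(starRingEnd ℂ) M) (Complex.exp θ) = 0 := by
  rw [← dd_mirror_eq_zero (θ := θ), map_neg, Complex.conj_conj, neg_neg]

/-- The reflection as a self-map of the complement of the branch curve. -/
def mirrorMap : C(UU, UU) :=
  ⟨fun p => ⟨mirror p.1, fun h => p.2 (dd_mirror_eq_zero.1 h)⟩,
    (continuous_mirror.comp continuous_subtype_val).subtype_mk _⟩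

theorem topH_mirror (θ : ℂ) : topH ((starRingEnd ℂ) θ + Real.pi * Complex.I) = topH θ := by
  simp [topH]

theorem mirror_mem_far {p : ℂ × ℂ} (h : p ∈ Far) : mirror p ∈ Far := by
  change topH ((starRingEnd ℂ) p.2 + Real.pi * Complex.I) - 1 < (-(starRingEnd ℂ) p.1).im
  rw [topH_mirror, Complex.neg_im, Complex.conj_im, neg_neg]
  exact h

theorem Clear.mirror {l l' h : ℝ} {θ : ℂ} (hc : Clear l l' h θ) :
    Clear (-l') (-l) h ((starRingEnd ℂ) θ + Real.pi * Complex.I) := by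
  intro M hM
  obtain ⟨h1, h2, h3⟩ := hc _ (dd_mirror_eq_zero'.1 hM)
  simp only [Complex.neg_re, Complex.conj_re, Complex.neg_im, Complex.conj_im, neg_neg] at h1 h2 h3
  exact ⟨fun e => h2 (by linarith), fun e => h1 (by linarith),
    fun e i => h3 e ⟨by linarith [i.2], by linarith [i.1]⟩⟩

theorem Alone.mirror {θ z : ℂ} {η : ℝ}
    (h : Alone ((starRingEnd ℂ) θ + Real.pi * Complex.I) (-(starRingEnd ℂ) z) η) :
    Alone θ z η := by
  intro M hM hne hi
  have := h _ (dd_mirror_eq_zero.2 hM) (fun e => hne ?_) (by simpa using hi)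
  · rw [abs_sub_comm] at this
    simpa [neg_add_eq_sub] using this
  · simpa using congrArg (starRingEnd ℂ) e

theorem clamp_one_sub (x : ℝ) : clamp (1 - x) = 1 - clamp x := by
  rcases le_total x 0 with h | h
  · rw [clamp_of_nonpos h, clamp_of_one_le (by linarith), sub_zero]
  · rcases le_total x 1 with h' | h'
    · rw [clamp_of_mem h h', clamp_of_mem (by linarith) (by linarith)]
    · rw [clamp_of_one_le h', clamp_of_nonpos (by linarith), sub_self]

theorem mirror_box (l l' h : ℝ) (θ : ℂ) (t : ℝ) : mirror (box l l' h θ t) =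
    box (-l') (-l) h ((starRingEnd ℂ) θ + Real.pi * Complex.I) (3 - t) := by
  rw [box, box, mirror, topH_mirror, show 3 - t - 1 = 1 - (t - 1) by ring,
    show 3 - t - 2 = 1 - t by ring, show 3 - t = 1 - (t - 2) by ring, clamp_one_sub, clamp_one_sub,
    clamp_one_sub]
  refine Prod.ext (Complex.ext ?_ ?_) rfl
  · simp only [Complex.neg_re, Complex.conj_re, pt_re]
    ring
  · simp only [Complex.neg_im, Complex.conj_im, pt_im]
    ring

variable {G : Type*} [Group G] {Φ : PathHom UU G}

theorem hol_comap_mirror {f : ℝ → ℂ × ℂ} {a b : ℝ} (hab : a ≤ b) (hf : CurveIn UU f a b) :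
    (Φ.comap mirrorMap).hol f a b = Φ.hol (fun t => mirror (f t)) a b := by
  obtain ⟨k, hk⟩ := hf.exists_map hab
  rw [PathHom.hol_eq _ hab k hk, PathHom.comap_ev,
    Φ.hol_eq hab (mirrorMap.comp k) fun t ht => by simp [mirrorMap, hk t ht]]

theorem FarTrivial.mirror (hΦ : FarTrivial Φ) : FarTrivial (Φ.comap mirrorMap) :=
  fun f a b hab hf => by
    rw [hol_comap_mirror hab ⟨hf.1, fun t ht => far_subset (hf.2 t ht)⟩]
    exact hΦ _ a b hab ⟨continuous_mirror.comp_continuousOn hf.1,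
      fun t ht => mirror_mem_far (hf.2 t ht)⟩

theorem bx_mirror {l l' h : ℝ} {θ : ℂ} (hl : l ≤ l') (hc : Clear l l' h θ) :
    bx (Φ.comap mirrorMap) l l' h θ =
      (bx Φ (-l') (-l) h ((starRingEnd ℂ) θ + Real.pi * Complex.I))⁻¹ := by
  rw [bx, hol_comap_mirror (by norm_num) (curveIn_box hl hc), bx]
  simp only [mirror_box]
  exact Φ.hol_reverse (φ := fun t => 3 - t) (by norm_num) (by fun_prop)
    (fun t ht => ⟨by linarith [ht.2], by linarith [ht.1]⟩) (by norm_num)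
    (curveIn_box (by linarith) hc.mirror) (by norm_num) (by norm_num)

theorem Mer.mirror {θ z : ℂ} {g : G}
    (h : Mer Φ ((starRingEnd ℂ) θ + Real.pi * Complex.I) (-(starRingEnd ℂ) z) g) :
    Mer (Φ.comap mirrorMap) θ z g⁻¹ := by
  obtain ⟨η, h0, ha, rfl⟩ := h
  refine ⟨η, h0, ha.mirror, ?_⟩
  rw [bx_mirror (by linarith) (ha.mirror.clear h0)]
  congr 2 <;> simp <;> ring

theorem baseT_dom : baseT ∈ Dom := mem_dom_of_im (by simp [baseT])

theorem log_baseT : (starRingEnd ℂ) (Complex.log baseT) + Real.pi * Complex.I =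
    Complex.log baseT := by
  have : (Complex.log baseT).im = Real.pi / 2 := by
    rw [Complex.log_im, baseT, Complex.arg_real_mul _ (by norm_num), Complex.arg_I]
  refine Complex.ext (by simp) ?_
  simp only [Complex.add_im, Complex.conj_im, this, Complex.mul_im, Complex.ofReal_re,
    Complex.I_im, Complex.ofReal_im, Complex.I_re]
  ring

theorem mirror_roots : -(starRingEnd ℂ) (pm baseT) = qm baseT ∧
    -(starRingEnd ℂ) (pp baseT) = qp baseT ∧ -(starRingEnd ℂ) (qp baseT) = pp baseT ∧
    -(starRingEnd ℂ) (qm baseT) = pm baseT := by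
  have hT : (starRingEnd ℂ) baseT = -baseT := by
    rw [baseT, map_mul, Complex.conj_ofReal, Complex.conj_I, mul_neg]
  have hw : csq (3 + 4 * baseT) = (starRingEnd ℂ) (csq (3 - 4 * baseT)) := by
    refine csq_eq baseT_dom.2.2 (by simpa using csq_re_pos baseT_dom.2.1) ?_
    rw [← map_pow, csq_sub_sq baseT_dom, map_sub, map_mul, hT, map_ofNat, map_ofNat]
    ring
  simp only [pm, pp, qp, qm, hw, map_sub, map_add, map_neg, map_mul, map_one, hT,
    Complex.conj_conj]
  refine ⟨?_, ?_, ?_, ?_⟩ <;> ring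

theorem Quad.mirror {x₁ x₂ x₃ x₄ : G}
    (h : Quad Φ (Complex.log baseT) (pm baseT) (pp baseT) (qp baseT) (qm baseT) x₁ x₂ x₃ x₄) :
    Quad (Φ.comap mirrorMap) (Complex.log baseT) (pm baseT) (pp baseT) (qp baseT) (qm baseT)
      x₄⁻¹ x₃⁻¹ x₂⁻¹ x₁⁻¹ := by
  obtain ⟨r1, r2, r3, r4⟩ := mirror_roots
  refine ⟨h.roots, h.h01, h.h12, h.h23, Mer.mirror ?_, Mer.mirror ?_, Mer.mirror ?_,
    Mer.mirror ?_⟩ <;> rw [log_baseT]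
  · rw [r1]; exact h.m3
  · rw [r2]; exact h.m2
  · rw [r3]; exact h.m1
  · rw [r4]; exact h.m0

theorem braid_of_tacnode {x₁ x₂ x₃ x₄ : G} (hz : x₁ * x₂ = x₃ * x₄) (h23 : x₂ * x₃ = x₃ * x₂)
    (h1 : x₁ = (x₃ * x₄ * x₃⁻¹)⁻¹ * x₂ * (x₃ * x₄ * x₃⁻¹))
    (h2 : x₁ = x₂ * (x₃ * x₄ * x₃⁻¹) * x₂⁻¹ * x₂ * (x₂ * (x₃ * x₄ * x₃⁻¹) * x₂⁻¹)⁻¹) :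
    x₁ * x₂ * x₁ = x₂ * x₁ * x₂ ∧ x₁ * x₃ = x₃ * x₁ := by
  rw [← hz] at h1 h2
  have e3 : x₃⁻¹ * x₂ = x₂ * x₃⁻¹ := (Commute.inv_right (show Commute x₂ x₃ from h23)).symm
  have hb : x₁ * x₂ * x₁ = x₂ * x₁ * x₂ := by
    have e := congrArg (· * (x₂ * (x₁ * x₂ * x₃⁻¹))) h2
    simp only [mul_inv_rev, inv_inv, mul_assoc, inv_mul_cancel_left, mul_inv_cancel, mul_one] at e
    rw [e3] at e
    simpa only [← mul_assoc, mul_left_inj] using e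
  refine ⟨hb, ?_⟩
  rw [mul_assoc, eq_inv_mul_iff_mul_eq, ← mul_assoc, ← mul_assoc, ← hb, mul_assoc (x₁ * x₂),
    mul_assoc (x₁ * x₂), mul_right_inj] at h1
  have h : Commute x₃⁻¹ x₁ := h1
  exact (Commute.inv_left_iff.1 h).symm

theorem eq_of_commute_of_braid {a b : G} (hc : Commute a b) (h : a * b * a = b * a * b) :
    a = b := by
  rwa [← hc.eq, mul_right_inj] at h

/-- The meridians over the base value satisfy the relations of an abelian group on two generators
with equal squares, provided the products of the two pairs agree. -/
theorem quad_relations (hΦ : FarTrivial Φ) {x₁ x₂ x₃ x₄ : G}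
    (h : Quad Φ (Complex.log baseT) (pm baseT) (pp baseT) (qp baseT) (qm baseT) x₁ x₂ x₃ x₄)
    (hz : x₁ * x₂ = x₃ * x₄) : x₁ = x₂ ∧ x₃ = x₄ ∧ Commute x₁ x₃ := by
  have h23 := quad_commute hΦ h
  obtain ⟨t1, t2⟩ := quad_tacnode hΦ (quad_two_fifths hΦ h)
  obtain ⟨b1, c1⟩ := braid_of_tacnode hz h23 t1 t2
  have h' := h.mirror
  have h23' := quad_commute hΦ.mirror h'
  obtain ⟨t1', t2'⟩ := quad_tacnode hΦ.mirror (quad_two_fifths hΦ.mirror h')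
  obtain ⟨b2, c2⟩ := braid_of_tacnode (by
    rw [← mul_inv_rev, ← mul_inv_rev, hz]) h23' t1' t2'
  have k13 : Commute x₁ x₃ := c1
  have k23 : Commute x₂ x₃ := h23
  have k42 : Commute x₄ x₂ := by
    have : Commute x₄⁻¹ x₂⁻¹ := c2
    exact Commute.inv_inv_iff.1 this
  have k34 : Commute x₃ x₄ := by
    have : Commute x₃ (x₃ * x₄) := hz ▸ k13.symm.mul_right k23.symm
    have := ((Commute.refl x₃).inv_right).mul_right this
    rwa [inv_mul_cancel_left] at this
  have k12 : Commute x₁ x₂ := by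
    have : Commute x₂ (x₁ * x₂) := hz ▸ k23.mul_right k42.symm
    have := this.mul_right ((Commute.refl x₂).inv_right)
    rw [mul_inv_cancel_right] at this
    exact this.symm
  refine ⟨?_, ?_, k13⟩
  · exact eq_of_commute_of_braid k12 b1
  · exact (inv_injective (eq_of_commute_of_braid k34.symm.inv_inv b2)).symm

end

section

variable {G : Type*} [Group G] {Φ : PathHom UU G} {c : G}

/-- Compatibility of `Φ` with the deck translation of the logarithmic coordinate, and with the
discs `M = e + 6 T` filling the puncture `T = 0`. -/
structure Monodromic (Φ : PathHom UU G) (c : G) : Prop where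
  far : FarTrivial Φ
  shift : ∀ (f : ℝ → ℂ × ℂ) (a b : ℝ), a ≤ b → CurveIn UU f a b →
    Φ.hol (fun t => ((f t).1, (f t).2 + 2 * Real.pi * Complex.I)) a b = c * Φ.hol f a b * c⁻¹
  disc : ∀ e : ℂ, e = 1 ∨ e = -1 →
    Φ.hol (fun s : ℝ => (e + 6 * baseT * Complex.exp (2 * Real.pi * s * Complex.I),
      Complex.log baseT + 2 * Real.pi * s * Complex.I)) 0 1 = c⁻¹

theorem norm_baseT : ‖baseT‖ = 1 / 10 := by
  simp [baseT]

theorem baseT_ne_zero : baseT ≠ 0 := by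
  rw [← norm_ne_zero_iff, norm_baseT]; norm_num

theorem norm_lt_of_sq_eq {A T k : ℂ} (hT : ‖T‖ = 1 / 10) (hk : ‖k‖ = 4)
    (hA : A ^ 2 = T ^ 2 * (3 + k * T)) : ‖A‖ < 1 / 5 := by
  have h1 : ‖A‖ ^ 2 = ‖T‖ ^ 2 * ‖3 + k * T‖ := by rw [← norm_pow, hA, norm_mul, norm_pow]
  have h2 := norm_add_le 3 (k * T)
  rw [norm_mul, hk, hT, show ‖(3 : ℂ)‖ = 3 by simp] at h2
  rw [hT] at h1
  nlinarith [norm_nonneg A]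

theorem near_root {M T : ℂ} (hT : ‖T‖ = 1 / 10) (h : DD M T = 0) :
    ‖M + 1‖ < 1 / 5 ∨ ‖M - 1‖ < 1 / 5 := by
  rcases mul_eq_zero.1 h with h | h
  · exact Or.inl (norm_lt_of_sq_eq hT (k := -4) (by simp) (by linear_combination h))
  · exact Or.inr (norm_lt_of_sq_eq hT (k := 4) (by simp) (by linear_combination h))

theorem norm_exp_of_im {r : ℝ} :
    ‖Complex.exp (Complex.log baseT + 2 * Real.pi * r * Complex.I)‖ = 1 / 10 := by
  rw [Complex.exp_add, norm_mul, Complex.exp_log baseT_ne_zero, norm_baseT,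
    show (2 * Real.pi * r * Complex.I : ℂ) = ((2 * Real.pi * r : ℝ) : ℂ) * Complex.I by push_cast; ring,
    Complex.norm_exp_ofReal_mul_I, mul_one]

/-- Points near `e` horizontally but not in the small disc around `e` are not roots. -/
theorem mem_UU_of_far_from {e M θ : ℂ} (he : e = 1 ∨ e = -1) (hT : ‖Complex.exp θ‖ = 1 / 10)
    (h1 : |(M - e).re| ≤ 1) (h2 : ∃ p q : ℝ, p ^ 2 + q ^ 2 ≤ 1 ∧
      1 / 5 ≤ p * (M - e).re + q * (M - e).im) : (M, θ) ∈ UU := by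
  intro hD
  obtain ⟨p, q, hpq, h2⟩ := h2
  have h3 : ∀ z : ℂ, z.re ^ 2 + z.im ^ 2 = ‖z‖ ^ 2 := fun z => by
    rw [Complex.sq_norm, Complex.normSq_apply]; ring
  have h4 : ¬ ‖M - e‖ < 1 / 5 := fun h => by
    have h5 := h3 (M - e)
    have h6 := norm_nonneg (M - e)
    generalize (M - e).re = x at *
    generalize (M - e).im = y at *
    have h7 : (p * x + q * y) ^ 2 ≤ (p ^ 2 + q ^ 2) * (x ^ 2 + y ^ 2) := by
      nlinarith [sq_nonneg (p * y - q * x)]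
    nlinarith [sq_nonneg x, sq_nonneg y]
  have h5 : ¬ ‖M + e‖ < 1 / 5 := fun h => by
    have h6 := (Complex.abs_re_le_norm (M + e)).trans_lt h
    rw [abs_lt] at h6
    rw [abs_le] at h1
    rcases he with rfl | rfl <;> simp at h1 h6 <;> linarith
  rcases near_root hT hD with h | h <;> rcases he with rfl | rfl
  · exact h5 h
  · exact h4 (by simpa using h)
  · exact h4 h
  · exact h5 (by simpa [sub_eq_add_neg] using h)

/-- The vertical coordinate of the stem of the keyhole. -/
def stem (t : ℝ) : ℝ := 3 / 5 + (topH (Complex.log baseT) - 3 / 5) * (1 - clamp t + clamp (t - 2))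

/-- The keyhole around `e`, with the logarithmic coordinate increasing by `2 π s i`. -/
def keyhole (e : ℂ) (s t : ℝ) : ℂ × ℂ :=
  (e + Complex.I * stem t * Complex.exp (2 * Real.pi * clamp (t - 1) * Complex.I),
    Complex.log baseT + 2 * Real.pi * (s * clamp (t - 1) : ℝ) * Complex.I)

theorem clamp_mem (x : ℝ) : 0 ≤ clamp x ∧ clamp x ≤ 1 :=
  ⟨le_max_left _ _, max_le zero_le_one (min_le_right _ _)⟩

theorem clamp_cases (t : ℝ) : (clamp (t - 1) = 0 ∧ clamp (t - 2) = 0) ∨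
    (clamp t = 1 ∧ clamp (t - 2) = 0 ∧ clamp (t - 1) = t - 1 ∧ 1 ≤ t ∧ t ≤ 2) ∨
    (clamp t = 1 ∧ clamp (t - 1) = 1) := by
  rcases le_total t 1 with h1 | h1
  · exact Or.inl ⟨clamp_of_nonpos (by linarith), clamp_of_nonpos (by linarith)⟩
  rcases le_total t 2 with h2 | h2
  · exact Or.inr (Or.inl ⟨clamp_of_one_le h1, clamp_of_nonpos (by linarith),
      clamp_of_mem (by linarith) (by linarith), h1, h2⟩)
  · exact Or.inr (Or.inr ⟨clamp_of_one_le h1, clamp_of_one_le (by linarith)⟩)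

theorem keyhole_re_im (e : ℂ) (s t : ℝ) : ((keyhole e s t).1 - e).re =
      -(stem t * Real.sin (2 * Real.pi * clamp (t - 1))) ∧
    ((keyhole e s t).1 - e).im = stem t * Real.cos (2 * Real.pi * clamp (t - 1)) := by
  have : (2 * Real.pi * clamp (t - 1) * Complex.I : ℂ) =
    ((2 * Real.pi * clamp (t - 1) : ℝ) : ℂ) * Complex.I := by push_cast; ring
  rw [keyhole, this, Complex.exp_mul_I, ← Complex.ofReal_cos, ← Complex.ofReal_sin]
  generalize Real.cos (2 * Real.pi * clamp (t - 1)) = x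
  generalize Real.sin (2 * Real.pi * clamp (t - 1)) = y
  constructor <;> simp

theorem sector_bounds {u : ℝ} (h0 : 0 ≤ u) (h1 : u ≤ 1) :
    (0 ≤ Real.sin (2 * Real.pi * u) ∧ 0 ≤ Real.cos (2 * Real.pi * u) ∧ u ≤ 1 / 8) ∨
    (7 / 10 ≤ Real.sin (2 * Real.pi * u) ∧ u ≤ 3 / 8) ∨
    (Real.cos (2 * Real.pi * u) ≤ -(7 / 10)) ∨
    (Real.sin (2 * Real.pi * u) ≤ -(7 / 10) ∧ 5 / 8 ≤ u) ∨
    (Real.sin (2 * Real.pi * u) ≤ 0 ∧ 0 ≤ Real.cos (2 * Real.pi * u) ∧ 7 / 8 ≤ u) := by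
  have hp := Real.pi_pos
  have h7 : 7 / 10 ≤ √2 / 2 := by
    have : 7 / 5 ≤ √2 := Real.le_sqrt_of_sq_le (by norm_num)
    linarith
  have hc : ∀ x, |x| ≤ Real.pi / 4 → 7 / 10 ≤ Real.cos x := fun x hx => by
    rw [← Real.cos_abs]
    refine h7.trans ?_
    rw [← Real.cos_pi_div_four]
    exact Real.cos_le_cos_of_nonneg_of_le_pi (abs_nonneg x) (by linarith) hx
  rcases le_total u (1 / 8) with h | h
  · exact Or.inl ⟨Real.sin_nonneg_of_nonneg_of_le_pi (by positivity) (by nlinarith),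
      Real.cos_nonneg_of_mem_Icc ⟨by nlinarith, by nlinarith⟩, h⟩
  rcases le_total u (3 / 8) with h' | h'
  · refine Or.inr (Or.inl ⟨?_, h'⟩)
    rw [← Real.cos_sub_pi_div_two]
    exact hc _ (abs_le.2 ⟨by nlinarith, by nlinarith⟩)
  rcases le_total u (5 / 8) with h'' | h''
  · refine Or.inr (Or.inr (Or.inl ?_))
    rw [← neg_le_neg_iff, neg_neg, ← Real.cos_sub_pi]
    exact hc _ (abs_le.2 ⟨by nlinarith, by nlinarith⟩)
  rcases le_total u (7 / 8) with h3 | h3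
  · refine Or.inr (Or.inr (Or.inr (Or.inl ⟨?_, h''⟩)))
    rw [← neg_le_neg_iff, neg_neg, ← Real.cos_add_pi_div_two, ← Real.cos_sub_two_pi]
    exact hc _ (abs_le.2 ⟨by nlinarith, by nlinarith⟩)
  · refine Or.inr (Or.inr (Or.inr (Or.inr ⟨?_, ?_, h3⟩)))
    · rw [← Real.sin_sub_two_pi]
      exact Real.sin_nonpos_of_nonpos_of_neg_pi_le (by nlinarith) (by nlinarith)
    · rw [← Real.cos_sub_two_pi]
      exact Real.cos_nonneg_of_mem_Icc ⟨by nlinarith, by nlinarith⟩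

theorem three_fifths_le_stem (t : ℝ) : 3 / 5 ≤ stem t := by
  have h1 := clamp_mem t
  have h2 := clamp_mem (t - 2)
  have h3 := topH_pos (Complex.log baseT)
  rw [stem]
  nlinarith [mul_nonneg (by linarith : 0 ≤ topH (Complex.log baseT) - 3 / 5)
    (by linarith : 0 ≤ 1 - clamp t + clamp (t - 2))]

/-- The keyhole around `e` and the box around `e` are contained in a common half-plane at each
time. -/
theorem keyhole_box_half_plane (t : ℝ) : ∃ p q : ℝ, p ^ 2 + q ^ 2 ≤ 1 ∧
    |-(stem t * Real.sin (2 * Real.pi * clamp (t - 1)))| ≤ 1 ∧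
    1 / 5 ≤ p * -(stem t * Real.sin (2 * Real.pi * clamp (t - 1))) +
      q * (stem t * Real.cos (2 * Real.pi * clamp (t - 1))) ∧
    1 / 5 ≤ p * (-1 + 2 * clamp (t - 1)) + q * (-(3 / 5) +
      (topH (Complex.log baseT) + 3 / 5) * (1 - clamp t + clamp (t - 2))) := by
  have hs := three_fifths_le_stem t
  have hH := topH_pos (Complex.log baseT)
  rcases clamp_cases t with ⟨h1, h2⟩ | ⟨h0, h2, h1, ht, ht'⟩ | ⟨h0, h1⟩
  · have := mul_nonneg (by linarith : 0 ≤ topH (Complex.log baseT) + 3 / 5)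
      (by linarith [clamp_mem t] : 0 ≤ 1 - clamp t)
    refine ⟨-(4 / 5), 3 / 5, by norm_num, ?_⟩
    rw [h1, h2]
    simp only [mul_zero, Real.sin_zero, Real.cos_zero, neg_zero, abs_zero]
    refine ⟨by norm_num, by linarith, by linarith⟩
  · have hst : stem t = 3 / 5 := by rw [stem, h0, h2]; ring
    have hsq := Real.sin_sq_add_cos_sq (2 * Real.pi * (t - 1))
    have hb := Real.abs_sin_le_one (2 * Real.pi * (t - 1))
    have ha : |-(3 / 5 * Real.sin (2 * Real.pi * (t - 1)))| ≤ 1 := by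
      rw [abs_neg, abs_mul, abs_of_pos (by norm_num : (0 : ℝ) < 3 / 5)]; linarith
    rw [hst, h0, h1, h2]
    have hu := sector_bounds (by linarith : 0 ≤ t - 1) (by linarith)
    generalize Real.sin (2 * Real.pi * (t - 1)) = x at *
    generalize Real.cos (2 * Real.pi * (t - 1)) = y at *
    rcases hu with ⟨a, b, d⟩ | ⟨a, b⟩ | a | ⟨a, b⟩ | ⟨a, b, d⟩
    · refine ⟨-(4 / 5), 3 / 5, by norm_num, ha, ?_, by linarith⟩
      have : 1 ≤ x + y := by nlinarith
      linarith
    · exact ⟨-1, 0, by norm_num, ha, by linarith, by linarith⟩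
    · exact ⟨0, -1, by norm_num, ha, by linarith, by linarith⟩
    · exact ⟨1, 0, by norm_num, ha, by linarith, by linarith⟩
    · refine ⟨4 / 5, 3 / 5, by norm_num, ha, ?_, by linarith⟩
      have : 1 ≤ -x + y := by nlinarith
      linarith
  · have := mul_nonneg (by linarith : 0 ≤ topH (Complex.log baseT) + 3 / 5)
      (clamp_mem (t - 2)).1
    refine ⟨4 / 5, 3 / 5, by norm_num, ?_⟩
    rw [h0, h1, mul_one, Real.sin_two_pi, Real.cos_two_pi]
    simp only [mul_zero, neg_zero, abs_zero]
    refine ⟨by norm_num, by linarith, by linarith⟩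

theorem keyhole_mem {e : ℂ} (he : e = 1 ∨ e = -1) (s t : ℝ) : keyhole e s t ∈ UU := by
  obtain ⟨p, q, h, h1, h2, -⟩ := keyhole_box_half_plane t
  obtain ⟨e1, e2⟩ := keyhole_re_im e s t
  rw [← e1] at h1
  rw [← e1, ← e2] at h2
  exact mem_UU_of_far_from he norm_exp_of_im h1 ⟨p, q, h, h2⟩

theorem continuous_keyhole (e : ℂ) : Continuous fun p : ℝ × ℝ => keyhole e p.1 p.2 := by
  unfold keyhole stem
  fun_prop

theorem keyhole_zero (e : ℂ) (s : ℝ) :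
    keyhole e s 0 = (e + Complex.I * topH (Complex.log baseT), Complex.log baseT) := by
  simp [keyhole, stem, clamp_of_nonpos]

theorem keyhole_three (e : ℂ) (s : ℝ) :
    keyhole e s 3 = (e + Complex.I * topH (Complex.log baseT),
      Complex.log baseT + 2 * Real.pi * s * Complex.I) := by
  rw [keyhole, stem, clamp_of_one_le, clamp_of_one_le, clamp_of_one_le]
  · simp [Complex.exp_two_pi_mul_I]
  all_goals norm_num

theorem im_of_unit {e : ℂ} (he : e = 1 ∨ e = -1) : e.im = 0 ∧ pt e.re 0 = e := by
  rcases he with rfl | rfl <;> simp [pt, Complex.ext_iff]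

theorem bx_eq_hol_keyhole (hΦ : FarTrivial Φ) {e : ℂ} (he : e = 1 ∨ e = -1) :
    bx Φ (e.re - 1) (e.re + 1) (-(3 / 5)) (Complex.log baseT) = Φ.hol (keyhole e 0) 0 3 := by
  have him := (im_of_unit he).1
  have hT := topH_pos (Complex.log baseT)
  have e1 : ∀ t, (box (e.re - 1) (e.re + 1) (-(3 / 5)) (Complex.log baseT) t).1 - e =
      pt (-1 + 2 * clamp (t - 1)) (-(3 / 5) +
      (topH (Complex.log baseT) + 3 / 5) * (1 - clamp t + clamp (t - 2))) := fun t => by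
    apply Complex.ext <;> simp [box, him] <;> ring
  have key := Φ.hol_slide (H := fun p : ℝ × ℝ =>
    ((1 - p.1 : ℝ) * (box (e.re - 1) (e.re + 1) (-(3 / 5)) (Complex.log baseT) p.2).1 +
      (p.1 : ℝ) * (keyhole e 0 p.2).1, Complex.log baseT)) zero_le_one
      (by norm_num : (0 : ℝ) ≤ 3) ?_ ?_ ?_ ?_
  · rw [bx]
    refine Eq.trans (Φ.hol_congr fun t _ => ?_) (key.trans (Φ.hol_congr fun t _ => ?_))
    · simp [box]
    · simp [keyhole]
  · have := continuous_keyhole e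
    have h1 : Continuous fun p : ℝ × ℝ => (keyhole e 0 p.2).1 :=
      (this.comp (continuous_const.prodMk continuous_snd)).fst
    simp only [box]
    fun_prop
  · rintro ⟨s, t⟩ ⟨⟨hs0 : 0 ≤ s, hs1 : s ≤ 1⟩, -⟩
    obtain ⟨p, q, h, h1, h2, h3⟩ := keyhole_box_half_plane t
    obtain ⟨k1, k2⟩ := keyhole_re_im e 0 t
    have h4 : |-1 + 2 * clamp (t - 1)| ≤ 1 := by
      have := clamp_mem (t - 1)
      rw [abs_le]; constructor <;> linarith
    have e2 : ((1 - s : ℝ) * (box (e.re - 1) (e.re + 1) (-(3 / 5)) (Complex.log baseT) t).1 +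
        (s : ℝ) * (keyhole e 0 t).1 - e : ℂ) =
        (1 - s : ℝ) * ((box (e.re - 1) (e.re + 1) (-(3 / 5)) (Complex.log baseT) t).1 - e) +
        (s : ℝ) * ((keyhole e 0 t).1 - e) := by
      push_cast; ring
    rw [e1] at e2
    refine mem_UU_of_far_from he ?_ ?_ ⟨p, q, h, ?_⟩
    · simpa using norm_exp_of_im (r := 0)
    all_goals
      simp only [e2, Complex.add_re, Complex.add_im, Complex.re_ofReal_mul,
        Complex.im_ofReal_mul, pt_re, pt_im, k1, k2]
    · rw [abs_le] at *
      constructor <;> nlinarith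
    · nlinarith
  all_goals
    simp only [box_zero, box_three, keyhole_zero, keyhole_three]
    refine hΦ _ _ _ zero_le_one ⟨by fun_prop, fun s _ => ?_⟩
    simp [Far, him]
    linarith

theorem hol_keyhole (hΦ : Monodromic Φ c) {e : ℂ} (he : e = 1 ∨ e = -1) :
    Φ.hol (keyhole e 0) 0 3 = c⁻¹ := by
  have him := (im_of_unit he).1
  have hT := topH_pos (Complex.log baseT)
  have hc := continuous_keyhole e
  have hk : CurveIn UU (keyhole e 1) 0 3 := ⟨(hc.comp (continuous_const.prodMk
    continuous_id)).continuousOn, fun t _ => keyhole_mem he 1 t⟩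
  have h1 : Φ.hol (keyhole e 0) 0 3 = Φ.hol (keyhole e 1) 0 3 := by
    refine Φ.hol_slide (H := fun p => keyhole e p.1 p.2) zero_le_one (by norm_num)
      hc.continuousOn (fun p _ => keyhole_mem he _ _) ?_ ?_
    all_goals
      simp only [keyhole_zero, keyhole_three]
      refine hΦ.far _ _ _ zero_le_one ⟨by fun_prop, fun s _ => ?_⟩
      simp [Far, him, topH, ← Complex.ofReal_exp, ← Complex.ofReal_pow]
      try linarith
  have h2 : Φ.hol (keyhole e 1) 1 2 = c⁻¹ := by
    have hd : CurveIn UU (fun s : ℝ => keyhole e 1 (s + 1)) 0 1 :=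
      ⟨(hc.comp (continuous_const.prodMk (by fun_prop : Continuous fun s : ℝ => s + 1))).continuousOn,
        fun t _ => keyhole_mem he 1 _⟩
    rw [← hΦ.disc e he]
    have h3 := Φ.hol_comp (φ := fun t => t - 1) (by norm_num : (1 : ℝ) ≤ 2) (by fun_prop)
      (fun t ht => ⟨by linarith [ht.1], by linarith [ht.2]⟩) zero_le_one hd (by norm_num)
      (by norm_num)
    simp only [sub_add_cancel] at h3
    rw [h3]
    refine Φ.hol_congr fun t ht => ?_
    have hst : stem (t + 1) = 3 / 5 := by
      rw [stem, clamp_of_one_le (by linarith [ht.1]), clamp_of_nonpos (by linarith [ht.2])]; ring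
    rw [keyhole, hst, add_sub_cancel_right, clamp_of_mem ht.1 ht.2, baseT]
    push_cast
    refine Prod.ext ?_ ?_
    · simp only; ring
    · simp only; ring
  have h3 : Φ.hol (keyhole e 1) 2 3 = (c * Φ.hol (keyhole e 1) 0 1 * c⁻¹)⁻¹ := by
    have h4 := hk.mono le_rfl (by norm_num : (1 : ℝ) ≤ 3)
    rw [← hΦ.shift _ _ _ zero_le_one h4]
    have h5 : CurveIn UU (fun t => ((keyhole e 1 t).1,
        (keyhole e 1 t).2 + 2 * Real.pi * Complex.I)) 0 1 := by
      refine ⟨?_, fun t ht => ?_⟩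
      · have h6 := h4.1
        generalize keyhole e 1 = k at h6
        fun_prop
      · have h6 := h4.2 t ht
        rw [UU, mem_ofPred_eq] at h6 ⊢
        rwa [Complex.exp_periodic]
    rw [← Φ.hol_reverse (φ := fun t => 3 - t) (by norm_num : (2 : ℝ) ≤ 3) (by fun_prop)
      (fun t ht => ⟨by linarith [ht.2], by linarith [ht.1]⟩) zero_le_one h5 (by norm_num)
      (by norm_num)]
    refine Φ.hol_congr fun t ht => ?_
    have k1 := ht.1
    have k2 := ht.2
    have e1 : stem (3 - t) = stem t := by
      rw [stem, stem, clamp_of_mem (by linarith) (by linarith), clamp_of_nonpos (by linarith),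
        clamp_of_one_le (by linarith : 1 ≤ t), clamp_of_mem (by linarith) (by linarith)]
      ring
    rw [keyhole, keyhole, e1, clamp_of_one_le (by linarith : 1 ≤ t - 1),
      clamp_of_nonpos (by linarith : 3 - t - 1 ≤ 0)]
    simp [Complex.exp_two_pi_mul_I]
  rw [h1, ← Φ.hol_trans (by norm_num : (0 : ℝ) ≤ 2) (by norm_num) hk,
    ← Φ.hol_trans zero_le_one (by norm_num) (hk.mono le_rfl (by norm_num : (2 : ℝ) ≤ 3)), h2, h3]
  group

theorem pair_product (hΦ : Monodromic Φ c) {e z₁ z₂ : ℂ} {g₁ g₂ : G} (he : e = 1 ∨ e = -1)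
    (h1 : ‖z₁ - e‖ < 1 / 5) (h2 : ‖z₂ - e‖ < 1 / 5) (h12 : z₁.re < z₂.re)
    (hr : ∀ M, DD M (Complex.exp (Complex.log baseT)) = 0 → M = z₁ ∨ M = z₂ ∨ ‖M + e‖ < 1 / 5)
    (m1 : Mer Φ (Complex.log baseT) z₁ g₁) (m2 : Mer Φ (Complex.log baseT) z₂ g₂) :
    g₁ * g₂ = c⁻¹ := by
  have him := (im_of_unit he).1
  have hb : ∀ z : ℂ, ‖z‖ < 1 / 5 → (-(1 / 5) < z.re ∧ z.re < 1 / 5) ∧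
      (-(1 / 5) < z.im ∧ z.im < 1 / 5) := fun z hz =>
    ⟨abs_lt.1 ((Complex.abs_re_le_norm z).trans_lt hz),
      abs_lt.1 ((Complex.abs_im_le_norm z).trans_lt hz)⟩
  obtain ⟨⟨a1, a2⟩, a3, a4⟩ := hb _ h1
  obtain ⟨⟨b1, b2⟩, b3, b4⟩ := hb _ h2
  simp only [Complex.sub_re, Complex.sub_im, him] at a1 a2 a3 a4 b1 b2 b3 b4
  have hfar : ∀ M : ℂ, ‖M + e‖ < 1 / 5 → ¬ (e.re - 1 ≤ M.re ∧ M.re ≤ e.re + 1) := by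
    rintro M hM ⟨h, h'⟩
    obtain ⟨⟨d1, d2⟩, -⟩ := hb _ hM
    rcases he with rfl | rfl <;> simp at d1 d2 h h' <;> linarith
  have hcl : ∀ l l' : ℝ, l ≤ l' → e.re - 1 ≤ l → l' ≤ e.re + 1 → l ≠ z₁.re → l' ≠ z₁.re →
      l ≠ z₂.re → l' ≠ z₂.re → Clear l l' (-(3 / 5)) (Complex.log baseT) := by
    intro l l' hll hl hl' n1 n2 n3 n4 M hM
    rcases hr M hM with rfl | rfl | h
    · exact ⟨fun h => absurd h.symm n1, fun h => absurd h.symm n2, fun h => by linarith⟩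
    · exact ⟨fun h => absurd h.symm n3, fun h => absurd h.symm n4, fun h => by linarith⟩
    · exact ⟨fun h5 => absurd ⟨by linarith, by linarith⟩ (hfar M h),
        fun h5 => absurd ⟨by linarith, by linarith⟩ (hfar M h),
        fun _ h5 => hfar M h ⟨by linarith, by linarith⟩⟩
  rw [← hol_keyhole hΦ he, ← bx_eq_hol_keyhole hΦ.far he,
    ← bx_mul (l' := (z₁.re + z₂.re) / 2) (by linarith) (by linarith)
      (hcl _ _ (by linarith) (by linarith) (by linarith) (by linarith) (by linarith)
        (by linarith) (by linarith))
      (hcl _ _ (by linarith) (by linarith) (by linarith) (by linarith) (by linarith)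
        (by linarith) (by linarith)),
    m1.bx_eq_of_unique hΦ.far (by linarith) (by linarith) (by linarith) ?_,
    m2.bx_eq_of_unique hΦ.far (by linarith) (by linarith) (by linarith) ?_]
  all_goals
    intro M hM hne k1 k2
    rcases hr M hM with rfl | rfl | h
    · first | exact absurd rfl hne | linarith
    · first | exact absurd rfl hne | linarith
    · exact absurd ⟨by linarith, by linarith⟩ (hfar M h)

/-- The two pairs of meridians over the base value have the same product. -/
theorem Quad.pair_products (hΦ : Monodromic Φ c) {x₁ x₂ x₃ x₄ : G}
    (h : Quad Φ (Complex.log baseT) (pm baseT) (pp baseT) (qp baseT) (qm baseT) x₁ x₂ x₃ x₄) :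
    x₁ * x₂ = c⁻¹ ∧ x₃ * x₄ = c⁻¹ := by
  have d1 := csq_sub_sq baseT_dom
  have d2 := csq_add_sq baseT_dom
  have n1 : ‖baseT * csq (3 - 4 * baseT)‖ < 1 / 5 :=
    norm_lt_of_sq_eq norm_baseT (k := -4) (by simp) (by rw [mul_pow, d1]; ring)
  have n2 : ‖baseT * csq (3 + 4 * baseT)‖ < 1 / 5 :=
    norm_lt_of_sq_eq norm_baseT (k := 4) (by simp) (by rw [mul_pow, d2])
  have e1 : ‖pm baseT - -1‖ < 1 / 5 := by
    rw [← norm_neg, show -(pm baseT - -1) = baseT * csq (3 - 4 * baseT) by rw [pm]; ring]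
    exact n1
  have e2 : ‖pp baseT - -1‖ < 1 / 5 := by
    rw [show pp baseT - -1 = baseT * csq (3 - 4 * baseT) by rw [pp]; ring]; exact n1
  have e3 : ‖qp baseT - 1‖ < 1 / 5 := by
    rw [show qp baseT - 1 = baseT * csq (3 + 4 * baseT) by rw [qp]; ring]; exact n2
  have e4 : ‖qm baseT - 1‖ < 1 / 5 := by
    rw [← norm_neg, show -(qm baseT - 1) = baseT * csq (3 + 4 * baseT) by rw [qm]; ring]
    exact n2
  have hr : ∀ M, DD M (Complex.exp (Complex.log baseT)) = 0 →
      M = pm baseT ∨ M = pp baseT ∨ M = qp baseT ∨ M = qm baseT := by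
    intro M hM
    obtain ⟨i, hi⟩ := (h.roots M).1 hM
    fin_cases i <;> simp at hi <;> simp [hi]
  constructor
  · refine pair_product hΦ (Or.inr rfl) e1 e2 h.h01 (fun M hM => ?_) h.m0 h.m1
    rcases hr M hM with rfl | rfl | rfl | rfl
    · exact Or.inl rfl
    · exact Or.inr (Or.inl rfl)
    · exact Or.inr (Or.inr e3)
    · exact Or.inr (Or.inr e4)
  · refine pair_product hΦ (Or.inl rfl) e3 e4 h.h23 (fun M hM => ?_) h.m2 h.m3
    rw [sub_neg_eq_add] at e1 e2
    rcases hr M hM with rfl | rfl | rfl | rfl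
    · exact Or.inr (Or.inr e1)
    · exact Or.inr (Or.inr e2)
    · exact Or.inl rfl
    · exact Or.inr (Or.inl rfl)

end

section

variable {G : Type*} [Group G] {Φ : PathHom UU G}

/-- The L-shaped curve in the fibre through `p` going horizontally to the line `Re M = l` and then
vertically to the far region. -/
def ell (l : ℝ) (p : ℂ × ℂ) (t : ℝ) : ℂ × ℂ :=
  (pt (p.1.re + (l - p.1.re) * clamp t) (p.1.im + (topH p.2 - p.1.im) * clamp (t - 1)), p.2)

theorem continuous_ell (l : ℝ) : Continuous fun q : (ℂ × ℂ) × ℝ => ell l q.1 q.2 := by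
  have := continuous_topH
  unfold ell
  fun_prop

theorem ell_zero (l : ℝ) (p : ℂ × ℂ) : ell l p 0 = p := by
  rw [ell, clamp_of_nonpos le_rfl, clamp_of_nonpos (by norm_num)]
  simp [pt]

theorem ell_two (l : ℝ) (p : ℂ × ℂ) : ell l p 2 = (pt l (topH p.2), p.2) := by
  rw [ell, clamp_of_one_le (by norm_num), clamp_of_one_le (by norm_num)]
  simp

/-- The values of `Φ` on L-shaped curves going to the right. -/
def ellValues (Φ : PathHom UU G) (p : ℂ × ℂ) : Set G :=
  {g | ∃ l, p.1.re ≤ l ∧ CurveIn UU (ell l p) 0 2 ∧ Φ.hol (ell l p) 0 2 = g}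

theorem ell_clear {l : ℝ} {p : ℂ × ℂ} (hl : p.1.re ≤ l) (h : CurveIn UU (ell l p) 0 2) :
    (∀ M, DD M (Complex.exp p.2) = 0 → M.re = l → M.im < p.1.im) ∧
    ∀ M, DD M (Complex.exp p.2) = 0 → M.im = p.1.im → ¬(p.1.re ≤ M.re ∧ M.re ≤ l) := by
  refine ⟨fun M hM hr => ?_, fun M hM hi hlr => ?_⟩
  · by_contra! hi
    have h1 := im_lt_topH hM
    have h2 : 0 < topH p.2 - p.1.im := by linarith
    have h3 : (M.im - p.1.im) / (topH p.2 - p.1.im) ≤ 1 := by rw [div_le_one h2]; linarith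
    have h4 : 0 ≤ (M.im - p.1.im) / (topH p.2 - p.1.im) := div_nonneg (by linarith) h2.le
    refine h.2 (1 + (M.im - p.1.im) / (topH p.2 - p.1.im)) ⟨by linarith, by linarith⟩ ?_
    rw [ell, clamp_of_one_le (by linarith), clamp_of_mem (by linarith) (by linarith)]
    convert hM using 2
    apply Complex.ext
    · simp [hr]
    · simp only [pt_im]; field_simp; ring
  · rcases hl.eq_or_lt with e | e
    · refine h.2 0 (by simp) ?_
      rw [ell_zero]
      convert hM using 2
      exact Complex.ext (by linarith) hi.symm
    have h2 : 0 < l - p.1.re := by linarith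
    have h3 : (M.re - p.1.re) / (l - p.1.re) ≤ 1 := by rw [div_le_one h2]; linarith
    have h4 : 0 ≤ (M.re - p.1.re) / (l - p.1.re) := div_nonneg (by linarith) h2.le
    refine h.2 ((M.re - p.1.re) / (l - p.1.re)) ⟨by linarith, by linarith⟩ ?_
    rw [ell, clamp_of_mem h4 h3, clamp_of_nonpos (by linarith)]
    convert hM using 2
    apply Complex.ext
    · simp only [pt_re]; field_simp; ring
    · simp [hi]

theorem hol_ell {l : ℝ} {p : ℂ × ℂ} (hl : p.1.re ≤ l) (h : CurveIn UU (ell l p) 0 2) :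
    Φ.hol (ell l p) 0 2 = Φ.hol (fun x : ℝ => (pt x p.1.im, p.2)) p.1.re l *
      (Φ.hol (box l l p.1.im p.2) 0 1)⁻¹ := by
  obtain ⟨h1, h2⟩ := ell_clear hl h
  have hc : Clear l l p.1.im p.2 := fun M hM => ⟨h1 M hM, h1 M hM, fun e i => by
    have := h1 M hM (le_antisymm i.2 i.1); linarith⟩
  rw [← Φ.hol_trans zero_le_one (by norm_num) h]
  congr 1
  · rw [← Φ.hol_comp (φ := fun t => p.1.re + (l - p.1.re) * t) (f := fun x => (pt x p.1.im, p.2))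
      zero_le_one (by fun_prop) (fun t ht => ⟨by nlinarith [ht.1], by nlinarith [ht.2]⟩) hl
      ⟨by fun_prop, fun x hx hD => h2 _ hD rfl hx⟩ (by ring) (by ring)]
    refine Φ.hol_congr fun t ht => ?_
    rw [ell, clamp_of_mem ht.1 ht.2, clamp_of_nonpos (by linarith [ht.2]), mul_zero, add_zero]
  · rw [← Φ.hol_reverse (φ := fun t => 2 - t) (by norm_num : (1 : ℝ) ≤ 2) (by fun_prop)
      (fun t ht => ⟨by linarith [ht.2], by linarith [ht.1]⟩) zero_le_one
      ((curveIn_box le_rfl hc).mono le_rfl (by norm_num)) (by norm_num) (by norm_num)]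
    refine Φ.hol_congr fun t ht => ?_
    have k1 := ht.1
    have k2 := ht.2
    rw [ell, box, clamp_of_one_le k1, clamp_of_mem (by linarith) (by linarith),
      clamp_of_mem (by linarith : 0 ≤ 2 - t) (by linarith), clamp_of_nonpos (by linarith),
      clamp_of_nonpos (by linarith)]
    refine Prod.ext (Complex.ext ?_ ?_) rfl <;> simp only [pt_re, pt_im] <;> ring

/-- The values of `Φ` on U-shaped curves in the fibre over `θ`. -/
def boxValues (Φ : PathHom UU G) (θ : ℂ) : Set G :=
  {g | ∃ l l' h, l ≤ l' ∧ Clear l l' h θ ∧ bx Φ l l' h θ = g}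

theorem inv_mul_mem_of_ellValues {S : Subgroup G} {p : ℂ × ℂ} (hS : boxValues Φ p.2 ⊆ S) {v v' : G}
    (hv : v ∈ ellValues Φ p) (hv' : v' ∈ ellValues Φ p) : v⁻¹ * v' ∈ S := by
  obtain ⟨l, hl, h, rfl⟩ := hv
  obtain ⟨l', hl', h', rfl⟩ := hv'
  have key : ∀ l l', p.1.re ≤ l → l ≤ l' → CurveIn UU (ell l p) 0 2 → CurveIn UU (ell l' p) 0 2 →
      (Φ.hol (ell l p) 0 2)⁻¹ * Φ.hol (ell l' p) 0 2 ∈ S := by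
    intro l l' hl hll h h'
    obtain ⟨h1, -⟩ := ell_clear hl h
    obtain ⟨h1', h2'⟩ := ell_clear (hl.trans hll) h'
    have hc : Clear l l' p.1.im p.2 := fun M hM =>
      ⟨h1 M hM, h1' M hM, fun e i => h2' M hM e ⟨hl.trans i.1, i.2⟩⟩
    refine hS ⟨l, l', p.1.im, hll, hc, ?_⟩
    rw [hol_ell hl h, hol_ell (hl.trans hll) h', bx_eq hll hc,
      ← Φ.hol_trans hl hll (f := fun x : ℝ => (pt x p.1.im, p.2))
        ⟨by fun_prop, fun x hx hD => h2' _ hD rfl hx⟩]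
    group
  rcases le_total l l' with hll | hll
  · exact key _ _ hl hll h h'
  · simpa using S.inv_mem (key _ _ hl' hll h' h)

theorem isRoots_exp {θ u w : ℂ} (hu : u ^ 2 = 3 - 4 * Complex.exp θ)
    (hw : w ^ 2 = 3 + 4 * Complex.exp θ) :
    IsRoots θ ![-1 - Complex.exp θ * u, -1 + Complex.exp θ * u, 1 + Complex.exp θ * w,
      1 - Complex.exp θ * w] := by
  intro M
  generalize Complex.exp θ = T at *
  rw [show DD M T = (M - (-1 - T * u)) * (M - (-1 + T * u)) *
    ((M - (1 + T * w)) * (M - (1 - T * w))) by rw [DD, ← hu, ← hw]; ring]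
  simp [Fin.exists_fin_succ, sub_eq_zero, or_assoc, mul_eq_zero]

theorem exists_isRoots (θ : ℂ) : ∃ z, IsRoots θ z := by
  obtain ⟨u, hu⟩ := IsAlgClosed.exists_pow_nat_eq (3 - 4 * Complex.exp θ) two_pos
  obtain ⟨w, hw⟩ := IsAlgClosed.exists_pow_nat_eq (3 + 4 * Complex.exp θ) two_pos
  exact ⟨_, isRoots_exp hu hw⟩

theorem exists_curveIn_ell {p : ℂ × ℂ} (hp : p ∈ UU) :
    ∃ l, p.1.re < l ∧ CurveIn UU (ell l p) 0 2 := by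
  obtain ⟨z, hz⟩ := exists_isRoots p.2
  have h1 : ∀ i, ∀ᶠ l in 𝓝[>] p.1.re, ¬ (p.1.re < (z i).re ∧ (z i).re ≤ l) := by
    intro i
    by_cases h : p.1.re < (z i).re
    · filter_upwards [Ioo_mem_nhdsGT h] with l hl hh
      linarith [hl.2, hh.2]
    · exact Filter.Eventually.of_forall fun l hl => h hl.1
  obtain ⟨l, hl, hlp⟩ := ((Filter.eventually_all.2 h1).and self_mem_nhdsWithin).exists
  have hlp' : p.1.re < l := hlp
  refine ⟨l, hlp', ⟨((continuous_ell l).comp (by fun_prop :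
    Continuous fun t : ℝ => (p, t))).continuousOn, fun t ht hD => ?_⟩⟩
  have hD' : DD (ell l p t).1 (Complex.exp p.2) = 0 := hD
  obtain ⟨i, hi⟩ := (hz _).1 hD'
  have h2 := hl i
  rw [← hi] at h2
  have h3 := clamp_mem t
  rcases le_total t 1 with h | h
  · rw [ell, clamp_of_mem ht.1 h, clamp_of_nonpos (by linarith : t - 1 ≤ 0)] at h2 hD'
    simp only [pt_re] at h2
    rcases ht.1.eq_or_lt with rfl | h0
    · refine hp ?_
      simpa [pt] using hD'
    · exact h2 ⟨by nlinarith, by nlinarith⟩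
  · rw [ell, clamp_of_one_le h] at h2
    simp only [pt_re] at h2
    exact h2 ⟨by linarith, by linarith⟩

theorem one_mem_ellValues (hΦ : FarTrivial Φ) {p : ℂ × ℂ} (hp : p ∈ Far) : 1 ∈ ellValues Φ p := by
  have hf : CurveIn Far (ell p.1.re p) 0 2 := by
    refine ⟨((continuous_ell _).comp (by fun_prop :
      Continuous fun t : ℝ => (p, t))).continuousOn, fun t ht => ?_⟩
    have h1 := clamp_mem (t - 1)
    have h2 : topH p.2 - 1 < p.1.im := hp
    simp only [Far, ell, mem_ofPred_eq, pt_im]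
    rcases h1.2.eq_or_lt with e | e
    · rw [e]; linarith
    · nlinarith [mul_pos (sub_pos.2 h2) (sub_pos.2 e)]
  exact ⟨p.1.re, le_rfl, ⟨hf.1, fun t ht => far_subset (hf.2 t ht)⟩, hΦ _ _ _ zero_le_two hf⟩

theorem isOpen_UU : IsOpen UU := by
  have : Continuous fun p : ℂ × ℂ => DD p.1 (Complex.exp p.2) := by unfold DD; fun_prop
  exact isOpen_ne_fun this continuous_const

/-- A curve with end points in the far region takes its value in the group generated by the boxes
of the fibres it passes through. -/
theorem hol_mem_of_boxValues (hΦ : FarTrivial Φ) (S : Subgroup G) {f : ℝ → ℂ × ℂ} {a b : ℝ}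
    (hab : a ≤ b) (hf : CurveIn UU f a b) (ha : f a ∈ Far) (hb : f b ∈ Far)
    (hS : ∀ t ∈ Icc a b, boxValues Φ (f t).2 ⊆ S) : Φ.hol f a b ∈ S := by
  obtain ⟨k, hk⟩ := hf.exists_map hab
  have hk' : Continuous fun t => (k t : ℂ × ℂ) := continuous_subtype_val.comp k.continuous
  have key := Φ.hol_mem_of_potential S hab hf (fun t => ellValues Φ (f t))
    (fun t ht => ?_) ?_ 1 (one_mem_ellValues hΦ ha) 1
    (one_mem_ellValues hΦ hb)
  · simpa using key
  · obtain ⟨l, hl, h⟩ := exists_curveIn_ell (hf.2 t ht)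
    exact ⟨_, l, hl.le, h, rfl⟩
  intro t₀ ht₀
  obtain ⟨l, hl, hC⟩ := exists_curveIn_ell (hf.2 t₀ ht₀)
  have hcont : Continuous fun q : ℝ × ℝ => ell l (k q.1) q.2 :=
    (continuous_ell l).comp ((hk'.comp continuous_fst).prodMk continuous_snd)
  have h1 : ∀ᶠ s in 𝓝 t₀, ∀ τ ∈ Icc (0 : ℝ) 2, ell l (k s) τ ∈ UU :=
    isCompact_Icc.eventually_forall_of_forall_eventually fun τ hτ =>
      hcont.continuousAt.eventually_mem (isOpen_UU.mem_nhds (by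
        simpa only [hk t₀ ht₀] using hC.2 τ hτ))
  have h2 : ∀ᶠ s in 𝓝 t₀, (k s : ℂ × ℂ).1.re < l :=
    (Complex.continuous_re.comp (continuous_fst.comp hk')).continuousAt.eventually_lt
      continuousAt_const (by simpa only [Function.comp, hk t₀ ht₀] using hl)
  obtain ⟨ε, hε, hball⟩ := Metric.eventually_nhds_iff_ball.1 (h1.and h2)
  have hcu : ∀ s ∈ Icc a b, s ∈ Metric.ball t₀ ε →
      Φ.hol (ell l (f s)) 0 2 ∈ ellValues Φ (f s) := by
    intro s hs hsε
    rw [← hk s hs]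
    exact ⟨l, (hball s hsε).2.le, ⟨(hcont.comp (by fun_prop : Continuous fun τ : ℝ =>
      (s, τ))).continuousOn, (hball s hsε).1⟩, rfl⟩
  refine ⟨_, Metric.ball_mem_nhds t₀ hε, fun s hs s' hs' hss v hv v' hv' => ?_⟩
  have hsub : Icc s s' ⊆ Metric.ball t₀ ε :=
    (convex_ball t₀ ε).ordConnected.out hs.2 hs'.2
  have hsub' : Icc s s' ⊆ Icc a b := Icc_subset_Icc hs.1.1 hs'.1.2
  have hsq := Φ.hol_square (H := fun q => ell l (k q.1) q.2) hss (zero_le_two (α := ℝ))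
    hcont.continuousOn fun q hq => (hball _ (hsub hq.1)).1 _ hq.2
  simp only [ell_zero, ell_two, hk s hs.1, hk s' hs'.1] at hsq
  rw [hΦ (fun x => (pt l (topH (k x : ℂ × ℂ).2), (k x : ℂ × ℂ).2)) s s' hss
    ⟨(by have := continuous_topH; fun_prop), fun x _ => by simp [Far]⟩, mul_one,
    Φ.hol_congr (fun x hx => hk x (hsub' hx))] at hsq
  have e : v⁻¹ * Φ.hol f s s' * v' = v⁻¹ * Φ.hol (ell l (f s)) 0 2 *
      ((Φ.hol (ell l (f s')) 0 2)⁻¹ * v') := by rw [← hsq]; group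
  rw [e]
  exact S.mul_mem (inv_mul_mem_of_ellValues (hS s hs.1) hv (hcu s hs.1 hs.2))
    (inv_mul_mem_of_ellValues (hS s' hs'.1) (hcu s' hs'.1 hs'.2) hv')

end

section

variable {G : Type*} [Group G] {Φ : PathHom UU G}

theorem bx_eq_one (hΦ : FarTrivial Φ) {l l' h : ℝ} {θ : ℂ} (hl : l ≤ l')
    (hc : ∀ M, DD M (Complex.exp θ) = 0 → l ≤ M.re → M.re ≤ l' → M.im < h) :
    bx Φ l l' h θ = 1 := by
  have hs := bx_slide hΦ (l := fun _ => l) (l' := fun _ => l')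
    (h := fun s => h + s * (max h (topH θ) - h)) (θ := fun _ => θ) (by fun_prop) (by fun_prop)
    (by fun_prop) (by fun_prop) (fun _ _ => hl) fun s hs M hM => by
      have h1 : 0 ≤ s * (max h (topH θ) - h) :=
        mul_nonneg hs.1 (sub_nonneg.2 (le_max_left _ _))
      exact ⟨fun e => by linarith [hc M hM e.ge (e.trans_le hl)],
        fun e => by linarith [hc M hM (hl.trans e.ge) e.le],
        fun e i => by linarith [hc M hM i.1 i.2]⟩
  simp only [zero_mul, add_zero, one_mul, add_sub_cancel] at hs
  rw [hs]
  refine hΦ _ _ _ (by norm_num) ⟨by unfold box; fun_prop, fun t _ => ?_⟩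
  have h1 := le_max_right h (topH θ)
  have h2 : 0 ≤ 1 - clamp t + clamp (t - 2) := by linarith [(clamp_mem t).2, (clamp_mem (t - 2)).1]
  have h3 : 1 - clamp t + clamp (t - 2) ≤ 1 := by
    rcases le_total t 2 with h | h
    · rw [clamp_of_nonpos (by linarith : t - 2 ≤ 0)]; linarith [(clamp_mem t).1]
    · rw [clamp_of_one_le (by linarith : 1 ≤ t)]; linarith [(clamp_mem (t - 2)).2]
  simp only [Far, box, mem_ofPred_eq, pt_im]
  nlinarith

theorem boxValues_subset (hΦ : FarTrivial Φ) {S : Subgroup G} {θ : ℂ} {z : Fin 4 → ℂ}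
    (hr : IsRoots θ z) (hz : ∀ i j, i ≠ j → (z i).re ≠ (z j).re)
    (hg : ∀ i, ∃ g ∈ S, Mer Φ θ (z i) g) : boxValues Φ θ ⊆ S := by
  rintro _ ⟨l, l', h, hl, hc, rfl⟩
  obtain ⟨n, hn⟩ : ∃ n, ((Finset.univ : Finset (Fin 4)).filter
    fun i => l ≤ (z i).re ∧ (z i).re ≤ l').card = n := ⟨_, rfl⟩
  induction n using Nat.strong_induction_on generalizing l l' with
  | _ n ih =>
  subst hn
  by_cases h2 : ∃ i j, l ≤ (z i).re ∧ (z i).re < (z j).re ∧ (z j).re ≤ l'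
  · obtain ⟨i, j, hi, hij, hj⟩ := h2
    obtain ⟨m, hm, hmr⟩ := ((Ioo_infinite hij).sdiff (finite_range fun k => (z k).re)).nonempty
    have hmc : Clear m m h θ := fun M hM => by
      obtain ⟨k, rfl⟩ := (hr M).1 hM
      have : (z k).re ≠ m := fun e => hmr ⟨k, e⟩
      exact ⟨fun e => absurd e this, fun e => absurd e this,
        fun _ e => this (le_antisymm e.2 e.1)⟩
    have hc1 : Clear l m h θ := hc.mono hc.left hmc le_rfl (by linarith [hm.2])
    have hc2 : Clear m l' h θ := hc.mono hmc hc.right (by linarith [hm.1]) le_rfl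
    rw [← bx_mul (by linarith [hm.1]) (by linarith [hm.2]) hc1 hc2]
    refine S.mul_mem (ih _ ?_ _ _ (by linarith [hm.1]) hc1 rfl)
      (ih _ ?_ _ _ (by linarith [hm.2]) hc2 rfl)
    · refine Finset.card_lt_card (Finset.ssubset_iff_subset_ne.2
        ⟨fun k => ?_, fun e => ?_⟩)
      · simp only [Finset.mem_filter, Finset.mem_univ, true_and]
        exact fun hk => ⟨hk.1, by linarith [hm.2]⟩
      · have := (Finset.ext_iff.1 e j).2 (by simp [hj]; linarith)
        simp only [Finset.mem_filter, Finset.mem_univ, true_and] at this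
        linarith [hm.2]
    · refine Finset.card_lt_card (Finset.ssubset_iff_subset_ne.2
        ⟨fun k => ?_, fun e => ?_⟩)
      · simp only [Finset.mem_filter, Finset.mem_univ, true_and]
        exact fun hk => ⟨by linarith [hm.1], hk.2⟩
      · have := (Finset.ext_iff.1 e i).2 (by simp [hi]; linarith)
        simp only [Finset.mem_filter, Finset.mem_univ, true_and] at this
        linarith [hm.1]
  by_cases h1 : ∃ i, l ≤ (z i).re ∧ (z i).re ≤ l' ∧ h ≤ (z i).im
  · obtain ⟨i, hi, hi', hih⟩ := h1
    obtain ⟨g, hgS, hg⟩ := hg i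
    obtain ⟨c1, c2, c3⟩ := hc (z i) ((hr _).2 ⟨i, rfl⟩)
    rw [hg.bx_eq_of_unique hΦ (hi.lt_of_ne fun e => by linarith [c1 e.symm])
      (hi'.lt_of_ne fun e => by linarith [c2 e])
      (hih.lt_of_ne fun e => c3 e.symm ⟨hi, hi'⟩)]
    · exact hgS
    intro M hM hne hM1 hM2
    obtain ⟨k, rfl⟩ := (hr M).1 hM
    have hki : k ≠ i := fun e => hne (by rw [e])
    rcases (hz k i hki).lt_or_gt with e | e
    · exact absurd ⟨k, i, hM1, e, hi'⟩ h2
    · exact absurd ⟨i, k, hi, e, hM2⟩ h2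
  · rw [bx_eq_one hΦ hl]
    · exact S.one_mem
    intro M hM hM1 hM2
    obtain ⟨k, rfl⟩ := (hr M).1 hM
    by_contra! e
    exact h1 ⟨k, hM1, hM2, e⟩

theorem Quad.boxValues_subset (hΦ : FarTrivial Φ) {θ z₀ z₁ z₂ z₃ : ℂ} {g₀ g₁ g₂ g₃ : G}
    (h : Quad Φ θ z₀ z₁ z₂ z₃ g₀ g₁ g₂ g₃) {S : Subgroup G} (h0 : g₀ ∈ S) (h1 : g₁ ∈ S)
    (h2 : g₂ ∈ S) (h3 : g₃ ∈ S) : boxValues Φ θ ⊆ S := by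
  refine _root_.boxValues_subset hΦ h.roots (fun i j hij => ?_) fun i => ?_
  · have := h.h01
    have := h.h12
    have := h.h23
    fin_cases i <;> fin_cases j <;> first | exact absurd rfl hij | (simp; linarith)
  · fin_cases i
    exacts [⟨_, h0, h.m0⟩, ⟨_, h1, h.m1⟩, ⟨_, h2, h.m2⟩, ⟨_, h3, h.m3⟩]

end

theorem exists_sq_eq_near (u c : ℂ) : ∃ v : ℂ, v ^ 2 = c ∧ ‖v - u‖ ^ 2 ≤ ‖c - u ^ 2‖ := by
  obtain ⟨v, hv⟩ := IsAlgClosed.exists_pow_nat_eq c two_pos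
  have e : ‖c - u ^ 2‖ = ‖v - u‖ * ‖v + u‖ := by rw [← norm_mul, ← hv]; ring_nf
  rcases le_total ‖v - u‖ ‖v + u‖ with h | h
  · exact ⟨v, hv, by rw [e]; nlinarith [norm_nonneg (v - u)]⟩
  · refine ⟨-v, by rw [neg_sq, hv], ?_⟩
    rw [e, show -v - u = -(v + u) by ring, norm_neg]
    nlinarith [norm_nonneg (v + u)]

theorem exists_sqrt_continuousAt {f : ℂ → ℂ} {x₀ : ℂ} (hf : ContinuousAt f x₀) :
    ∃ u : ℂ → ℂ, (∀ x, u x ^ 2 = f x) ∧ ContinuousAt u x₀ := by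
  obtain ⟨u₀, hu₀⟩ := IsAlgClosed.exists_pow_nat_eq (f x₀) two_pos
  choose u hu hu' using fun x => exists_sq_eq_near u₀ (f x)
  have h0 : u x₀ = u₀ := by
    have := hu' x₀
    rw [hu₀, sub_self, norm_zero] at this
    have h := pow_eq_zero_iff two_ne_zero |>.1 (le_antisymm this (sq_nonneg _))
    exact sub_eq_zero.1 (norm_eq_zero.1 h)
  refine ⟨u, hu, ?_⟩
  rw [ContinuousAt, h0, tendsto_iff_norm_sub_tendsto_zero]
  have h1 : Filter.Tendsto (fun x => √‖f x - u₀ ^ 2‖) (𝓝 x₀) (𝓝 0) := by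
    have : ContinuousAt (fun x => √‖f x - u₀ ^ 2‖) x₀ := by fun_prop
    rw [ContinuousAt, hu₀, sub_self, norm_zero, Real.sqrt_zero] at this
    rwa [hu₀]
  exact squeeze_zero (fun _ => norm_nonneg _) (fun x => Real.le_sqrt_of_sq_le (hu' x)) h1

/-- The values of `T` where two roots of the fibre come together. -/
def discr (T : ℂ) : ℂ := (3 - 4 * T) * (3 + 4 * T) * (4 * T ^ 6 - 3 * T ^ 2 + 1)

theorem roots_ne {T e₁ e₂ : ℂ} (h₁ : e₁ ^ 2 = 3 - 4 * T) (h₂ : e₂ ^ 2 = 3 + 4 * T)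
    (h : 4 * T ^ 6 - 3 * T ^ 2 + 1 ≠ 0) : -1 + T * e₁ ≠ 1 + T * e₂ := by
  intro e
  have h3 : T ^ 2 * (e₁ * e₂) = 3 * T ^ 2 - 2 := by
    linear_combination (-(T * e₁ - T * e₂ + 2) / 2) * e + T ^ 2 / 2 * h₁ + T ^ 2 / 2 * h₂
  apply h
  have h4 : (T ^ 2 * (e₁ * e₂)) ^ 2 = T ^ 4 * ((3 - 4 * T) * (3 + 4 * T)) := by
    rw [← h₁, ← h₂]; ring
  rw [h3] at h4
  linear_combination h4 / 4

theorem injective_roots {T e₁ e₂ : ℂ} (hT : T ≠ 0) (h1 : e₁ ^ 2 = 3 - 4 * T)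
    (h2 : e₂ ^ 2 = 3 + 4 * T) (hd : discr T ≠ 0) :
    Function.Injective ![-1 - T * e₁, -1 + T * e₁, 1 + T * e₂, 1 - T * e₂] := by
  simp only [discr, mul_ne_zero_iff] at hd
  obtain ⟨⟨ha, hb⟩, hc⟩ := hd
  have k1 : T * e₁ ≠ 0 := mul_ne_zero hT fun e => ha (by rw [← h1, e]; ring)
  have k2 : T * e₂ ≠ 0 := mul_ne_zero hT fun e => hb (by rw [← h2, e]; ring)
  have r1 := roots_ne h1 h2 hc
  have r2 := roots_ne (e₁ := -e₁) (by rw [neg_sq, h1]) h2 hc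
  have r3 := roots_ne (e₂ := -e₂) h1 (by rw [neg_sq, h2]) hc
  have r4 := roots_ne (e₁ := -e₁) (e₂ := -e₂) (by rw [neg_sq, h1]) (by rw [neg_sq, h2]) hc
  simp only [mul_neg, ← sub_eq_add_neg] at r2 r3 r4
  have n1 : ∀ x y : ℂ, x ≠ 0 → y - x ≠ y + x := fun x y hx e => hx (by
    linear_combination -e / 2)
  have c1 := n1 _ (-1) k1
  have c2 := n1 _ 1 k2
  intro i j hij
  fin_cases i <;> fin_cases j <;> first
    | rfl
    | exact absurd hij (by assumption)
    | exact absurd hij.symm (by assumption)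

theorem exists_isRoots_continuousAt (θ₀ : ℂ) : ∃ z : ℂ → Fin 4 → ℂ, (∀ θ, IsRoots θ (z θ)) ∧
    (∀ i, ContinuousAt (fun θ => z θ i) θ₀) ∧
    (discr (Complex.exp θ₀) ≠ 0 → Function.Injective (z θ₀)) := by
  obtain ⟨u, hu, hu'⟩ := exists_sqrt_continuousAt (f := fun θ => 3 - 4 * Complex.exp θ) (x₀ := θ₀)
    (by fun_prop)
  obtain ⟨w, hw, hw'⟩ := exists_sqrt_continuousAt (f := fun θ => 3 + 4 * Complex.exp θ) (x₀ := θ₀)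
    (by fun_prop)
  refine ⟨fun θ => ![-1 - Complex.exp θ * u θ, -1 + Complex.exp θ * u θ, 1 + Complex.exp θ * w θ,
    1 - Complex.exp θ * w θ], fun θ => isRoots_exp (hu θ) (hw θ), fun i => ?_, fun hd => ?_⟩
  · fin_cases i <;> simp <;> fun_prop
  exact injective_roots (Complex.exp_ne_zero θ₀) (hu θ₀) (hw θ₀) hd

theorem countable_exp_preimage (s : Finset ℂ) : (Complex.exp ⁻¹' (s : Set ℂ)).Countable := by
  have h : ∀ c : ℂ, (Complex.exp ⁻¹' {c}).Countable := by
    intro c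
    by_cases hc : c = 0
    · convert countable_empty
      ext x; simp [hc, Complex.exp_ne_zero]
    refine (countable_range fun n : ℤ => Complex.log c + n * (2 * Real.pi * Complex.I)).mono ?_
    intro x hx
    have hx' : Complex.exp x = Complex.exp (Complex.log c) := by rw [Complex.exp_log hc]; exact hx
    obtain ⟨n, hn⟩ := Complex.exp_eq_exp_iff_exists_int.1 hx'
    exact ⟨n, hn.symm⟩
  rw [← biUnion_of_singleton (s : Set ℂ), preimage_iUnion₂]
  exact s.countable_toSet.biUnion fun c _ => h c

theorem countable_discr : {θ : ℂ | discr (Complex.exp θ) = 0}.Countable := by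
  let P : Polynomial ℂ := (3 - 4 * .X) * (3 + 4 * .X) * (4 * .X ^ 6 - 3 * .X ^ 2 + 1)
  have hP : P ≠ 0 := fun h => by
    have := congrArg (Polynomial.eval 0) h
    simp [P] at this
  refine (countable_exp_preimage P.roots.toFinset).mono fun θ hθ => ?_
  simp only [mem_preimage, Finset.mem_coe, Multiset.mem_toFinset, Polynomial.mem_roots hP]
  simpa [P, discr, Polynomial.IsRoot] using hθ

section

/-- The displacement pushing `M` radially out of the discs of radius `2 * δ` about the `z i`. -/
def push (z : Fin 4 → ℂ) (δ : ℝ) (M : ℂ) : ℂ :=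
  ∑ i, ((max 0 (2 * δ / ‖M - z i‖ - 1) : ℝ) : ℂ) * (M - z i)

theorem push_continuousOn (z : Fin 4 → ℂ) (δ : ℝ) : ContinuousOn (push z δ) {M | ∀ i, M ≠ z i} := by
  refine continuousOn_finsetSum _ fun i _ => ?_
  refine (Complex.continuous_ofReal.comp_continuousOn (continuousOn_const.sup
    ((continuousOn_const.div (by fun_prop) fun M hM => ?_).sub continuousOn_const))).mul
    (by fun_prop)
  exact norm_ne_zero_iff.2 (sub_ne_zero.2 (hM i))

theorem push_term_eq_zero {δ r : ℝ} (hδ : 0 < δ) (h : 2 * δ ≤ r) : max 0 (2 * δ / r - 1) = 0 :=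
  max_eq_left (by rw [sub_nonpos, div_le_one (by linarith)]; exact h)

theorem push_eq_zero {z : Fin 4 → ℂ} {δ : ℝ} {M : ℂ} (hδ : 0 < δ)
    (h : ∀ i, 2 * δ ≤ ‖M - z i‖) : push z δ M = 0 :=
  Finset.sum_eq_zero fun i _ => by rw [push_term_eq_zero hδ (h i)]; simp

theorem push_spec {z : Fin 4 → ℂ} {δ : ℝ} {M : ℂ} (hδ : 0 < δ)
    (hz : ∀ i j, i ≠ j → 4 * δ ≤ ‖z i - z j‖) (hM : ∀ i, M ≠ z i) (j : Fin 4) :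
    (∀ s ∈ Icc (0 : ℝ) 1, M + s * push z δ M ≠ z j) ∧ 2 * δ ≤ ‖M + push z δ M - z j‖ := by
  by_cases h : ∀ i, 2 * δ ≤ ‖M - z i‖
  · rw [push_eq_zero hδ h]
    simpa using ⟨fun _ _ _ => hM j, h j⟩
  push Not at h
  obtain ⟨i, hi⟩ := h
  have hpos : 0 < ‖M - z i‖ := norm_pos_iff.2 (sub_ne_zero.2 (hM i))
  have hp : push z δ M = ((2 * δ / ‖M - z i‖ - 1 : ℝ) : ℂ) * (M - z i) := by
    rw [push, Finset.sum_eq_single i]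
    · rw [max_eq_right]
      rw [sub_nonneg, le_div_iff₀ hpos]; linarith
    · intro k _ hk
      rw [push_term_eq_zero hδ]
      · simp
      have h1 := hz k i hk
      have h2 := norm_sub_le (M - z i) (M - z k)
      rw [show M - z i - (M - z k) = z k - z i by ring] at h2
      linarith
    · simp
  have hn : ∀ s ∈ Icc (0 : ℝ) 1, ‖M + s * push z δ M - z i‖ =
      (1 - s) * ‖M - z i‖ + s * (2 * δ) := by
    intro s hs
    have e : M + s * push z δ M - z i = ((1 + s * (2 * δ / ‖M - z i‖ - 1) : ℝ) : ℂ) * (M - z i) := by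
      rw [hp]; push_cast; ring
    have h1 : 1 ≤ 2 * δ / ‖M - z i‖ := by rw [le_div_iff₀ hpos]; linarith
    rw [e, norm_mul, Complex.norm_real, Real.norm_of_nonneg]
    · field_simp; ring
    · nlinarith [hs.1]
  by_cases hji : j = i
  · subst hji
    refine ⟨fun s hs e => ?_, ?_⟩
    · have := hn s hs
      rw [e, sub_self, norm_zero] at this
      rcases hs.2.eq_or_lt with rfl | h1
      · linarith
      · nlinarith [mul_pos (sub_pos.2 h1) hpos, hs.1]
    · have := hn 1 (by simp)
      rw [Complex.ofReal_one, one_mul] at this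
      linarith
  · have h1 := hz j i hji
    refine ⟨fun s hs e => ?_, ?_⟩
    · have := hn s hs
      rw [e] at this
      nlinarith [hs.1, hs.2]
    · have := hn 1 (by simp)
      rw [Complex.ofReal_one, one_mul] at this
      have h2 := norm_sub_le (M + push z δ M - z i) (M + push z δ M - z j)
      rw [show M + push z δ M - z i - (M + push z δ M - z j) = z j - z i by ring] at h2
      linarith

variable {G : Type*} [Group G] {Φ : PathHom UU G}

theorem boxValues_subset_of_near (hΦ : FarTrivial Φ) {S : Subgroup G} {θ θ₀ : ℂ}
    (hS : boxValues Φ θ₀ ⊆ S) {z : Fin 4 → ℂ} {δ : ℝ} (hδ : 0 < δ) (hδ' : δ ≤ 1 / 4)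
    (hr : IsRoots θ z) (hz : ∀ i j, i ≠ j → 4 * δ ≤ ‖z i - z j‖)
    (hnear : ∀ s ∈ Icc (0 : ℝ) 1, topH (θ + s * (θ₀ - θ)) - 1 < topH θ ∧
      ∀ M, DD M (Complex.exp (θ + s * (θ₀ - θ))) = 0 → ∃ i, ‖M - z i‖ < 2 * δ) :
    boxValues Φ θ ⊆ S := by
  rintro _ ⟨l, l', h, hl, hc, rfl⟩
  have hbox := curveIn_box hl hc
  have hne : ∀ t ∈ Icc (0 : ℝ) 3, ∀ i, (box l l' h θ t).1 ≠ z i := fun t ht i e =>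
    hbox.2 t ht ((hr _).2 ⟨i, e⟩)
  have hm : ContinuousOn (fun t => (box l l' h θ t).1) (Icc 0 3) := by unfold box; fun_prop
  have hp : ContinuousOn (fun t => push z δ (box l l' h θ t).1) (Icc 0 3) :=
    (push_continuousOn z δ).comp hm hne
  have hsnd : ∀ {k : ℝ → ℂ}, ContinuousOn k (Icc 0 3) →
      ContinuousOn (fun p : ℝ × ℝ => k p.2) (Icc 0 1 ×ˢ Icc 0 3) := fun hk =>
    hk.comp continuous_snd.continuousOn fun p hp => hp.2
  have hm2 := hsnd hm
  have hp2 := hsnd hp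
  have hfar : ∀ x : ℝ, push z δ (pt x (topH θ)) = 0 := fun x => push_eq_zero hδ fun i => by
    have h1 := norm_root_le ((hr _).2 ⟨i, rfl⟩)
    have h2 := Complex.abs_im_le_norm (pt x (topH θ) - z i)
    have h3 := Complex.abs_im_le_norm (z i)
    rw [Complex.sub_im, pt_im] at h2
    linarith [le_abs_self (topH θ - (z i).im), le_abs_self (z i).im]
  have e1 := Φ.hol_slide (U := UU) (H := fun p : ℝ × ℝ => ((box l l' h θ p.2).1 +
    p.1 * push z δ (box l l' h θ p.2).1, θ)) (zero_le_one (α := ℝ)) (by norm_num : (0:ℝ) ≤ 3)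
    (by fun_prop) (fun p hp hD => by
      obtain ⟨i, hi⟩ := (hr _).1 hD
      exact (push_spec hδ hz (hne _ hp.2) i).1 _ hp.1 hi) ?_ ?_
  · have e2 := Φ.hol_slide (U := UU) (H := fun p : ℝ × ℝ => ((box l l' h θ p.2).1 +
      push z δ (box l l' h θ p.2).1, θ + p.1 * (θ₀ - θ))) (zero_le_one (α := ℝ))
      (by norm_num : (0:ℝ) ≤ 3) (by fun_prop) (fun p hp hD => by
        obtain ⟨i, hi⟩ := (hnear p.1 hp.1).2 _ hD
        exact hi.not_ge (push_spec hδ hz (hne _ hp.2) i).2) ?_ ?_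
    · simp only [Complex.ofReal_zero, zero_mul, add_zero, Complex.ofReal_one, one_mul,
        add_sub_cancel] at e1 e2
      rw [bx, show box l l' h θ = fun t => ((box l l' h θ t).1, θ) from rfl, e1, e2]
      refine hol_mem_of_boxValues hΦ S (by norm_num) ⟨by fun_prop, fun t ht hD => ?_⟩ ?_ ?_
        fun t _ => hS
      · obtain ⟨i, hi⟩ := (hnear 1 (by simp)).2 _
          (by simpa only [Complex.ofReal_one, one_mul, add_sub_cancel] using hD)
        exact hi.not_ge (push_spec hδ hz (hne _ ht) i).2
      · have := (hnear 1 (by simp)).1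
        simp only [Complex.ofReal_one, one_mul, add_sub_cancel] at this
        simpa [box_zero, hfar, Far] using this
      · have := (hnear 1 (by simp)).1
        simp only [Complex.ofReal_one, one_mul, add_sub_cancel] at this
        simpa [box_three, hfar, Far] using this
    · simp only [box_zero, hfar]
      exact hΦ _ _ _ zero_le_one ⟨by fun_prop, fun s hs => by
        simpa [Far] using (hnear s hs).1⟩
    · simp only [box_three, hfar]
      exact hΦ _ _ _ zero_le_one ⟨by fun_prop, fun s hs => by
        simpa [Far] using (hnear s hs).1⟩
  · simp only [box_zero, hfar, mul_zero, add_zero]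
    exact hΦ _ _ _ zero_le_one ⟨by fun_prop, fun s hs => by simp [Far]⟩
  · simp only [box_three, hfar, mul_zero, add_zero]
    exact hΦ _ _ _ zero_le_one ⟨by fun_prop, fun s hs => by simp [Far]⟩

end

section

variable {G : Type*} [Group G] {Φ : PathHom UU G}

theorem eventually_boxValues_subset (hΦ : FarTrivial Φ) {S : Subgroup G} {θ₀ : ℂ}
    (hd : discr (Complex.exp θ₀) ≠ 0) (hS : boxValues Φ θ₀ ⊆ S) :
    ∀ᶠ θ in 𝓝 θ₀, boxValues Φ θ ⊆ S := by
  obtain ⟨z, hz, hcont, hinj⟩ := exists_isRoots_continuousAt θ₀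
  replace hinj := hinj hd
  obtain ⟨δ, hδ, hδ', hsep⟩ : ∃ δ > 0, δ ≤ 1 / 4 ∧
      ∀ i j, i ≠ j → 6 * δ ≤ ‖z θ₀ i - z θ₀ j‖ := by
    have h1 : ∀ i j, ∀ᶠ δ in 𝓝[>] (0 : ℝ), i ≠ j → 6 * δ ≤ ‖z θ₀ i - z θ₀ j‖ := by
      intro i j
      by_cases hij : i = j
      · simp [hij]
      have : 0 < ‖z θ₀ i - z θ₀ j‖ := norm_pos_iff.2 (sub_ne_zero.2 fun e => hij (hinj e))
      filter_upwards [Ioo_mem_nhdsGT (by positivity : 0 < ‖z θ₀ i - z θ₀ j‖ / 6)] with δ h _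
      linarith [h.2]
    obtain ⟨δ, h1, h2⟩ := ((Filter.eventually_all.2 fun i => Filter.eventually_all.2 (h1 i)).and
      (Ioo_mem_nhdsGT (by norm_num : (0 : ℝ) < 1 / 4))).exists
    exact ⟨δ, h2.1, h2.2.le, h1⟩
  have h1 : ∀ᶠ θ in 𝓝 θ₀, (∀ i, ‖z θ i - z θ₀ i‖ < δ) ∧ |topH θ - topH θ₀| < 1 / 4 := by
    refine (Filter.eventually_all.2 fun i => ?_).and ?_
    · have := (hcont i).eventually_mem (Metric.ball_mem_nhds _ hδ)
      simpa only [mem_ball_iff_norm] using this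
    · have := continuous_topH.continuousAt.eventually_mem
        (Metric.ball_mem_nhds (topH θ₀) (by norm_num : (0 : ℝ) < 1 / 4))
      simpa only [Metric.mem_ball, Real.dist_eq] using this
  obtain ⟨ε, hε, hball⟩ := Metric.eventually_nhds_iff_ball.1 h1
  filter_upwards [Metric.ball_mem_nhds θ₀ hε] with θ hθ
  obtain ⟨hzθ, htθ⟩ := hball θ hθ
  refine boxValues_subset_of_near hΦ hS hδ hδ' (hz θ) (fun i j hij => ?_) fun s hs => ?_
  · have h2 := norm_sub_le (z θ₀ i - z θ i) (z θ₀ j - z θ j)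
    have h3 := norm_sub_le (z θ₀ i - z θ i - (z θ₀ j - z θ j)) (z θ j - z θ i)
    rw [show z θ₀ i - z θ i - (z θ₀ j - z θ j) - (z θ j - z θ i) = z θ₀ i - z θ₀ j by ring,
      norm_sub_rev (z θ j)] at h3
    have h4 := hzθ i
    have h5 := hzθ j
    rw [norm_sub_rev] at h4 h5
    linarith [hsep i j hij]
  · have hs' : θ + s * (θ₀ - θ) ∈ Metric.ball θ₀ ε := by
      have := (convex_ball θ₀ ε).add_smul_sub_mem hθ (Metric.mem_ball_self hε) hs
      simpa using this
    obtain ⟨hz', ht'⟩ := hball _ hs'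
    rw [abs_lt] at htθ ht'
    refine ⟨by linarith, fun M hM => ?_⟩
    obtain ⟨i, rfl⟩ := (hz _ M).1 hM
    refine ⟨i, ?_⟩
    have h2 := norm_sub_le (z (θ + s * (θ₀ - θ)) i - z θ₀ i) (z θ i - z θ₀ i)
    rw [sub_sub_sub_cancel_right] at h2
    linarith [hz' i, hzθ i]

theorem eventually_clear {l l' h : ℝ} {θ₀ : ℂ} (hc : Clear l l' h θ₀) :
    ∀ᶠ θ in 𝓝 θ₀, Clear l l' h θ := by
  have hre := Complex.continuous_re
  have him := Complex.continuous_im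
  have hK : IsCompact (Metric.closedBall (0 : ℂ) (topH θ₀) ∩
      ({M | M.re = l ∧ h ≤ M.im} ∪ {M | M.re = l' ∧ h ≤ M.im} ∪
        {M | M.im = h ∧ l ≤ M.re ∧ M.re ≤ l'})) := by
    refine (isCompact_closedBall _ _).inter_right ((IsClosed.union ?_ ?_).union ?_)
    · exact (isClosed_eq hre continuous_const).inter (isClosed_le continuous_const him)
    · exact (isClosed_eq hre continuous_const).inter (isClosed_le continuous_const him)
    · exact (isClosed_eq him continuous_const).inter
        ((isClosed_le continuous_const hre).inter (isClosed_le hre continuous_const))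
  have h1 : ∀ᶠ θ in 𝓝 θ₀, ∀ M ∈ Metric.closedBall (0 : ℂ) (topH θ₀) ∩
      ({M | M.re = l ∧ h ≤ M.im} ∪ {M | M.re = l' ∧ h ≤ M.im} ∪
        {M | M.im = h ∧ l ≤ M.re ∧ M.re ≤ l'}), DD M (Complex.exp θ) ≠ 0 := by
    refine hK.eventually_forall_of_forall_eventually fun M hM => ?_
    have hcont : Continuous fun p : ℂ × ℂ => DD p.2 (Complex.exp p.1) := by unfold DD; fun_prop
    refine hcont.continuousAt.eventually_ne fun hD => ?_
    obtain ⟨c1, c2, c3⟩ := hc M hD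
    rcases hM.2 with (h | h) | h
    · exact (c1 h.1).not_ge h.2
    · exact (c2 h.1).not_ge h.2
    · exact c3 h.1 h.2
  have h2 : ∀ᶠ θ in 𝓝 θ₀, topH θ < topH θ₀ + 1 :=
    continuous_topH.continuousAt.eventually_lt continuousAt_const (by linarith)
  filter_upwards [h1, h2] with θ h1 h2 M hM
  have hb : M ∈ Metric.closedBall (0 : ℂ) (topH θ₀) := by
    rw [mem_closedBall_zero_iff]
    linarith [norm_root_le hM]
  refine ⟨fun e => ?_, fun e => ?_, fun e i => h1 M ⟨hb, Or.inr ⟨e, i⟩⟩ hM⟩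
  · by_contra! h
    exact h1 M ⟨hb, Or.inl (Or.inl ⟨e, h⟩)⟩ hM
  · by_contra! h
    exact h1 M ⟨hb, Or.inl (Or.inr ⟨e, h⟩)⟩ hM

theorem isClosed_boxValues_subset (hΦ : FarTrivial Φ) (S : Subgroup G) :
    IsClosed {θ | boxValues Φ θ ⊆ S} := by
  refine isClosed_of_closure_subset fun θ₀ hθ₀ => ?_
  rintro _ ⟨l, l', h, hl, hc, rfl⟩
  obtain ⟨ε, hε, hball⟩ := Metric.eventually_nhds_iff_ball.1 (eventually_clear hc)
  obtain ⟨θ, hθ, hd⟩ := Metric.mem_closure_iff.1 hθ₀ ε hε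
  have hs := bx_slide hΦ (l := fun _ => l) (l' := fun _ => l') (h := fun _ => h)
    (θ := fun s => θ₀ + s * (θ - θ₀)) (by fun_prop) (by fun_prop) (by fun_prop) (by fun_prop)
    (fun _ _ => hl) fun s hs => hball _ (by
      have := (convex_ball θ₀ ε).add_smul_sub_mem (Metric.mem_ball_self hε)
        (by rwa [Metric.mem_ball, dist_comm]) hs
      simpa using this)
  simp only [Complex.ofReal_zero, zero_mul, add_zero, Complex.ofReal_one, one_mul,
    add_sub_cancel] at hs
  rw [hs]
  exact hθ ⟨l, l', h, hl, hball _ (by rwa [Metric.mem_ball, dist_comm]), rfl⟩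

theorem boxValues_subset_of_forall (hΦ : FarTrivial Φ) {S : Subgroup G} {θ₀ : ℂ}
    (hd : discr (Complex.exp θ₀) ≠ 0) (hS : boxValues Φ θ₀ ⊆ S) (θ : ℂ) : boxValues Φ θ ⊆ S := by
  have hconn : IsPreconnected {θ : ℂ | discr (Complex.exp θ) = 0}ᶜ :=
    (countable_discr.isPathConnected_compl_of_one_lt_rank
      (by rw [Complex.rank_real_complex]; norm_num)).isConnected.isPreconnected
  have hdense : Dense {θ : ℂ | discr (Complex.exp θ) = 0}ᶜ := countable_discr.dense_compl ℝ
  have hcl := isClosed_boxValues_subset hΦ S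
  have hsub : {θ : ℂ | discr (Complex.exp θ) = 0}ᶜ ⊆ interior {θ | boxValues Φ θ ⊆ S} := by
    refine hconn.subset_left_of_subset_union isOpen_interior hcl.isOpen_compl
      (disjoint_left.2 fun x hx hx' => hx' (interior_subset hx)) (fun x hx => ?_)
      ⟨θ₀, hd, mem_interior_iff_mem_nhds.2 (eventually_boxValues_subset hΦ hd hS)⟩
    by_cases h : boxValues Φ x ⊆ S
    · exact Or.inl (mem_interior_iff_mem_nhds.2 (eventually_boxValues_subset hΦ hx h))
    · exact Or.inr h
  have := hcl.closure_subset_iff.2 (hsub.trans interior_subset)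
  exact this (hdense θ)

theorem discr_baseT : discr baseT ≠ 0 := by
  have h : (baseT : ℂ) ^ 2 = -1 / 100 := by
    rw [baseT, mul_pow, Complex.I_sq]; push_cast; norm_num
  rw [show discr baseT = (9 - 16 * baseT ^ 2) * (4 * (baseT ^ 2) ^ 3 - 3 * baseT ^ 2 + 1) by
    rw [discr]; ring, h]
  norm_num

theorem exists_baseQuad (Φ : PathHom UU G) : ∃ x₁ x₂ x₃ x₄, Quad Φ (Complex.log baseT)
    (pm baseT) (pp baseT) (qp baseT) (qm baseT) x₁ x₂ x₃ x₄ := by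
  have d1 := csq_sub_sq baseT_dom
  have d2 := csq_add_sq baseT_dom
  have n1 : ‖baseT * csq (3 - 4 * baseT)‖ < 1 / 5 :=
    norm_lt_of_sq_eq norm_baseT (k := -4) (by simp) (by rw [mul_pow, d1]; ring)
  have n2 : ‖baseT * csq (3 + 4 * baseT)‖ < 1 / 5 :=
    norm_lt_of_sq_eq norm_baseT (k := 4) (by simp) (by rw [mul_pow, d2])
  have r1 := csq_re_pos baseT_dom.2.1
  have r2 := csq_re_pos baseT_dom.2.2
  have i1 := congrArg Complex.im d1
  have i2 := congrArg Complex.im d2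
  have k1 := abs_lt.1 ((Complex.abs_re_le_norm _).trans_lt n1)
  have k2 := abs_lt.1 ((Complex.abs_re_le_norm _).trans_lt n2)
  have e : ∀ z : ℂ, (baseT * z).re = -z.im / 10 := fun z => by simp [baseT]; ring
  simp only [sq, Complex.mul_im, Complex.sub_im, Complex.add_im] at i1 i2
  have b1 : (baseT).im = 1 / 10 := by simp [baseT]
  simp [b1] at i1 i2
  rw [e] at k1 k2
  have j1 : (csq (3 - 4 * baseT)).im < 0 := by nlinarith
  have j2 : 0 < (csq (3 + 4 * baseT)).im := by nlinarith
  refine exists_quad Φ (isRoots_of_dom baseT_dom) ?_ ?_ ?_ <;>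
    simp only [pm, pp, qp, qm, Complex.add_re, Complex.sub_re, e, Complex.neg_re, Complex.one_re] <;>
    linarith

theorem Monodromic.exists_generators {c : G} (hΦ : Monodromic Φ c) : ∃ x y : G, Commute x y ∧
    x ^ 2 = c⁻¹ ∧ y ^ 2 = c⁻¹ ∧ ∀ (f : ℝ → ℂ × ℂ) (a b : ℝ), a ≤ b → CurveIn UU f a b →
      f a ∈ Far → f b ∈ Far → Φ.hol f a b ∈ Subgroup.closure {x, y} := by
  obtain ⟨x₁, x₂, x₃, x₄, h⟩ := exists_baseQuad Φ
  obtain ⟨p1, p2⟩ := Quad.pair_products hΦ h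
  obtain ⟨rfl, rfl, hc⟩ := quad_relations hΦ.far h (p1.trans p2.symm)
  refine ⟨x₁, x₃, hc, by rw [sq, p1], by rw [sq, p2], fun f a b hab hf ha hb => ?_⟩
  have h1 : x₁ ∈ Subgroup.closure {x₁, x₃} := Subgroup.subset_closure (by simp)
  have h3 : x₃ ∈ Subgroup.closure {x₁, x₃} := Subgroup.subset_closure (by simp)
  refine hol_mem_of_boxValues hΦ.far _ hab hf ha hb fun t _ => ?_
  refine boxValues_subset_of_forall hΦ.far ?_ (h.boxValues_subset hΦ.far h1 h1 h3 h3) _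
  rw [Complex.exp_log baseT_ne_zero]
  exact discr_baseT

end

section

/-- The affine equation of the quartic in the coordinates `M`, `T`, `N`, on the surface
`M² - 4TN = 1`. -/
def QQ (p : ℂ × ℂ × ℂ) : ℂ :=
  16 * p.2.2 ^ 2 - 6 * (p.1 ^ 2 + 1) - 16 * p.2.1 * p.1 + 9 * p.2.1 ^ 2 - 16 * p.2.1 ^ 4

/-- The double cover of the complement of the sextic. -/
def YY : Set (ℂ × ℂ × ℂ) := {p | p.1 ^ 2 - 4 * p.2.1 * p.2.2 = 1 ∧ QQ p ≠ 0}

/-- The chart of the surface over `T ≠ 0` with logarithmic coordinate. -/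
def chartFun (p : ℂ × ℂ) : ℂ × ℂ × ℂ :=
  (p.1, Complex.exp p.2, (p.1 ^ 2 - 1) / (4 * Complex.exp p.2))

theorem continuous_QQ : Continuous QQ := by
  unfold QQ
  fun_prop

theorem sq_mul_QQ (p : ℂ × ℂ × ℂ) (h : p.1 ^ 2 - 4 * p.2.1 * p.2.2 = 1) :
    p.2.1 ^ 2 * QQ p = DD p.1 p.2.1 := by
  have h1 : p.1 ^ 2 = 1 + 4 * p.2.1 * p.2.2 := by linear_combination h
  have h3 : p.1 ^ 3 = p.1 * (1 + 4 * p.2.1 * p.2.2) := by rw [← h1]; ring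
  have h4 : p.1 ^ 4 = (1 + 4 * p.2.1 * p.2.2) ^ 2 := by rw [← h1]; ring
  unfold QQ DD
  ring_nf
  ring_nf at h1 h3 h4
  rw [h4, h1]
  ring

theorem chartFun_mem {p : ℂ × ℂ} : chartFun p ∈ YY ↔ p ∈ UU := by
  have hT := Complex.exp_ne_zero p.2
  have h : (chartFun p).1 ^ 2 - 4 * (chartFun p).2.1 * (chartFun p).2.2 = 1 := by
    simp only [chartFun]
    field_simp
    ring
  have h2 := sq_mul_QQ _ h
  have h3 : DD (chartFun p).1 (chartFun p).2.1 = DD p.1 (Complex.exp p.2) := rfl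
  rw [h3] at h2
  constructor
  · rintro ⟨_, h4⟩
    exact (h2 ▸ mul_ne_zero (pow_ne_zero 2 hT) h4 : DD p.1 (Complex.exp p.2) ≠ 0)
  · intro h4
    have h5 : DD p.1 (Complex.exp p.2) ≠ 0 := h4
    exact ⟨h, right_ne_zero_of_mul (h2 ▸ h5)⟩

theorem continuous_chartFun : Continuous chartFun := by
  unfold chartFun
  have : ∀ p : ℂ × ℂ, 4 * Complex.exp p.2 ≠ 0 := fun p => by simp
  fun_prop (disch := assumption)

/-- The logarithmic chart as a map into the surface. -/
def chart : C(UU, YY) :=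
  ⟨fun p => ⟨chartFun p, chartFun_mem.2 p.2⟩, (continuous_chartFun.comp continuous_subtype_val).subtype_mk _⟩

theorem chartFun_shift (M θ : ℂ) (n : ℤ) :
    chartFun (M, θ + n * (2 * Real.pi * Complex.I)) = chartFun (M, θ) := by
  simp only [chartFun, Complex.exp_add, Complex.exp_int_mul_two_pi_mul_I, mul_one]

theorem chartFun_shift_one (M θ : ℂ) :
    chartFun (M, θ + 2 * Real.pi * Complex.I) = chartFun (M, θ) := by
  simpa using chartFun_shift M θ 1

theorem eq_of_chartFun_eq {p q : ℂ × ℂ} (h : chartFun p = chartFun q) :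
    ∃ n : ℤ, p = (q.1, q.2 + n * (2 * Real.pi * Complex.I)) := by
  simp only [chartFun, Prod.mk.injEq] at h
  obtain ⟨n, hn⟩ := Complex.exp_eq_exp_iff_exists_int.1 h.2.1
  exact ⟨n, Prod.ext h.1 hn⟩

variable {G : Type*} [Group G]

/-- Invariance of pulled back holonomy under the deck translation. -/
theorem hol_chart_shift (Ψ : PathHom YY G) {f : ℝ → ℂ × ℂ} {a b : ℝ} (hab : a ≤ b)
    (hf : CurveIn UU f a b) :
    (Ψ.comap chart).hol (fun t => ((f t).1, (f t).2 + 2 * Real.pi * Complex.I)) a b =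
      (Ψ.comap chart).hol f a b := by
  obtain ⟨h, hh⟩ := hf.exists_map hab
  have hm : ∀ p : UU, (p.1.1, p.1.2 + 2 * Real.pi * Complex.I) ∈ UU := fun p => by
    rw [← chartFun_mem, chartFun_shift_one]
    exact chartFun_mem.2 p.2
  let s : C(UU, UU) := ⟨fun p => ⟨_, hm p⟩, by fun_prop⟩
  rw [PathHom.hol_eq _ hab h hh, PathHom.hol_eq _ hab (s.comp h) (fun t ht => by
    rw [← hh t ht]; rfl), PathHom.comap_ev, PathHom.comap_ev, ← ContinuousMap.comp_assoc]
  have : chart.comp s = chart := by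
    ext1 p
    exact Subtype.ext (chartFun_shift_one _ _)
  rw [this]

theorem disc_mem {e T : ℂ} (he : e = 1 ∨ e = -1) (hT : ‖T‖ ≤ 1 / 10) :
    (e + 6 * T, T, (12 * e + 36 * T) / 4) ∈ YY := by
  have he2 : e ^ 2 = 1 := by rcases he with rfl | rfl <;> norm_num
  have hen : ‖e‖ = 1 := by rcases he with rfl | rfl <;> simp
  refine ⟨by linear_combination he2, fun h => ?_⟩
  have h1 : (132 : ℂ) = -(776 * e * T + 993 * T ^ 2 - 16 * T ^ 4) := by
    simp only [QQ] at h
    linear_combination h + (-144 + 6) * he2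
  have h2 := congrArg norm h1
  rw [norm_neg] at h2
  have h3 := norm_sub_le (776 * e * T + 993 * T ^ 2) (16 * T ^ 4)
  have h4 := norm_add_le (776 * e * T) (993 * T ^ 2)
  simp only [norm_mul, norm_pow, hen, Complex.norm_ofNat] at h2 h3 h4
  have h5 : ‖T‖ ^ 2 ≤ (1 / 10) ^ 2 := by gcongr
  have h6 : ‖T‖ ^ 4 ≤ (1 / 10) ^ 4 := by gcongr
  linarith

theorem chartFun_disc {e : ℂ} (he : e = 1 ∨ e = -1) (z : ℂ) :
    chartFun (e + 6 * baseT * Complex.exp z, Complex.log baseT + z) =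
      (e + 6 * (baseT * Complex.exp z), baseT * Complex.exp z,
        (12 * e + 36 * (baseT * Complex.exp z)) / 4) := by
  have he2 : e ^ 2 = 1 := by rcases he with rfl | rfl <;> norm_num
  have hT := Complex.exp_ne_zero z
  have hb := baseT_ne_zero
  simp only [chartFun, Complex.exp_add, Complex.exp_log baseT_ne_zero, Prod.mk.injEq]
  refine ⟨by ring, trivial, ?_⟩
  field_simp
  linear_combination he2

theorem norm_baseT_mul_exp_le (s : ℝ) :
    ‖baseT * Complex.exp (2 * Real.pi * s * Complex.I)‖ ≤ 1 / 10 := by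
  rw [norm_mul, norm_baseT]
  have := Complex.norm_exp_ofReal_mul_I (2 * Real.pi * s)
  push_cast at this
  rw [this, mul_one]

theorem curveIn_disc {e : ℂ} (he : e = 1 ∨ e = -1) :
    CurveIn UU (fun s : ℝ => (e + 6 * baseT * Complex.exp (2 * Real.pi * s * Complex.I),
      Complex.log baseT + 2 * Real.pi * s * Complex.I)) 0 1 := by
  refine ⟨by fun_prop, fun t _ => chartFun_mem.1 ?_⟩
  rw [chartFun_disc he]
  exact disc_mem he (norm_baseT_mul_exp_le t)

theorem hol_disc (Ψ : PathHom YY G) {e : ℂ} (he : e = 1 ∨ e = -1) :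
    (Ψ.comap chart).hol (fun s : ℝ => (e + 6 * baseT * Complex.exp (2 * Real.pi * s * Complex.I),
      Complex.log baseT + 2 * Real.pi * s * Complex.I)) 0 1 = 1 := by
  let B : Set ℂ := Metric.closedBall 0 (1 / 10)
  have hB : SimplyConnectedSpace B :=
    simplyConnectedSpace_of_convex (convex_closedBall 0 _) ⟨0, by simp [B]⟩
  have hBm : ∀ T : B, ‖(T : ℂ)‖ ≤ 1 / 10 := fun T => by simpa [B] using T.2
  let d : C(B, YY) := ⟨fun T => ⟨_, disc_mem he (hBm T)⟩, by fun_prop⟩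
  let k : C(ℝ, B) := ⟨fun s => ⟨baseT * Complex.exp (2 * Real.pi * s * Complex.I), by
    simpa [B] using norm_baseT_mul_exp_le s⟩, by fun_prop⟩
  have hk : k 0 = k 1 := Subtype.ext (by simp [k])
  obtain ⟨h, hh⟩ := (curveIn_disc he).exists_map zero_le_one
  have key : Ψ.ev (chart.comp h) 0 1 = Ψ.ev (d.comp k) 0 1 := by
    refine Ψ.ev_congr zero_le_one fun t ht => Subtype.ext ?_
    simp only [chart, d, k, ContinuousMap.comp_apply, ContinuousMap.coe_mk, hh t ht,
      chartFun_disc he]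
  rw [PathHom.hol_eq _ zero_le_one h hh, PathHom.comap_ev, key, Ψ.ev_comp, hk, Ψ.ev_self]

end

section

/-- A base point in the far region. -/
def farBase : ℂ × ℂ := (pt 0 (topH (Complex.log baseT)), Complex.log baseT)

theorem farBase_mem : farBase ∈ Far := by
  simp [farBase, Far]

instance : SimplyConnectedSpace Far :=
  simplyConnectedSpace_of_convex convex_far ⟨farBase, farBase_mem⟩

/-- The deck translation of the logarithmic coordinate. -/
def deck (p : ℂ × ℂ) : ℂ × ℂ := (p.1, p.2 + 2 * Real.pi * Complex.I)

theorem continuous_deck : Continuous deck := by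
  unfold deck
  fun_prop

theorem deck_mem_far {p : ℂ × ℂ} : deck p ∈ Far ↔ p ∈ Far := by
  simp [deck, Far, topH]

theorem deck_mem {p : ℂ × ℂ} (hp : p ∈ UU) : deck p ∈ UU := by
  rw [← chartFun_mem, deck, chartFun_shift_one]
  exact chartFun_mem.2 hp

variable {G : Type*} [Group G] (Φ : PathHom UU G)

/-- Conjugation of a groupoid homomorphism by a function on the base. -/
def PathHom.twist (u : ℂ × ℂ → G) : PathHom UU G where
  toFun {x y} p := (u x)⁻¹ * Φ.toFun p * u y
  map_trans p q := by
    rw [Φ.map_trans]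
    group

theorem PathHom.hol_twist (u : ℂ × ℂ → G) {f : ℝ → ℂ × ℂ} {a b : ℝ} (hab : a ≤ b)
    (hf : CurveIn UU f a b) :
    (Φ.twist u).hol f a b = (u (f a))⁻¹ * Φ.hol f a b * u (f b) := by
  obtain ⟨h, hh⟩ := hf.exists_map hab
  rw [PathHom.hol_eq _ hab h hh, PathHom.hol_eq _ hab h hh, ← hh a (left_mem_Icc.2 hab),
    ← hh b (right_mem_Icc.2 hab)]
  rfl

/-- The value of `Φ` on paths in the far region. -/
def farEv (p q : Far) : G :=
  Φ.ev ⟨Set.inclusion far_subset, continuous_inclusion far_subset⟩ p q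

theorem hol_eq_farEv {f : ℝ → ℂ × ℂ} {a b : ℝ} (hab : a ≤ b) (hf : CurveIn Far f a b) :
    Φ.hol f a b = farEv Φ ⟨f a, hf.2 a (left_mem_Icc.2 hab)⟩ ⟨f b, hf.2 b (right_mem_Icc.2 hab)⟩ := by
  obtain ⟨h, hh⟩ := hf.exists_map hab
  rw [Φ.hol_factor hab ⟨Set.inclusion far_subset, continuous_inclusion far_subset⟩
    h.continuous.continuousOn fun t ht => (hh t ht).symm, farEv]
  congr 1 <;> exact Subtype.ext (hh _ (by simp [hab]))

theorem farEv_trans (p q r : Far) : farEv Φ p q * farEv Φ q r = farEv Φ p r :=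
  Φ.ev_trans _ _ _ _

/-- The invariance of the holonomy under the deck translation. -/
def DeckInvariant : Prop := ∀ (f : ℝ → ℂ × ℂ) (a b : ℝ), a ≤ b → CurveIn UU f a b →
  Φ.hol (fun t => deck (f t)) a b = Φ.hol f a b

variable {Φ}

theorem DeckInvariant.farEv (h : DeckInvariant Φ) (p q : Far) :
    farEv Φ ⟨deck p, deck_mem_far.2 p.2⟩ ⟨deck q, deck_mem_far.2 q.2⟩ = farEv Φ p q := by
  have hc : CurveIn Far (fun t : ℝ => AffineMap.lineMap (p : ℂ × ℂ) (q : ℂ × ℂ) t) 0 1 :=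
    ⟨AffineMap.lineMap_continuous.continuousOn, fun t ht => convex_far.lineMap_mem p.2 q.2 ht⟩
  have hd : CurveIn Far (fun t : ℝ => deck (AffineMap.lineMap (p : ℂ × ℂ) (q : ℂ × ℂ) t)) 0 1 :=
    ⟨continuous_deck.comp_continuousOn hc.1, fun t ht => deck_mem_far.2 (hc.2 t ht)⟩
  have h1 := h _ 0 1 zero_le_one ⟨hc.1, fun t ht => far_subset (hc.2 t ht)⟩
  rw [hol_eq_farEv Φ zero_le_one hc, hol_eq_farEv Φ zero_le_one hd] at h1
  simpa using h1

variable (Φ)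

/-- The monodromy of the deck translation. -/
def deckGen : G := farEv Φ ⟨farBase, farBase_mem⟩ ⟨deck farBase, deck_mem_far.2 farBase_mem⟩

open Classical in
/-- The farGauge making the far region trivial. -/
def farGauge (p : ℂ × ℂ) : G :=
  if h : p ∈ Far then farEv Φ ⟨p, h⟩ ⟨farBase, farBase_mem⟩
  else deckGen Φ ^ (-⌊p.2.im / (2 * Real.pi)⌋)

variable {Φ}

theorem farGauge_farBase : farGauge Φ farBase = 1 := by
  rw [farGauge, dif_pos farBase_mem, farEv, Φ.ev_self]

theorem DeckInvariant.farGauge_deck (h : DeckInvariant Φ) (p : ℂ × ℂ) :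
    farGauge Φ (deck p) = farGauge Φ p * (deckGen Φ)⁻¹ := by
  by_cases hp : p ∈ Far
  · rw [farGauge, farGauge, dif_pos hp, dif_pos (deck_mem_far.2 hp), eq_mul_inv_iff_mul_eq, deckGen,
      farEv_trans, ← h.farEv ⟨p, hp⟩]
  · rw [farGauge, farGauge, dif_neg hp, dif_neg (fun h => hp (deck_mem_far.1 h)), ← zpow_sub_one]
    congr 1
    have : (deck p).2.im / (2 * Real.pi) = p.2.im / (2 * Real.pi) + 1 := by
      have := Real.pi_pos
      simp [deck]
      field_simp
    rw [this, Int.floor_add_one]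
    ring

theorem not_far_disc {e z : ℂ} (he : e = 1 ∨ e = -1) :
    (e + 6 * baseT, z) ∉ Far := by
  have h1 := topH_pos z
  have h2 : (e + 6 * baseT).im = 3 / 5 := by rcases he with rfl | rfl <;> simp [baseT] <;> norm_num
  simp only [Far, mem_ofPred_eq, not_lt, h2]
  linarith

theorem DeckInvariant.monodromic (h : DeckInvariant Φ)
    (hd : ∀ e : ℂ, e = 1 ∨ e = -1 →
      Φ.hol (fun s : ℝ => (e + 6 * baseT * Complex.exp (2 * Real.pi * s * Complex.I),
        Complex.log baseT + 2 * Real.pi * s * Complex.I)) 0 1 = 1) :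
    Monodromic (Φ.twist (farGauge Φ)) (deckGen Φ) where
  far f a b hab hf := by
    have hf' : CurveIn UU f a b := ⟨hf.1, fun t ht => far_subset (hf.2 t ht)⟩
    rw [Φ.hol_twist _ hab hf', hol_eq_farEv Φ hab hf, farGauge, farGauge,
      dif_pos (hf.2 a (left_mem_Icc.2 hab)), dif_pos (hf.2 b (right_mem_Icc.2 hab)), mul_assoc,
      farEv_trans, inv_mul_cancel]
  shift f a b hab hf := by
    have hf' : CurveIn UU (fun t => deck (f t)) a b := by
      refine ⟨continuous_deck.comp_continuousOn hf.1, fun t ht => ?_⟩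
      exact deck_mem (hf.2 t ht)
    have e := Φ.hol_twist (farGauge Φ) hab hf'
    rw [h f a b hab hf, h.farGauge_deck, h.farGauge_deck] at e
    refine e.trans ?_
    rw [Φ.hol_twist _ hab hf]
    group
  disc e he := by
    rw [Φ.hol_twist _ zero_le_one (curveIn_disc he), hd e he]
    have e0 : farGauge Φ (e + 6 * baseT, Complex.log baseT) = 1 := by
      rw [farGauge, dif_neg (not_far_disc he)]
      have : ⌊(Complex.log baseT).im / (2 * Real.pi)⌋ = 0 := by
        have := Real.pi_pos
        rw [Int.floor_eq_zero_iff, Complex.log_im]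
        have h2 : Complex.arg baseT = Real.pi / 2 := by
          rw [baseT, Complex.arg_real_mul _ (by norm_num), Complex.arg_I]
        rw [h2]
        constructor
        · positivity
        · rw [div_lt_one (by positivity)]
          linarith
      rw [this, neg_zero, zpow_zero]
    have e1 := h.farGauge_deck (e + 6 * baseT, Complex.log baseT)
    simpa [e0, deck] using e1

theorem deckInvariant_chart (Ψ : PathHom YY G) : DeckInvariant (Ψ.comap chart) :=
  fun _ _ _ hab hf => hol_chart_shift Ψ hab hf

theorem PathHom.comap_comap {X Y Z : Type*} [TopologicalSpace X] [TopologicalSpace Y]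
    [TopologicalSpace Z] (Φ : PathHom Z G) (f : C(Y, Z)) (g : C(X, Y)) :
    (Φ.comap f).comap g = Φ.comap (f.comp g) := by
  rw [PathHom.mk.injEq]
  funext x y p
  induction p using Path.Homotopic.Quotient.ind
  rfl

/-- The deck translation as a self-map. -/
def deckMap : C(UU, UU) :=
  ⟨fun p => ⟨deck p, deck_mem p.2⟩, (continuous_deck.comp continuous_subtype_val).subtype_mk _⟩

theorem toFun_map_deckMap (Ψ : PathHom YY G) {p q : UU} (r : Path.Homotopic.Quotient p q) :
    (Ψ.comap chart).toFun (r.map deckMap) = (Ψ.comap chart).toFun r := by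
  have h : chart.comp deckMap = chart := by
    ext1 p
    exact Subtype.ext (chartFun_shift_one _ _)
  change ((Ψ.comap chart).comap deckMap).toFun r = _
  rw [PathHom.comap_comap, h]

/-- Every value of a groupoid homomorphism on a subset of a space is the holonomy of a curve. -/
theorem PathHom.toFun_eq_hol {E : Type*} [TopologicalSpace E] {U : Set E} (Φ : PathHom U G)
    {p q : U} (r : Path.Homotopic.Quotient p q) :
    ∃ f : ℝ → E, CurveIn U f 0 1 ∧ f 0 = p ∧ f 1 = q ∧ Φ.toFun r = Φ.hol f 0 1 := by
  induction r using Path.Homotopic.Quotient.ind with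
  | mk γ =>
    have : SimplyConnectedSpace I :=
      simplyConnectedSpace_of_convex (convex_Icc (0 : ℝ) 1) ⟨0, by simp⟩
    refine ⟨fun t => (γ.extend t : U), ⟨by fun_prop, fun t _ => (γ.extend t).2⟩, by simp, by simp,
      ?_⟩
    rw [Φ.toFun_mk, Φ.hol_factor (f := fun t => (γ.extend t : U)) zero_le_one (γ : C(I, U)) (k := projIcc 0 1 zero_le_one)
      continuous_projIcc.continuousOn fun t _ => rfl]
    simp

theorem PathHom.toFun_refl {X : Type*} [TopologicalSpace X] (Φ : PathHom X G) (x : X) :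
    Φ.toFun (Path.Homotopic.Quotient.refl x) = 1 := by
  simpa using (Φ.map_trans (.refl x) (.refl x)).symm

theorem PathHom.toFun_symm {X : Type*} [TopologicalSpace X] (Φ : PathHom X G) {x y : X}
    (r : Path.Homotopic.Quotient x y) : Φ.toFun r.symm = (Φ.toFun r)⁻¹ := by
  rw [eq_inv_iff_mul_eq_one, ← Φ.map_trans, Path.Homotopic.Quotient.symm_trans, Φ.toFun_refl]

theorem exists_path_far (p : UU) : ∃ q : UU, (q : ℂ × ℂ) ∈ Far ∧ Joined p q := by
  obtain ⟨l, -, h⟩ := exists_curveIn_ell p.2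
  obtain ⟨f, hf⟩ := h.exists_map zero_le_two
  have h0 : f 0 = p := Subtype.ext ((hf 0 (by simp)).trans (ell_zero _ _))
  refine ⟨f 2, ?_, ⟨(PathConnectedSpace.somePath (0 : ℝ) 2).map f.continuous |>.cast h0.symm rfl⟩⟩
  rw [hf 2 (by simp), ell_two]
  simp [Far]

theorem exists_coset_function (Ψ : PathHom YY G) : ∃ x y : G, Commute x y ∧ x ^ 2 = y ^ 2 ∧
    ∃ v : UU → G, v ⟨farBase, far_subset farBase_mem⟩ ∈ Subgroup.closure {x, y} ∧
      (∀ (p q : UU) (r : Path.Homotopic.Quotient p q),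
        (v p)⁻¹ * (Ψ.comap chart).toFun r * v q ∈ Subgroup.closure {x, y}) ∧
      ∀ p q : UU, chart p = chart q → (v p)⁻¹ * v q ∈ Subgroup.closure {x, y} := by
  have hD := deckInvariant_chart Ψ
  have hM := hD.monodromic fun e he => hol_disc Ψ he
  obtain ⟨x, y, hxy, hx, hy, hS⟩ := hM.exists_generators
  set Φ := Ψ.comap chart
  set S := Subgroup.closure {x, y} with hSdef
  have hfar : ∀ (p q : UU) (r : Path.Homotopic.Quotient p q), (p : ℂ × ℂ) ∈ Far →
      (q : ℂ × ℂ) ∈ Far → (farGauge Φ p)⁻¹ * Φ.toFun r * farGauge Φ q ∈ S := by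
    intro p q r hp hq
    change (Φ.twist (farGauge Φ)).toFun r ∈ S
    obtain ⟨f, hf, h0, h1, e⟩ := (Φ.twist (farGauge Φ)).toFun_eq_hol r
    rw [e]
    exact hS f 0 1 zero_le_one hf (h0 ▸ hp) (h1 ▸ hq)
  have hshift : ∀ {p q : UU} (r : Path.Homotopic.Quotient p q),
      Φ.toFun (r.map deckMap) = Φ.toFun r := toFun_map_deckMap Ψ
  choose w hw hj using exists_path_far
  let k : ∀ p, Path.Homotopic.Quotient p (w p) := fun p => Path.Homotopic.Quotient.mk (hj p).some
  let v : UU → G := fun p => Φ.toFun (k p) * farGauge Φ (w p)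
  have h1 : ∀ (p q : UU) (r : Path.Homotopic.Quotient p q), (v p)⁻¹ * Φ.toFun r * v q ∈ S := by
    intro p q r
    have := hfar _ _ (((k p).symm.trans r).trans (k q)) (hw p) (hw q)
    rw [Φ.map_trans, Φ.map_trans, Φ.toFun_symm] at this
    convert this using 1
    simp only [v]
    group
  have hc : deckGen Φ ∈ S := by
    rw [← inv_mem_iff, ← hx]
    exact S.pow_mem (Subgroup.subset_closure (by simp)) 2
  have h2 : ∀ p : UU, (v p)⁻¹ * v (deckMap p) ∈ S := by
    intro p
    have a1 := h1 _ _ ((k p).map deckMap)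
    rw [hshift] at a1
    have a2 := hfar _ _ (k (deckMap (w p))) (deck_mem_far.2 (hw p)) (hw _)
    have a3 : farGauge Φ (deckMap (w p)) = _ := hD.farGauge_deck (w p)
    rw [a3] at a2
    have a4 := S.mul_mem (S.mul_mem (S.inv_mem hc) a2) (S.inv_mem a1)
    convert a4 using 1
    simp only [v]
    group
  have h3 : ∀ (n : ℤ) (p q : UU), (q : ℂ × ℂ) = (p.1.1, p.1.2 + n * (2 * Real.pi * Complex.I)) →
      (v p)⁻¹ * v q ∈ S := by
    intro n
    have hadd : ∀ (p q : ℂ × ℂ) (m : ℤ), q = (p.1, p.2 + m * (2 * Real.pi * Complex.I)) →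
        deck q = (p.1, p.2 + (m + 1 : ℤ) * (2 * Real.pi * Complex.I)) := by
      rintro p _ m rfl
      simp only [deck]
      push_cast
      ring_nf
    have htr : ∀ p q r : UU, (v p)⁻¹ * v q ∈ S → (v q)⁻¹ * v r ∈ S → (v p)⁻¹ * v r ∈ S := by
      intro p q r hp hq
      simpa [mul_assoc] using S.mul_mem hp hq
    have hmem : ∀ (p : UU) (m : ℤ), (p.1.1, p.1.2 + m * (2 * Real.pi * Complex.I)) ∈ UU := by
      intro p m
      rw [← chartFun_mem, chartFun_shift]
      exact chartFun_mem.2 p.2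
    induction n with
    | zero =>
      intro p q h
      have : q = p := Subtype.ext (by rw [h]; simp)
      simp [this]
    | succ n ih =>
      intro p q h
      let r : UU := ⟨_, hmem p n⟩
      have e : deckMap r = q := Subtype.ext ((hadd _ _ n rfl).trans (by rw [h]))
      exact htr p r q (ih p r rfl) (e ▸ h2 r)
    | pred n ih =>
      intro p q h
      let r : UU := ⟨_, hmem p (-n)⟩
      have e : deckMap q = r := Subtype.ext ((hadd _ _ _ h).trans (by simp [r]))
      refine htr p r q (ih p r (by simp [r])) ?_
      have := S.inv_mem (h2 q)
      rw [e] at this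
      simpa using this
  refine ⟨x, y, hxy, hx.trans hy.symm, v, ?_, h1, fun p q h => ?_⟩
  · have := hfar _ _ (k ⟨farBase, far_subset farBase_mem⟩) farBase_mem (hw _)
    rw [farGauge_farBase] at this
    simpa [v] using this
  · obtain ⟨n, hn⟩ := eq_of_chartFun_eq (congrArg Subtype.val h).symm
    exact h3 n p q hn

end

section

variable {G : Type*} [Group G]

/-- A simply connected chart of the surface around `y`, compatible with a coset function on the
logarithmic cover, together with a curve from `y` into the domain of the logarithmic chart. -/
structure LocalChart (Ψ : PathHom YY G) (v : UU → G) (S : Subgroup G) (y : YY) where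
  A : Type
  [top : TopologicalSpace A]
  [sc : SimplyConnectedSpace A]
  c : C(A, YY)
  K : Set YY
  isOpen : IsOpen K
  self_mem : y ∈ K
  e : C(K, A)
  c_e : ∀ z : K, c (e z) = z
  κ : C(ℝ, A)
  κ_zero : c (κ 0) = y
  κ_lift : ∀ u ∈ Ioc (0 : ℝ) 1, ∃ p, chart p = c (κ u)
  coset : ∀ p q a b, chart p = c a → chart q = c b → (v p)⁻¹ * Ψ.ev c a b * v q ∈ S

attribute [instance] LocalChart.top LocalChart.sc

variable {Ψ : PathHom YY G} {v : UU → G} {S : Subgroup G}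

theorem LocalChart.ev_eq {y : YY} (L : LocalChart Ψ v S y) {g : C(ℝ, YY)} {a b : ℝ} (hab : a ≤ b)
    (hg : ∀ t ∈ Icc a b, g t ∈ L.K) :
    Ψ.ev g a b = Ψ.ev L.c (L.e ⟨g a, hg a (left_mem_Icc.2 hab)⟩)
      (L.e ⟨g b, hg b (right_mem_Icc.2 hab)⟩) := by
  let k : C(ℝ, L.K) := ⟨fun t => ⟨g (projIcc a b hab t), hg _ (projIcc a b hab t).2⟩, by
    have := continuous_projIcc (h := hab)
    fun_prop⟩
  have h1 : Ψ.ev g a b = Ψ.ev (L.c.comp (L.e.comp k)) a b := Ψ.ev_congr hab fun t ht => by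
    simp [k, L.c_e, projIcc_of_mem hab ht]
  rw [h1, Ψ.ev_comp]
  simp [k]

/-- The values of `Ψ` on curves from `y` into the domain of the logarithmic chart, corrected by the
coset function. -/
def surfaceValues (Ψ : PathHom YY G) (v : UU → G) (S : Subgroup G) (y : ℂ × ℂ × ℂ) : Set G :=
  {w | ∃ h : C(ℝ, YY), (h 0 : ℂ × ℂ × ℂ) = y ∧ ∀ u ∈ Ioc (0 : ℝ) 1, ∃ p : UU, chart p = h u ∧
    w⁻¹ * Ψ.ev h 0 u * v p ∈ S}

theorem LocalChart.nonempty {y : YY} (L : LocalChart Ψ v S y) :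
    (surfaceValues Ψ v S y).Nonempty := by
  obtain ⟨q, hq⟩ := L.κ_lift 1 (by simp)
  refine ⟨Ψ.ev (L.c.comp L.κ) 0 1 * v q, L.c.comp L.κ, congrArg _ L.κ_zero, fun u hu => ?_⟩
  obtain ⟨p, hp⟩ := L.κ_lift u hu
  refine ⟨p, hp, ?_⟩
  have h := L.coset q p _ _ hq hp
  rw [← Ψ.ev_comp, ← Ψ.ev_trans _ 1 0 u, ← Ψ.ev_symm] at h
  convert h using 1
  group

theorem LocalChart.exists_small {y : YY} (L : LocalChart Ψ v S y) {h : C(ℝ, YY)}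
    (h0 : h 0 ∈ L.K) : ∃ u ∈ Ioc (0 : ℝ) 1, ∀ t ∈ Icc 0 u, h t ∈ L.K := by
  have hm : h ⁻¹' L.K ∈ 𝓝 (0 : ℝ) := (L.isOpen.preimage h.continuous).mem_nhds h0
  obtain ⟨ε, hε, hb⟩ := Metric.mem_nhds_iff.1 hm
  refine ⟨min 1 (ε / 2), ⟨by positivity, min_le_left _ _⟩, fun t ht => hb ?_⟩
  have := ht.2.trans (min_le_right _ _)
  rw [Metric.mem_ball, Real.dist_eq, sub_zero, abs_of_nonneg ht.1]
  linarith

theorem LocalChart.mem {y : YY} (L : LocalChart Ψ v S y) {g : C(ℝ, YY)} {a b : ℝ} (hab : a ≤ b)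
    (hg : ∀ t ∈ Icc a b, g t ∈ L.K) {w w' : G} (hw : w ∈ surfaceValues Ψ v S (g a))
    (hw' : w' ∈ surfaceValues Ψ v S (g b)) : w⁻¹ * Ψ.ev g a b * w' ∈ S := by
  obtain ⟨h, h0, hp⟩ := hw
  obtain ⟨h', h0', hp'⟩ := hw'
  replace h0 : h 0 = g a := Subtype.ext h0
  replace h0' : h' 0 = g b := Subtype.ext h0'
  obtain ⟨u, hu, hK⟩ := L.exists_small (h := h) (h0 ▸ hg a (left_mem_Icc.2 hab))
  obtain ⟨u', hu', hK'⟩ := L.exists_small (h := h') (h0' ▸ hg b (right_mem_Icc.2 hab))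
  obtain ⟨p, hpu, hpS⟩ := hp u hu
  obtain ⟨p', hpu', hpS'⟩ := hp' u' hu'
  have m := L.coset p p' (L.e ⟨h u, hK u ⟨hu.1.le, le_rfl⟩⟩) (L.e ⟨h' u', hK' u' ⟨hu'.1.le, le_rfl⟩⟩)
    (by rw [L.c_e, hpu]) (by rw [L.c_e, hpu'])
  rw [L.ev_eq hu.1.le hK] at hpS
  rw [L.ev_eq hu'.1.le hK'] at hpS'
  simp only [h0] at hpS
  simp only [h0'] at hpS'
  rw [L.ev_eq hab hg]
  have h1 := S.mul_mem (S.mul_mem hpS m) (S.inv_mem hpS')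
  rw [← Ψ.ev_trans L.c _ (L.e ⟨g a, hg a (left_mem_Icc.2 hab)⟩) (L.e ⟨h' u', _⟩), ← Ψ.ev_symm L.c _ (L.e ⟨h u, _⟩),
    ← Ψ.ev_trans L.c _ (L.e ⟨g b, hg b (right_mem_Icc.2 hab)⟩) (L.e ⟨h' u', _⟩)] at h1
  convert h1 using 1
  group

theorem toFun_mem_of_localChart (hL : ∀ y, Nonempty (LocalChart Ψ v S y)) {y z : YY}
    (r : Path.Homotopic.Quotient y z) {w w' : G} (hw : w ∈ surfaceValues Ψ v S y)
    (hw' : w' ∈ surfaceValues Ψ v S z) : w⁻¹ * Ψ.toFun r * w' ∈ S := by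
  obtain ⟨f, hf, h0, h1, e⟩ := Ψ.toFun_eq_hol r
  rw [e]
  obtain ⟨g, hg⟩ := hf.exists_map zero_le_one
  refine Ψ.hol_mem_of_potential S zero_le_one hf (fun t => surfaceValues Ψ v S (f t)) ?_ ?_ w
    (h0 ▸ hw) w' (h1 ▸ hw')
  · intro t ht
    obtain ⟨L⟩ := hL ⟨f t, hf.2 t ht⟩
    exact L.nonempty
  · intro t ht
    obtain ⟨L⟩ := hL (g t)
    obtain ⟨ε, hε, hb⟩ := Metric.mem_nhds_iff.1
      ((L.isOpen.preimage g.continuous).mem_nhds L.self_mem : g ⁻¹' L.K ∈ 𝓝 t)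
    refine ⟨_, Metric.ball_mem_nhds t hε, fun s hs s' hs' hss w hw w' hw' => ?_⟩
    rw [Ψ.hol_eq hss g fun x hx => hg x ⟨hs.1.1.trans hx.1, hx.2.trans hs'.1.2⟩]
    rw [← hg s hs.1] at hw
    rw [← hg s' hs'.1] at hw'
    refine L.mem hss (fun x hx => hb ?_) hw hw'
    exact (convex_ball t ε).ordConnected.out hs.2 hs'.2 hx

end

section

variable {G : Type*} [Group G] {Ψ : PathHom YY G} {v : UU → G} {S : Subgroup G}

theorem coset_of_lift {A B : Type*} [TopologicalSpace A] [TopologicalSpace B]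
    [SimplyConnectedSpace A] [SimplyConnectedSpace B]
    (h1 : ∀ (p q : UU) (r : Path.Homotopic.Quotient p q),
      (v p)⁻¹ * (Ψ.comap chart).toFun r * v q ∈ S)
    (h2 : ∀ p q : UU, chart p = chart q → (v p)⁻¹ * v q ∈ S)
    {c : C(A, YY)} (j : C(B, A)) (l : C(B, UU)) (hl : chart.comp l = c.comp j) {p q : UU}
    (b b' : B) (hp : chart p = c (j b)) (hq : chart q = c (j b')) :
    (v p)⁻¹ * Ψ.ev c (j b) (j b') * v q ∈ S := by
  have e : Ψ.ev c (j b) (j b') = (Ψ.comap chart).toFun (arr l b b') := by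
    rw [← Ψ.ev_comp, ← hl]
    rfl
  have hb : ∀ b, chart (l b) = c (j b) := fun b => congrArg (fun f => f b) hl
  have a1 := S.mul_mem (S.mul_mem (h2 p (l b) (hp.trans (hb b).symm)) (h1 _ _ (arr l b b')))
    (h2 (l b') q ((hb b').trans hq.symm))
  rw [e]
  convert a1 using 1
  group

theorem nonempty_localChart_of_ne
    (h1 : ∀ (p q : UU) (r : Path.Homotopic.Quotient p q),
      (v p)⁻¹ * (Ψ.comap chart).toFun r * v q ∈ S)
    (h2 : ∀ p q : UU, chart p = chart q → (v p)⁻¹ * v q ∈ S) {y : YY} (hy : y.1.2.1 ≠ 0) :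
    Nonempty (LocalChart Ψ v S y) := by
  let E : ℂ × ℂ × ℂ → ℂ × ℂ := fun z => (z.1, Complex.log y.1.2.1 + Complex.log (z.2.1 / y.1.2.1))
  have hchart : ∀ z : YY, z.1.2.1 ≠ 0 → chartFun (E z) = z := by
    intro z hz
    have : (chartFun (E z)).2.1 = z.1.2.1 := by
      simp only [chartFun, E, Complex.exp_add, Complex.exp_log hy, Complex.exp_log (div_ne_zero hz hy)]
      field_simp
    refine Prod.ext rfl (Prod.ext this ?_)
    have e1 : (chartFun (E z)).2.2 = ((E z).1 ^ 2 - 1) / (4 * (chartFun (E z)).2.1) := rfl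
    rw [e1, this, div_eq_iff (mul_ne_zero (by norm_num : (4 : ℂ) ≠ 0) hz)]
    linear_combination z.2.1
  have hEy : E y ∈ UU := chartFun_mem.1 (by rw [hchart y hy]; exact y.2)
  obtain ⟨r, hr, hb⟩ := Metric.isOpen_iff.1 isOpen_UU _ hEy
  let A := Metric.ball (E y) r
  have hA : SimplyConnectedSpace A :=
    simplyConnectedSpace_of_convex (convex_ball _ _) ⟨_, Metric.mem_ball_self hr⟩
  let l : C(A, UU) := ⟨Set.inclusion hb, continuous_inclusion hb⟩
  let K₀ : Set YY := {z | z.1.2.1 / y.1.2.1 ∈ Complex.slitPlane}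
  have hK₀ : IsOpen K₀ := Complex.isOpen_slitPlane.preimage (by fun_prop)
  have hEc : ContinuousOn (fun z : YY => E z) K₀ := by
    refine ContinuousOn.prodMk (by fun_prop) (continuousOn_const.add ?_)
    exact ContinuousOn.clog (by fun_prop) fun z hz => hz
  have hK₀0 : ∀ z ∈ K₀, z.1.2.1 ≠ 0 := by
    intro z hz h
    simp [K₀, h] at hz
  refine ⟨{ A := A, c := chart.comp l, K := K₀ ∩ (fun z : YY => E z) ⁻¹' A
            isOpen := hEc.isOpen_inter_preimage hK₀ Metric.isOpen_ball
            self_mem := ⟨by simp [K₀, hy], Metric.mem_ball_self hr⟩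
            e := ⟨fun z => ⟨E z, z.2.2⟩, ?_⟩
            c_e := fun z => Subtype.ext (hchart z (hK₀0 z z.2.1))
            κ := ContinuousMap.const ℝ ⟨E y, Metric.mem_ball_self hr⟩
            κ_zero := Subtype.ext (hchart y hy)
            κ_lift := fun u hu => ⟨l ⟨E y, Metric.mem_ball_self hr⟩, rfl⟩
            coset := fun p q a b hp hq =>
              coset_of_lift h1 h2 (ContinuousMap.id A) l rfl a b hp hq }⟩
  have := hEc.comp_continuous (f := fun z : (K₀ ∩ (fun z : YY => E z) ⁻¹' A : Set YY) => (z : YY))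
    continuous_subtype_val fun z => z.2.1
  exact this.subtype_mk _

/-- The chart of the surface around a point with `T = 0`. -/
def axisFun (s : ℂ) (p : ℂ × ℂ) : ℂ × ℂ × ℂ := (s * csq (1 + 4 * p.1 * p.2), p.1, p.2)

theorem nonempty_localChart_of_eq
    (h1 : ∀ (p q : UU) (r : Path.Homotopic.Quotient p q),
      (v p)⁻¹ * (Ψ.comap chart).toFun r * v q ∈ S)
    (h2 : ∀ p q : UU, chart p = chart q → (v p)⁻¹ * v q ∈ S) {y : YY} (hy : y.1.2.1 = 0) :
    Nonempty (LocalChart Ψ v S y) := by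
  obtain ⟨⟨s, T, N⟩, hyY⟩ := y
  obtain rfl : T = 0 := hy
  have hs2 : s ^ 2 = 1 := by simpa using hyY.1
  let D : Set (ℂ × ℂ) := {p | 1 + 4 * p.1 * p.2 ∈ Complex.slitPlane}
  have hD : IsOpen D := Complex.isOpen_slitPlane.preimage (by fun_prop)
  have hDc : ContinuousOn (axisFun s) D := by
    refine ContinuousOn.prodMk (continuousOn_const.mul (ContinuousOn.csq' ?_ fun z hz => hz)) ?_ <;>
      fun_prop
  have hcsq1 : csq 1 = 1 := by simp [csq]
  have h0 : axisFun s (0, N) = (s, 0, N) := by simp [axisFun, hcsq1]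
  have hopen : IsOpen (D ∩ axisFun s ⁻¹' {z | QQ z ≠ 0}) :=
    hDc.isOpen_inter_preimage hD (isOpen_ne.preimage continuous_QQ)
  obtain ⟨r, hr, hb⟩ := Metric.isOpen_iff.1 hopen (0, N) ⟨by simp [D], by
    rw [mem_preimage, h0]; exact hyY.2⟩
  let A : Set (ℂ × ℂ) := Metric.ball (0, N) r
  have hmem : ∀ p ∈ A, axisFun s p ∈ YY := by
    intro p hp
    refine ⟨?_, (hb hp).2⟩
    simp only [axisFun, mul_pow, hs2, csq_sq (Complex.slitPlane_ne_zero (hb hp).1)]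
    ring
  have hA0 : (0, N) ∈ A := Metric.mem_ball_self hr
  have hA : SimplyConnectedSpace A := simplyConnectedSpace_of_convex (convex_ball _ _) ⟨_, hA0⟩
  let c : C(A, YY) := ⟨fun p => ⟨axisFun s p, hmem p p.2⟩,
    (hDc.comp_continuous continuous_subtype_val fun p => (hb p.2).1).subtype_mk _⟩
  let B : Set (ℂ × ℂ) := {p | p.1.re < Real.log r} ∩ {p | p.2 ∈ Metric.ball N r}
  have hBA : ∀ p ∈ B, (Complex.exp p.1, p.2) ∈ A := by
    rintro p ⟨hp, hp'⟩
    rw [Metric.mem_ball, Prod.dist_eq, max_lt_iff, dist_zero_right, Complex.norm_exp]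
    exact ⟨(Real.lt_log_iff_exp_lt hr).1 hp, hp'⟩
  have hBne : B.Nonempty := ⟨((Real.log r - 1 : ℝ), N), by simp only [Complex.ofReal_re, mem_ofPred_eq]; linarith, Metric.mem_ball_self hr⟩
  have hBc : Convex ℝ B := by
    refine Convex.inter ?_ ?_
    · exact convex_halfSpace_lt (f := fun p : ℂ × ℂ => p.1.re) ⟨fun _ _ => rfl, fun _ _ => by simp⟩ _
    · exact (convex_ball N r).is_linear_preimage (f := Prod.snd) ⟨fun _ _ => rfl, fun _ _ => rfl⟩
  have hB : SimplyConnectedSpace B := simplyConnectedSpace_of_convex hBc hBne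
  let j : C(B, A) := ⟨fun p => ⟨_, hBA p p.2⟩, by fun_prop⟩
  have hl : ∀ p : B, chartFun ((axisFun s (j p)).1, p.1.1) = axisFun s (j p) := by
    intro p
    have h3 := (hmem _ (j p).2).1
    refine Prod.ext rfl (Prod.ext rfl ?_)
    have hT := Complex.exp_ne_zero p.1.1
    simp only [chartFun]
    rw [div_eq_iff (by simp)]
    have e1 : (axisFun s (j p)).2.1 = Complex.exp p.1.1 := rfl
    rw [e1] at h3
    linear_combination h3
  let l : C(B, UU) := ⟨fun p => ⟨((axisFun s (j p)).1, p.1.1), chartFun_mem.1 (by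
    rw [hl]; exact hmem _ (j p).2)⟩, by
      have : Continuous fun p : B => axisFun s (j p) :=
        hDc.comp_continuous (by fun_prop) fun p => (hb (j p).2).1
      exact (this.fst.prodMk (by fun_prop)).subtype_mk _⟩
  have hlj : chart.comp l = c.comp j := by
    ext1 p
    exact Subtype.ext (hl p)
  have hlift : ∀ (p : UU) (a : A), chart p = c a → ∃ b, j b = a := by
    intro p a h
    have e1 : Complex.exp p.1.2 = a.1.1 := congrArg (fun z : YY => z.1.2.1) h
    have h4 := a.2
    rw [Metric.mem_ball, Prod.dist_eq, max_lt_iff, dist_zero_right, ← e1, Complex.norm_exp] at h4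
    exact ⟨⟨(p.1.2, a.1.2), (Real.lt_log_iff_exp_lt hr).2 h4.1, h4.2⟩,
      Subtype.ext (Prod.ext e1 rfl)⟩
  let k : ℝ → ℂ × ℂ := fun u => ((clamp u * (r / 2) : ℝ), N)
  have hk : ∀ u, k u ∈ A := by
    intro u
    have := clamp_mem u
    rw [Metric.mem_ball, Prod.dist_eq, max_lt_iff, dist_zero_right, Complex.norm_real,
      Real.norm_eq_abs, abs_of_nonneg (by nlinarith)]
    exact ⟨by nlinarith, by simpa [k] using hr⟩
  refine ⟨{ A := A, c := c
            K := {z | 0 < (s * z.1.1).re ∧ z.1.2 ∈ A}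
            isOpen := ?_
            self_mem := ⟨by simp [← sq, hs2], hA0⟩
            e := ⟨fun z => ⟨z.1.1.2, z.2.2⟩, by fun_prop⟩
            c_e := fun z => Subtype.ext (Prod.ext ?_ rfl)
            κ := ⟨fun u => ⟨k u, hk u⟩, ?_⟩
            κ_zero := ?_
            κ_lift := fun u hu => ?_
            coset := fun p q a b hp hq => ?_ }⟩
  · have c1 : Continuous fun z : YY => (s * z.1.1).re := by fun_prop
    have c2 : Continuous fun z : YY => z.1.2 := by fun_prop
    exact (isOpen_lt continuous_const c1).inter (Metric.isOpen_ball.preimage c2)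
  · have e2 : csq (1 + 4 * z.1.1.2.1 * z.1.1.2.2) = s * z.1.1.1 := by
      refine csq_eq (hb z.2.2).1 z.2.1 ?_
      linear_combination z.1.1.1 ^ 2 * hs2 + z.1.2.1
    change s * csq (1 + 4 * z.1.1.2.1 * z.1.1.2.2) = z.1.1.1
    rw [e2]
    linear_combination z.1.1.1 * hs2
  · have : Continuous k := by fun_prop
    exact this.subtype_mk _
  · refine Subtype.ext ?_
    have : k 0 = (0, N) := by simp [k, clamp_of_nonpos]
    change axisFun s (k 0) = _
    rw [this, h0]
  · have hu' : 0 < clamp u * (r / 2) := by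
      rw [clamp_of_mem hu.1.le hu.2]
      have := hu.1
      positivity
    have h5 : clamp u * (r / 2) < r := by nlinarith [clamp_mem u]
    let b : B := ⟨((Real.log (clamp u * (r / 2)) : ℝ), N), Real.log_lt_log hu' h5, Metric.mem_ball_self hr⟩
    refine ⟨l b, ?_⟩
    have : j b = ⟨k u, hk u⟩ := Subtype.ext (Prod.ext (by
      change Complex.exp ((Real.log (clamp u * (r / 2)) : ℝ) : ℂ) = _
      rw [← Complex.ofReal_exp, Real.exp_log hu']) rfl)
    rw [← ContinuousMap.comp_apply, hlj, ContinuousMap.comp_apply, this]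
    rfl
  · obtain ⟨b, rfl⟩ := hlift p _ hp
    obtain ⟨b', rfl⟩ := hlift q _ hq
    exact coset_of_lift h1 h2 j l hlj _ _ hp hq

/-- The base point of the surface. -/
def surfaceBase : YY := chart ⟨farBase, far_subset farBase_mem⟩

/-- The values on loops of a groupoid homomorphism on the surface. -/
theorem exists_loop_generators (Ψ : PathHom YY G) : ∃ x y : G, Commute x y ∧ x ^ 2 = y ^ 2 ∧
    ∀ r : Path.Homotopic.Quotient surfaceBase surfaceBase,
      Ψ.toFun r ∈ Subgroup.closure {x, y} := by
  obtain ⟨x, y, hc, hxy, v, hv, h1, h2⟩ := exists_coset_function Ψ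
  refine ⟨x, y, hc, hxy, fun r => ?_⟩
  have h3 : 1 ∈ surfaceValues Ψ v (Subgroup.closure {x, y}) surfaceBase := by
    refine ⟨ContinuousMap.const ℝ surfaceBase, rfl, fun u _ => ⟨_, rfl, ?_⟩⟩
    have h4 : Ψ.ev (ContinuousMap.const ℝ surfaceBase) 0 u = 1 := by
      have : ContinuousMap.const ℝ surfaceBase = (ContinuousMap.const ℝ surfaceBase).comp
          (ContinuousMap.const ℝ (0 : ℝ)) := rfl
      rw [this, Ψ.ev_comp]
      exact Ψ.ev_self _ _
    rwa [h4, inv_one, one_mul, one_mul]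
  have hL (z) : Nonempty (LocalChart Ψ v (Subgroup.closure {x, y}) z) := by
    by_cases hz : z.1.2.1 = 0
    · exact nonempty_localChart_of_eq h1 h2 hz
    · exact nonempty_localChart_of_ne h1 h2 hz
  simpa using toFun_mem_of_localChart hL r h3 h3

end

section

theorem exists_chart_eq {z : YY} (hz : z.1.2.1 ≠ 0) : ∃ p, chart p = z := by
  obtain ⟨⟨M, T, N⟩, h⟩ := z
  change T ≠ 0 at hz
  have h1 : chartFun (M, Complex.log T) = (M, T, N) := by
    have h2 : M ^ 2 - 4 * T * N = 1 := h.1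
    simp only [chartFun, Complex.exp_log hz]
    congr
    rw [div_eq_iff (by simpa using hz)]
    linear_combination h2
  exact ⟨⟨_, chartFun_mem.1 (h1 ▸ h)⟩, Subtype.ext h1⟩

theorem joined_chart (p : UU) : Joined (chart p) surfaceBase := by
  obtain ⟨q, hq, hj⟩ := exists_path_far p
  have h1 : Joined (⟨q, hq⟩ : Far) ⟨farBase, farBase_mem⟩ := PathConnectedSpace.joined _ _
  have h2 : Joined (chart q) surfaceBase :=
    h1.map (f := fun z : Far => chart ⟨z, far_subset z.2⟩)
      (chart.continuous.comp (continuous_subtype_val.subtype_mk _))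
  exact (hj.map chart.continuous).trans h2

theorem joined_surfaceBase (z : YY) : Joined z surfaceBase := by
  by_cases hz : z.1.2.1 = 0
  · let Ψ : PathHom YY Unit := ⟨fun _ => 1, fun _ _ => rfl⟩
    obtain ⟨L⟩ := nonempty_localChart_of_eq (Ψ := Ψ) (v := fun _ => 1) (S := ⊤)
      (fun _ _ _ => Subgroup.mem_top _) (fun _ _ _ => Subgroup.mem_top _) hz
    obtain ⟨p, hp⟩ := L.κ_lift 1 (by simp)
    have h1 : Joined (L.c (L.κ 0)) (L.c (L.κ 1)) :=
      (PathConnectedSpace.joined (0 : ℝ) 1).map (L.c.comp L.κ).continuous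
    rw [L.κ_zero, ← hp] at h1
    exact h1.trans (joined_chart p)
  · obtain ⟨p, rfl⟩ := exists_chart_eq hz
    exact joined_chart p

instance : PathConnectedSpace YY :=
  ⟨⟨surfaceBase⟩, fun x y => (joined_surfaceBase x).trans (joined_surfaceBase y).symm⟩

open Path.Homotopic in
/-- Homotopy classes of paths, closed up to loops at `x₀` by a choice of paths. -/
def PathHom.ofLoops {X : Type*} [TopologicalSpace X] {x₀ : X}
    (τ : ∀ x, Path.Homotopic.Quotient x₀ x) : PathHom X (FundamentalGroup X x₀)ᵐᵒᵖ where
  toFun {x y} p := .op (((τ x).trans p).trans (τ y).symm)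
  map_trans {x y z} p q := by
    rw [← MulOpposite.op_mul]
    congr 1
    change _ = Quotient.trans _ _
    simp only [Quotient.trans_assoc]
    congr 2
    rw [← Quotient.trans_assoc, Quotient.symm_trans, Quotient.refl_trans]

theorem exists_surface_generators : ∃ x y : FundamentalGroup YY surfaceBase,
    Commute x y ∧ x ^ 2 = y ^ 2 ∧ Subgroup.closure {x, y} = ⊤ := by
  classical
  let τ : ∀ x, Path.Homotopic.Quotient surfaceBase x := fun x =>
    if h : x = surfaceBase then (Path.Homotopic.Quotient.refl surfaceBase).cast rfl h
    else .mk (joined_surfaceBase x).symm.some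
  have hτ : τ surfaceBase = .refl surfaceBase := by
    simp only [τ, dif_pos]
    rfl
  obtain ⟨x, y, hc, hxy, h⟩ := exists_loop_generators (.ofLoops τ)
  refine ⟨x.unop, y.unop, hc.unop, congrArg MulOpposite.unop hxy, eq_top_iff.2 fun g _ => ?_⟩
  have h1 := h g
  have h2 : (PathHom.ofLoops τ).toFun g = .op g := by
    change MulOpposite.op (((τ surfaceBase).trans g).trans (τ surfaceBase).symm) = _
    rw [hτ, Path.Homotopic.Quotient.refl_trans]
    exact congrArg MulOpposite.op (Path.Homotopic.Quotient.trans_refl g)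
  rw [h2] at h1
  have h3 : ∀ w ∈ Subgroup.closure {x, y}, w.unop ∈ Subgroup.closure {x.unop, y.unop} := by
    intro w hw
    induction hw using Subgroup.closure_induction with
    | mem w hw =>
      rcases hw with rfl | rfl <;> exact Subgroup.subset_closure (by simp)
    | one => exact one_mem _
    | mul a b _ _ ha hb => exact mul_mem hb ha
    | inv a _ ha => exact inv_mem ha
  exact h3 _ h1

end

section

theorem exists_zpow_mul_zpow {A : Type*} [Group A] {P Q g : A} (hc : Commute P Q)
    (hg : g ∈ Subgroup.closure {P, Q}) : ∃ m n : ℤ, g = P ^ m * Q ^ n := by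
  induction hg using Subgroup.closure_induction with
  | mem w hw =>
    rcases hw with rfl | rfl
    · exact ⟨1, 0, by simp⟩
    · exact ⟨0, 1, by simp⟩
  | one => exact ⟨0, 0, by simp⟩
  | mul a b _ _ ha hb =>
    obtain ⟨m, n, rfl⟩ := ha
    obtain ⟨k, l, rfl⟩ := hb
    exact ⟨m + k, n + l, by
      rw [zpow_add, zpow_add, mul_assoc, mul_assoc, ← mul_assoc (Q ^ n),
        ← (hc.zpow_zpow k n).eq, mul_assoc]⟩
  | inv a _ ha =>
    obtain ⟨m, n, rfl⟩ := ha
    exact ⟨-m, -n, by rw [mul_inv_rev, zpow_neg, zpow_neg, (hc.zpow_zpow m n).inv_inv.eq]⟩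

theorem injective_of_commuting_generators {A Γ : Type*} [Group A] [Group Γ] {P Q : A}
    (hc : Commute P Q) (hPQ : P ^ 2 = Q ^ 2) (hcl : Subgroup.closure {P, Q} = ⊤) (ψ : A →* Γ)
    {a z : Γ} (ha : ∀ n : ℤ, a ^ n = 1 → n = 0) (hz : z ^ 2 = 1) (hz1 : z ≠ 1)
    (hra : a ∈ ψ.range) (hrz : z ∈ ψ.range) : Function.Injective ψ := by
  have hsq (m n : ℤ) : (P ^ m * Q ^ n) ^ 2 = P ^ (2 * (m + n)) := by
    rw [(hc.zpow_zpow m n).mul_pow, ← zpow_natCast (P ^ m), ← zpow_natCast (Q ^ n), ← zpow_mul,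
      ← zpow_mul, mul_comm n, zpow_mul Q, Nat.cast_ofNat, zpow_ofNat Q, ← hPQ, ← zpow_ofNat P,
      ← zpow_mul, ← zpow_add]
    congr 1
    ring
  have hform (g : A) : ∃ m n : ℤ, g = P ^ m * Q ^ n :=
    exists_zpow_mul_zpow hc (hcl ▸ Subgroup.mem_top g)
  have hP (n : ℤ) (h : ψ P ^ (2 * n) = 1) : n = 0 := by
    obtain ⟨g, rfl⟩ := hra
    obtain ⟨k, l, rfl⟩ := hform g
    have h1 : ψ (P ^ k * Q ^ l) ^ (2 * n) = 1 := by
      rw [zpow_mul, zpow_ofNat, ← map_pow, hsq, map_zpow, ← zpow_mul, mul_right_comm, zpow_mul, h,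
        one_zpow]
    simpa using ha _ h1
  have hPQi (n : ℤ) : (P ^ n * Q ^ (-n)) = (P * Q⁻¹) ^ n := by
    rw [hc.inv_right.mul_zpow, inv_zpow, zpow_neg]
  have hW2 : (P * Q⁻¹) ^ (2 : ℤ) = 1 := by
    rw [← hPQi, zpow_neg, zpow_ofNat, zpow_ofNat, hPQ, mul_inv_cancel]
  have hW : ψ (P * Q⁻¹) ≠ 1 := by
    intro hW
    obtain ⟨g, rfl⟩ := hrz
    obtain ⟨k, l, rfl⟩ := hform g
    have h1 := hP (k + l) (by rw [← map_zpow, ← hsq, map_pow, hz])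
    obtain rfl : l = -k := by omega
    apply hz1
    rw [hPQi, map_zpow, hW, one_zpow]
  refine (injective_iff_map_eq_one ψ).2 fun g hg => ?_
  obtain ⟨k, l, rfl⟩ := hform g
  have h1 := hP (k + l) (by rw [← map_zpow, ← hsq, map_pow, hg, one_pow])
  obtain rfl : l = -k := by omega
  rw [hPQi] at hg ⊢
  obtain ⟨j, rfl | rfl⟩ := Int.even_or_odd' k
  · rw [zpow_mul, hW2, one_zpow]
  · rw [zpow_add, zpow_mul, hW2, one_zpow, one_mul, zpow_one] at hg
    exact absurd hg hW

theorem simplyConnectedSpace_of_factor {E X Y Γ : Type*} [TopologicalSpace E] [TopologicalSpace X]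
    [TopologicalSpace Y] [PathConnectedSpace E] [Group Γ] [MulAction Γ E] {q : E → X}
    (hq : IsQuotientCoveringMap q Γ) (r : C(E, Y)) (s : C(Y, X)) (hqs : ∀ e, q e = s (r e))
    {e₀ : E} {P Q : FundamentalGroup Y (r e₀)} (hc : Commute P Q) (hPQ : P ^ 2 = Q ^ 2)
    (hcl : Subgroup.closure {P, Q} = ⊤) {a z : Γ} (ha : ∀ n : ℤ, a ^ n = 1 → n = 0)
    (hz : z ^ 2 = 1) (hz1 : z ≠ 1) (hra : r (a • e₀) = r e₀) (hrz : r (z • e₀) = r e₀) :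
    SimplyConnectedSpace E := by
  obtain rfl : q = s ∘ r := funext hqs
  let ψ : FundamentalGroup Y (r e₀) →* Γᵐᵒᵖ :=
    (hq.fundamentalGroupToMulOpposite ⟨e₀, hqs e₀⟩).comp (FundamentalGroup.map s (r e₀))
  have hmem : ∀ g : Γ, r (g • e₀) = r e₀ → MulOpposite.op g ∈ ψ.range := by
    intro g hg
    let γ : Path e₀ (g • e₀) := PathConnectedSpace.somePath _ _
    refine ⟨.mk ((γ.map r.continuous).cast rfl hg.symm), ?_⟩
    refine hq.fundamentalGroupToMulOpposite_apply_eq_Iff.2 ?_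
    have h := hq.isCoveringMap.monodromy_eq_of_map_eq
      (γ := FundamentalGroup.map s (r e₀) (.mk ((γ.map r.continuous).cast rfl hg.symm)))
      (ex := ⟨e₀, hqs e₀⟩) (ey := ⟨g • e₀, by rw [Set.mem_preimage, hqs, hg]; rfl⟩) (.mk γ) ?_
    · exact (congrArg Subtype.val h).symm
    · refine congrArg Path.Homotopic.Quotient.mk (Path.ext (funext fun t => ?_))
      exact hqs _
  have hinj : Function.Injective ψ := injective_of_commuting_generators hc hPQ hcl ψ
    (a := .op a) (z := .op z) (fun n hn => ha n (MulOpposite.op_injective (by simpa using hn)))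
    (by rw [← MulOpposite.op_pow, hz]; rfl) (fun h => hz1 (MulOpposite.op_injective h))
    (hmem a hra) (hmem z hrz)
  have hsub : Subsingleton (FundamentalGroup E e₀) := by
    refine ⟨fun g g' => ?_⟩
    suffices h : ∀ g : FundamentalGroup E e₀, g = 1 from (h g).trans (h g').symm
    intro g
    have h1 : FundamentalGroup.map r e₀ g = 1 := by
      apply hinj
      rw [map_one]
      refine hq.fundamentalGroupToMulOpposite_apply_eq_Iff.2 ?_
      have h := hq.isCoveringMap.monodromy_eq_of_map_eq
        (γ := FundamentalGroup.map s (r e₀) (FundamentalGroup.map r e₀ g))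
        (ex := ⟨e₀, hqs e₀⟩) (ey := ⟨e₀, hqs e₀⟩) g ?_
      · rw [MulOpposite.unop_one, one_smul]
        exact (congrArg Subtype.val h).symm
      · obtain ⟨γ, rfl⟩ := Path.Homotopic.Quotient.mk_surjective g
        exact congrArg Path.Homotopic.Quotient.mk (Path.ext (funext fun t => hqs _))
    refine hq.isCoveringMap.injective_path_homotopic_map e₀ e₀ ?_
    obtain ⟨γ, rfl⟩ := Path.Homotopic.Quotient.mk_surjective g
    exact congrArg (FundamentalGroup.map s (r e₀)) h1
  rw [simply_connected_iff_loops_nullhomotopic]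
  refine ⟨inferInstance, fun x γ => ?_⟩
  have h2 : Subsingleton (FundamentalGroup E x) :=
    (FundamentalGroup.fundamentalGroupMulEquivOfPathConnected x e₀).toEquiv.subsingleton
  exact Path.Homotopic.Quotient.exact (h2.elim (Path.Homotopic.Quotient.mk γ) (.mk (.refl x)))

end

section

theorem commute_sq {G : Type*} [Group G] {a t : G} (h : a * t * a⁻¹ = t⁻¹) :
    Commute (a ^ 2) t := by
  have h1 : a ^ 2 * t * (a ^ 2)⁻¹ = (a * t * a⁻¹)⁻¹ := by
    rw [conj_inv, ← h, pow_two]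
    group
  rw [h, inv_inv] at h1
  exact mul_inv_eq_iff_eq_mul.1 h1

/-- The generator `a` of `G₁`. -/
def genA : G1 := PresentedGroup.of 0

/-- The element `a²b` of `G₁`. -/
def genT : G1 := genA ^ 2 * PresentedGroup.of 1

theorem genA_mul_genT : genA * genT * genA⁻¹ = genT⁻¹ := by
  have h : (PresentedGroup.mk rels1) (ga ^ 2 * (ga * gb) ^ 2) = 1 :=
    PresentedGroup.one_of_mem (by simp [rels1])
  have h1 : genA ^ 2 * (genA * PresentedGroup.of 1) ^ 2 = 1 := h
  rw [eq_inv_iff_mul_eq_one, genT, ← h1, pow_two (genA * _)]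
  group

theorem genA_conj_zpow (j : ℤ) : genA * genT ^ j * genA⁻¹ = genT ^ (-j) := by
  rw [← conj_zpow, genA_mul_genT, inv_zpow, zpow_neg]

theorem genT_pow_four : genT ^ 4 = 1 := by
  have h : (PresentedGroup.mk rels1) (ga * gb ^ 2 * ga⁻¹ * (gb ^ 2)⁻¹) = 1 :=
    PresentedGroup.one_of_mem (by simp [rels1])
  have h1 : genA * PresentedGroup.of 1 ^ 2 * genA⁻¹ * (PresentedGroup.of 1 ^ 2)⁻¹ = (1 : G1) := h
  have h2 : (PresentedGroup.of 1 : G1) ^ 2 = genA ^ (-4 : ℤ) * genT ^ (2 : ℤ) := by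
    have h3 : (PresentedGroup.of 1 : G1) = (genA ^ 2)⁻¹ * genT := by
      rw [genT, inv_mul_cancel_left]
    rw [h3, (commute_sq genA_mul_genT).inv_left.mul_pow]
    group
  have h4 : genA * (genA ^ (-4 : ℤ) * genT ^ (2 : ℤ)) * genA⁻¹ =
      genA ^ (-4 : ℤ) * genT ^ (-2 : ℤ) := by
    rw [← genA_conj_zpow]
    group
  rw [h2, h4, mul_inv_eq_one, mul_right_inj] at h1
  calc genT ^ 4 = genT ^ (2 : ℤ) * genT ^ (2 : ℤ) := by group
    _ = 1 := by
      nth_rewrite 1 [← h1]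
      group

theorem exists_normalForm (g : G1) : ∃ j n : ℤ, g = genT ^ j * genA ^ n := by
  have hswap (n : ℤ) : ∀ j : ℤ, ∃ k : ℤ, genA ^ n * genT ^ j = genT ^ k * genA ^ n := by
    induction n with
    | zero => exact fun j => ⟨j, by simp⟩
    | succ n ih =>
      intro j
      obtain ⟨k, hk⟩ := ih (-j)
      refine ⟨k, ?_⟩
      rw [zpow_add_one, mul_assoc, mul_inv_eq_iff_eq_mul.1 (genA_conj_zpow j), ← mul_assoc, hk,
        mul_assoc]
    | pred n ih =>
      intro j
      obtain ⟨k, hk⟩ := ih (-j)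
      refine ⟨k, ?_⟩
      have h := mul_inv_eq_iff_eq_mul.1 (genA_conj_zpow (-j))
      rw [neg_neg] at h
      rw [zpow_sub_one, mul_assoc, ← mul_assoc (genT ^ k), ← hk, mul_assoc]
      congr 1
      rw [inv_mul_eq_iff_eq_mul, ← mul_assoc, h, mul_inv_cancel_right]
  have hg : g ∈ Subgroup.closure (Set.range (PresentedGroup.of : Fin 2 → G1)) := by
    rw [PresentedGroup.closure_range_of]
    trivial
  have hmul : ∀ x y : G1, (∃ j n : ℤ, x = genT ^ j * genA ^ n) →
      (∃ j n : ℤ, y = genT ^ j * genA ^ n) → ∃ j n : ℤ, x * y = genT ^ j * genA ^ n := by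
    rintro _ _ ⟨j, n, rfl⟩ ⟨k, m, rfl⟩
    obtain ⟨l, hl⟩ := hswap n k
    exact ⟨j + l, n + m, by
      rw [mul_assoc, ← mul_assoc (genA ^ n), hl, zpow_add, zpow_add]
      group⟩
  have hinv : ∀ x : G1, (∃ j n : ℤ, x = genT ^ j * genA ^ n) →
      ∃ j n : ℤ, x⁻¹ = genT ^ j * genA ^ n := by
    rintro _ ⟨j, n, rfl⟩
    obtain ⟨k, hk⟩ := hswap (-n) (-j)
    exact ⟨k, -n, by rw [← hk, mul_inv_rev, zpow_neg, zpow_neg]⟩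
  have hA : ∃ j n : ℤ, genA = genT ^ j * genA ^ n := ⟨0, 1, by simp⟩
  induction hg using Subgroup.closure_induction with
  | mem x hx =>
    obtain ⟨i, rfl⟩ := hx
    fin_cases i
    · exact hA
    · obtain h : (PresentedGroup.of 1 : G1) = (genA * genA)⁻¹ * genT := by
        rw [genT, pow_two, inv_mul_cancel_left]
      exact h ▸ hmul _ _ (hinv _ (hmul _ _ hA hA)) ⟨1, 0, by simp⟩
  | one => exact ⟨0, 0, by simp⟩
  | mul x y _ _ hx hy => exact hmul x y hx hy
  | inv x _ hx => exact hinv x hx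

/-- Two elements subject to the relations of `G₁` define a homomorphism. -/
def liftG1 {G : Type*} [Group G] (a t : G) (h1 : a * t * a⁻¹ = t⁻¹) (h2 : t ^ 4 = 1) : G1 →* G :=
  PresentedGroup.toGroup (f := ![a, (a ^ 2)⁻¹ * t]) (by
    have h3 : (a ^ 2)⁻¹ * t * ((a ^ 2)⁻¹ * t) = (a ^ 4)⁻¹ * t ^ 2 := by
      rw [← pow_two, (commute_sq h1).inv_left.mul_pow]
      group
    rintro r (rfl | rfl)
    · simp only [ga, gb, map_mul, map_pow, FreeGroup.lift_apply_of, Matrix.cons_val_zero,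
        Matrix.cons_val_one]
      calc _ = a * t * a⁻¹ * t := by
            rw [pow_two (a * _)]
            group
        _ = 1 := by rw [h1, inv_mul_cancel]
    · simp only [ga, gb, map_mul, map_pow, map_inv, FreeGroup.lift_apply_of, Matrix.cons_val_zero,
        Matrix.cons_val_one]
      rw [pow_two (_ * t), h3]
      calc _ = (a ^ 4)⁻¹ * ((a * t * a⁻¹) ^ 2 * (t ^ 2)⁻¹) * a ^ 4 := by
            rw [conj_pow]
            group
        _ = (a ^ 4)⁻¹ * (t ^ 4)⁻¹ * a ^ 4 := by
            rw [h1]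
            group
        _ = 1 := by
            rw [h2]
            group)

theorem liftG1_genA {G : Type*} [Group G] {a t : G} (h1 : a * t * a⁻¹ = t⁻¹) (h2 : t ^ 4 = 1) :
    liftG1 a t h1 h2 genA = a := by
  simp [liftG1, genA]

theorem liftG1_genT {G : Type*} [Group G] {a t : G} (h1 : a * t * a⁻¹ = t⁻¹) (h2 : t ^ 4 = 1) :
    liftG1 a t h1 h2 genT = t := by
  simp [liftG1, genT, genA]

end

section

/-- The quadratic-plus-quartic form whose logarithm is adjoined. -/
def ll (x y w : ℂ) : ℂ := x ^ 2 - 3 / 4 * y ^ 2 + y ^ 3 * w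

/-- Matrices `(α β; γ δ)` of determinant one with a common logarithm `τ` of the two forms, listed
as `(α, γ, β, δ, τ)`. -/
def EE : Set (ℂ × ℂ × ℂ × ℂ × ℂ) :=
  {p | p.1 * p.2.2.2.1 - p.2.2.1 * p.2.1 = 1 ∧ ll p.1 p.2.1 p.2.2.2.1 = Complex.exp p.2.2.2.2 ∧
    ll p.2.2.1 p.2.2.2.1 (-p.2.1) = Complex.exp p.2.2.2.2}

theorem mem_EE {α γ β δ τ : ℂ} : (α, γ, β, δ, τ) ∈ EE ↔ α * δ - β * γ = 1 ∧
    ll α γ δ = Complex.exp τ ∧ ll β δ (-γ) = Complex.exp τ := Iff.rfl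

/-- The homeomorphism of a subset of a space given by mutually inverse continuous maps. -/
def subtypeHomeo {V : Type*} [TopologicalSpace V] {S : Set V} (f g : C(V, V))
    (hf : ∀ x ∈ S, f x ∈ S) (hg : ∀ x ∈ S, g x ∈ S) (hgf : ∀ x, g (f x) = x)
    (hfg : ∀ x, f (g x) = x) : S ≃ₜ S where
  toFun x := ⟨f x, hf x x.2⟩
  invFun x := ⟨g x, hg x x.2⟩
  left_inv x := Subtype.ext (hgf x)
  right_inv x := Subtype.ext (hfg x)

theorem exp_pi_add (τ : ℂ) : Complex.exp (τ + Real.pi * Complex.I) = -Complex.exp τ := by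
  rw [Complex.exp_add, Complex.exp_pi_mul_I, mul_neg_one]

/-- The deck transformation of `EE` exchanging the two columns. -/
def homeoT : EE ≃ₜ EE :=
  subtypeHomeo ⟨fun p => (p.2.2.1, p.2.2.2.1, -p.1, -p.2.1, p.2.2.2.2), by fun_prop⟩
    ⟨fun p => (-p.2.2.1, -p.2.2.2.1, p.1, p.2.1, p.2.2.2.2), by fun_prop⟩
    (fun ⟨α, γ, β, δ, τ⟩ h => by
      obtain ⟨h1, h2, h3⟩ := mem_EE.1 h
      refine mem_EE.2 ⟨?_, h3, ?_⟩
      · linear_combination h1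
      · rw [← h2]
        simp only [ll]
        ring)
    (fun ⟨α, γ, β, δ, τ⟩ h => by
      obtain ⟨h1, h2, h3⟩ := mem_EE.1 h
      refine mem_EE.2 ⟨?_, ?_, ?_⟩
      · linear_combination h1
      · rw [← h3]
        simp only [ll]
        ring
      · simpa using h2)
    (fun _ => by simp) (fun _ => by simp)

/-- The deck transformation of `EE` adding `πi` to the logarithm. -/
def homeoA : EE ≃ₜ EE :=
  subtypeHomeo
    ⟨fun p => (Complex.I * p.1, Complex.I * p.2.1, -(Complex.I * p.2.2.1),
      -(Complex.I * p.2.2.2.1), p.2.2.2.2 + Real.pi * Complex.I), by fun_prop⟩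
    ⟨fun p => (-(Complex.I * p.1), -(Complex.I * p.2.1), Complex.I * p.2.2.1,
      Complex.I * p.2.2.2.1, p.2.2.2.2 - Real.pi * Complex.I), by fun_prop⟩
    (fun ⟨α, γ, β, δ, τ⟩ h => by
      obtain ⟨h1, h2, h3⟩ := mem_EE.1 h
      have hI := Complex.I_sq
      refine mem_EE.2 ⟨?_, ?_, ?_⟩
      · change Complex.I * α * -(Complex.I * δ) - -(Complex.I * β) * (Complex.I * γ) = 1
        linear_combination h1 - (α * δ - β * γ) * hI
      · change ll (Complex.I * α) (Complex.I * γ) (-(Complex.I * δ)) = Complex.exp (τ + _)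
        rw [exp_pi_add, ← h2]
        simp only [ll]
        linear_combination (α ^ 2 - 3 / 4 * γ ^ 2 - γ ^ 3 * δ * (Complex.I ^ 2 - 1)) * hI
      · change ll (-(Complex.I * β)) (-(Complex.I * δ)) (-(Complex.I * γ)) = Complex.exp (τ + _)
        rw [exp_pi_add, ← h3]
        simp only [ll]
        linear_combination (β ^ 2 - 3 / 4 * δ ^ 2 + δ ^ 3 * γ * (Complex.I ^ 2 - 1)) * hI)
    (fun ⟨α, γ, β, δ, τ⟩ h => by
      obtain ⟨h1, h2, h3⟩ := mem_EE.1 h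
      have hI := Complex.I_sq
      have hexp : Complex.exp (τ - Real.pi * Complex.I) = -Complex.exp τ := by
        rw [← neg_eq_iff_eq_neg, ← exp_pi_add, sub_add_cancel]
      refine mem_EE.2 ⟨?_, ?_, ?_⟩
      · change -(Complex.I * α) * (Complex.I * δ) - Complex.I * β * -(Complex.I * γ) = 1
        linear_combination h1 - (α * δ - β * γ) * hI
      · change ll (-(Complex.I * α)) (-(Complex.I * γ)) (Complex.I * δ) = Complex.exp (τ - _)
        rw [hexp, ← h2]
        simp only [ll]
        linear_combination (α ^ 2 - 3 / 4 * γ ^ 2 - γ ^ 3 * δ * (Complex.I ^ 2 - 1)) * hI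
      · change ll (Complex.I * β) (Complex.I * δ) (- -(Complex.I * γ)) = Complex.exp (τ - _)
        rw [hexp, ← h3]
        simp only [ll]
        linear_combination (β ^ 2 - 3 / 4 * δ ^ 2 + δ ^ 3 * γ * (Complex.I ^ 2 - 1)) * hI)
    (fun _ => by simp [← mul_assoc]) (fun _ => by simp [← mul_assoc])

theorem coe_homeoT (e : EE) : (homeoT e : ℂ × ℂ × ℂ × ℂ × ℂ) =
    (e.1.2.2.1, e.1.2.2.2.1, -e.1.1, -e.1.2.1, e.1.2.2.2.2) := rfl

theorem coe_homeoA (e : EE) : (homeoA e : ℂ × ℂ × ℂ × ℂ × ℂ) =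
    (Complex.I * e.1.1, Complex.I * e.1.2.1, -(Complex.I * e.1.2.2.1),
      -(Complex.I * e.1.2.2.2.1), e.1.2.2.2.2 + Real.pi * Complex.I) := rfl

theorem homeoA_mul_homeoT : homeoA * homeoT * homeoA⁻¹ = homeoT⁻¹ := by
  rw [mul_inv_eq_iff_eq_mul, eq_inv_mul_iff_mul_eq]
  ext e : 2
  simp [coe_homeoA, coe_homeoT]

theorem homeoT_pow_four : homeoT ^ 4 = 1 := by
  ext e : 2
  simp [pow_succ, coe_homeoT]

/-- The action of `G₁` on `EE`. -/
def actG1 : G1 →* (EE ≃ₜ EE) := liftG1 homeoA homeoT homeoA_mul_homeoT homeoT_pow_four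

instance : MulAction G1 EE where
  smul g e := actG1 g e
  one_smul e := by
    change actG1 1 e = e
    rw [map_one, Homeomorph.one_apply]
  mul_smul g h e := by
    change actG1 (g * h) e = actG1 g (actG1 h e)
    rw [map_mul, Homeomorph.mul_apply]

instance : ContinuousConstSMul G1 EE :=
  ⟨fun g => (actG1 g).continuous⟩

theorem coe_genT_smul (e : EE) : ((genT • e : EE) : ℂ × ℂ × ℂ × ℂ × ℂ) =
    (e.1.2.2.1, e.1.2.2.2.1, -e.1.1, -e.1.2.1, e.1.2.2.2.2) := by
  rw [← coe_homeoT]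
  change (actG1 genT e).1 = _
  rw [actG1, liftG1_genT]

theorem coe_genA_smul (e : EE) : ((genA • e : EE) : ℂ × ℂ × ℂ × ℂ × ℂ) =
    (Complex.I * e.1.1, Complex.I * e.1.2.1, -(Complex.I * e.1.2.2.1),
      -(Complex.I * e.1.2.2.2.1), e.1.2.2.2.2 + Real.pi * Complex.I) := by
  rw [← coe_homeoA]
  change (actG1 genA e).1 = _
  rw [actG1, liftG1_genA]

end

section

theorem ll_mul_ll {α β γ δ : ℂ} (h : α * δ - β * γ = 1) :
    16 * (ll α γ δ * ll β δ (-γ)) = QQ (α * δ + β * γ, γ * δ, α * β) := by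
  simp only [ll, QQ]
  linear_combination (-6 * (α * δ - β * γ + 1) - 16 * (γ * δ) * (α * δ + β * γ)) * h

theorem ll_smul {c : ℂ} (hc : c ≠ 0) (x y w : ℂ) : ll (c * x) (c * y) (w / c) = c ^ 2 * ll x y w := by
  simp only [ll]
  field_simp

/-- The invariants of the diagonal torus on two-by-two matrices. -/
def rFun (p : ℂ × ℂ × ℂ × ℂ × ℂ) : ℂ × ℂ × ℂ :=
  (p.1 * p.2.2.2.1 + p.2.2.1 * p.2.1, p.2.1 * p.2.2.2.1, p.1 * p.2.2.1)

theorem continuous_rFun : Continuous rFun := by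
  unfold rFun
  fun_prop

theorem rFun_mem (e : EE) : rFun e ∈ YY := by
  obtain ⟨⟨α, γ, β, δ, τ⟩, h⟩ := e
  obtain ⟨h1, h2, h3⟩ := mem_EE.1 h
  refine ⟨?_, ?_⟩
  · simp only [rFun]
    linear_combination (α * δ - β * γ + 1) * h1
  · rw [show QQ (rFun (α, γ, β, δ, τ)) = _ from (ll_mul_ll h1).symm, h2, h3]
    simp [Complex.exp_ne_zero]

/-- The map from `EE` to the surface. -/
def rMap : C(EE, YY) :=
  ⟨fun e => ⟨rFun e, rFun_mem e⟩, (continuous_rFun.comp continuous_subtype_val).subtype_mk _⟩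

theorem rFun_genA_smul (e : EE) : rFun (genA • e : EE) = rFun e := by
  have hI := Complex.I_sq
  simp only [coe_genA_smul, rFun, Prod.mk.injEq]
  refine ⟨?_, ?_, ?_⟩
  · linear_combination -(e.1.1 * e.1.2.2.2.1 + e.1.2.2.1 * e.1.2.1) * hI
  · linear_combination -(e.1.2.1 * e.1.2.2.2.1) * hI
  · linear_combination -(e.1.1 * e.1.2.2.1) * hI

theorem rFun_genT_smul (e : EE) : rFun (genT • e : EE) = -rFun e := by
  simp only [coe_genT_smul, rFun, Prod.neg_mk, Prod.mk.injEq]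
  refine ⟨?_, ?_, ?_⟩ <;> ring

theorem coe_genT_sq_smul (e : EE) : ((genT ^ 2 • e : EE) : ℂ × ℂ × ℂ × ℂ × ℂ) =
    (-e.1.1, -e.1.2.1, -e.1.2.2.1, -e.1.2.2.2.1, e.1.2.2.2.2) := by
  rw [pow_two, mul_smul, coe_genT_smul, coe_genT_smul]

theorem apply_zpow_smul (f : EE → ℂ) {g : G1} {c : ℂ} (h : ∀ e : EE, f (g • e) = f e + c) (n : ℤ)
    (e : EE) : f (g ^ n • e) = f e + n * c := by
  induction n with
  | zero => simp
  | succ n ih =>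
    rw [zpow_add_one, (Commute.refl g).zpow_left n |>.eq, mul_smul, h, ih]
    push_cast
    ring
  | pred n ih =>
    have h1 := h (g ^ (-(n : ℤ) - 1) • e)
    rw [← mul_smul, ← zpow_one_add, add_sub_cancel, ih] at h1
    rw [← sub_eq_iff_eq_add.2 h1]
    push_cast
    ring

theorem tau_normalForm_smul (j n : ℤ) (e : EE) :
    ((genT ^ j * genA ^ n) • e : EE).1.2.2.2.2 = e.1.2.2.2.2 + n * (Real.pi * Complex.I) := by
  rw [mul_smul, apply_zpow_smul (fun e => e.1.2.2.2.2) (c := 0)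
      (fun e => by rw [coe_genT_smul, add_zero]),
    apply_zpow_smul (fun e => e.1.2.2.2.2) (c := Real.pi * Complex.I)
      (fun e => by rw [coe_genA_smul]), mul_zero, add_zero]

theorem mem_orbit_of_matrix_eq {e e' : EE} (h1 : e'.1.1 = e.1.1) (h2 : e'.1.2.1 = e.1.2.1)
    (h3 : e'.1.2.2.1 = e.1.2.2.1) (h4 : e'.1.2.2.2.1 = e.1.2.2.2.1) :
    e' ∈ MulAction.orbit G1 e := by
  have hexp : Complex.exp e'.1.2.2.2.2 = Complex.exp e.1.2.2.2.2 := by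
    rw [← e.2.2.1, ← e'.2.2.1, h1, h2, h4]
  obtain ⟨n, hn⟩ := Complex.exp_eq_exp_iff_exists_int.1 hexp
  have hu (e : EE) : ((genT ^ 2 * genA ^ 2) • e : EE).1 = (e.1.1, e.1.2.1, e.1.2.2.1,
      e.1.2.2.2.1, e.1.2.2.2.2 + 2 * Real.pi * Complex.I) := by
    rw [mul_smul, coe_genT_sq_smul, pow_two genA, mul_smul, coe_genA_smul, coe_genA_smul]
    simp only [Prod.mk.injEq]
    refine ⟨?_, ?_, ?_, ?_, ?_⟩
    · linear_combination -e.1.1 * Complex.I_sq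
    · linear_combination -e.1.2.1 * Complex.I_sq
    · linear_combination -e.1.2.2.1 * Complex.I_sq
    · linear_combination -e.1.2.2.2.1 * Complex.I_sq
    · ring
  refine ⟨(genT ^ 2 * genA ^ 2) ^ n, Subtype.ext (Prod.ext ?_ (Prod.ext ?_ (Prod.ext ?_
    (Prod.ext ?_ ?_))))⟩
  · exact (apply_zpow_smul (fun e => e.1.1) (c := 0) (fun e => by simp [hu]) n e).trans (by simp [h1])
  · exact (apply_zpow_smul (fun e => e.1.2.1) (c := 0) (fun e => by simp [hu]) n e).trans
      (by simp [h2])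
  · exact (apply_zpow_smul (fun e => e.1.2.2.1) (c := 0) (fun e => by simp [hu]) n e).trans
      (by simp [h3])
  · exact (apply_zpow_smul (fun e => e.1.2.2.2.1) (c := 0) (fun e => by simp [hu]) n e).trans
      (by simp [h4])
  · exact (apply_zpow_smul (fun e => e.1.2.2.2.2) (fun e => by rw [hu]) n e).trans hn.symm

theorem mem_orbit_of_scale_eq {e e' : EE} {c : ℂ} (h1 : e'.1.1 = c * e.1.1)
    (h2 : e'.1.2.1 = c * e.1.2.1) (h3 : c * e'.1.2.2.1 = e.1.2.2.1)
    (h4 : c * e'.1.2.2.2.1 = e.1.2.2.2.1) : e' ∈ MulAction.orbit G1 e := by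
  have key (g : G1) (h : e' ∈ MulAction.orbit G1 (g • e)) : e' ∈ MulAction.orbit G1 e := by
    rwa [MulAction.orbit_smul] at h
  have hc : c ^ 4 = 1 := by
    clear key
    obtain ⟨⟨α, γ, β, δ, τ⟩, he⟩ := e
    obtain ⟨⟨α', γ', β', δ', τ'⟩, he'⟩ := e'
    dsimp only at h1 h2 h3 h4
    obtain ⟨-, h6, h7⟩ := mem_EE.1 he
    obtain ⟨h8, h9, h10⟩ := mem_EE.1 he'
    rw [← h4, ← h6] at h7
    rw [h1, h2] at h9
    rw [← h9, h2] at h10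
    rw [← h3, ← h4] at h7
    simp only [ll] at h6 h7 h9 h10
    have h13 := Complex.exp_ne_zero τ
    apply mul_right_cancel₀ h13
    rw [← h6, ← h4]
    linear_combination h7 - c ^ 2 * h10
  have hc0 : c ≠ 0 := by
    rintro rfl
    norm_num at hc
  replace h3 : e'.1.2.2.1 = c⁻¹ * e.1.2.2.1 := by rw [← h3, inv_mul_cancel_left₀ hc0]
  replace h4 : e'.1.2.2.2.1 = c⁻¹ * e.1.2.2.2.1 := by rw [← h4, inv_mul_cancel_left₀ hc0]
  have hI := Complex.I_sq
  have h5 : (c - 1) * (c + 1) * ((c - Complex.I) * (c + Complex.I)) = 0 := by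
    linear_combination hc - (c ^ 2 - 1) * hI
  simp only [mul_eq_zero, sub_eq_zero, add_eq_zero_iff_eq_neg] at h5
  rcases h5 with (rfl | rfl) | (rfl | rfl)
  · exact mem_orbit_of_matrix_eq (by simpa using h1) (by simpa using h2) (by simpa using h3)
      (by simpa using h4)
  · refine key (genT ^ 2) (mem_orbit_of_matrix_eq ?_ ?_ ?_ ?_) <;>
      simp [coe_genT_sq_smul, h1, h2, h3, h4, inv_neg]
  · refine key genA (mem_orbit_of_matrix_eq ?_ ?_ ?_ ?_) <;>
      simp [coe_genA_smul, h1, h2, h3, h4]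
  · refine key (genT ^ 2 * genA) (mem_orbit_of_matrix_eq ?_ ?_ ?_ ?_) <;>
      simp [mul_smul, coe_genT_sq_smul, coe_genA_smul, h1, h2, h3, h4, inv_neg]

theorem mem_orbit_of_rFun_eq {e e' : EE} (h : rFun e' = rFun e) :
    e' ∈ MulAction.orbit G1 e := by
  have main {e e' : EE} (h : rFun e' = rFun e) (h0 : e.1.1 * e.1.2.2.2.1 ≠ 0) :
      e' ∈ MulAction.orbit G1 e := by
    obtain ⟨⟨α, γ, β, δ, τ⟩, he⟩ := e
    obtain ⟨⟨α', γ', β', δ', τ'⟩, he'⟩ := e'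
    obtain ⟨h1, -, -⟩ := mem_EE.1 he
    obtain ⟨h1', -, -⟩ := mem_EE.1 he'
    simp only [rFun, Prod.mk.injEq] at h
    obtain ⟨h2, h3, h4⟩ := h
    have hα : α ≠ 0 := left_ne_zero_of_mul h0
    have hδ : δ ≠ 0 := right_ne_zero_of_mul h0
    have h5 : α' * δ' = α * δ := by linear_combination (h1' - h1 + h2) / 2
    have h0' : α' * δ' ≠ 0 := h5 ▸ h0
    have hα' : α' ≠ 0 := left_ne_zero_of_mul h0'
    have hδ' : δ' ≠ 0 := right_ne_zero_of_mul h0'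
    refine mem_orbit_of_scale_eq (c := α' / α) ?_ ?_ ?_ ?_
    · exact (div_mul_cancel₀ _ hα).symm
    · change γ' = α' / α * γ
      rw [div_mul_eq_mul_div, eq_div_iff hα]
      apply mul_right_cancel₀ hδ'
      linear_combination α * h3 - γ * h5
    · change α' / α * β' = β
      rw [div_mul_eq_mul_div, div_eq_iff hα]
      linear_combination h4
    · change α' / α * δ' = δ
      rw [div_mul_eq_mul_div, div_eq_iff hα]
      linear_combination h5
  by_cases h0 : e.1.1 * e.1.2.2.2.1 = 0
  · have h1 : genT • e' ∈ MulAction.orbit G1 (genT • e) := by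
      refine main (by rw [rFun_genT_smul, rFun_genT_smul, h]) ?_
      rw [coe_genT_smul]
      intro h2
      have h3 := e.2.1
      have h4 : e.1.2.2.1 * e.1.2.1 = 0 := by simpa using h2
      rw [h0, h4] at h3
      norm_num at h3
    rw [MulAction.orbit_smul] at h1
    rwa [← MulAction.orbit_eq_iff, MulAction.orbit_smul, MulAction.orbit_eq_iff] at h1
  · exact main h h0

end

section

/-- The first form at the matrix `(1, N; 2T/(M+1), (M+1)/2)`. -/
def formA (p : ℂ × ℂ × ℂ) : ℂ := ll 1 (2 * p.2.1 / (p.1 + 1)) ((p.1 + 1) / 2)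
/-- The second form at the matrix `(1, N; 2T/(M+1), (M+1)/2)`. -/
def formB (p : ℂ × ℂ × ℂ) : ℂ :=
  ll p.2.2 ((p.1 + 1) / 2) (-(2 * p.2.1 / (p.1 + 1)))

/-- A local section of `rFun`, depending on initial values `α`, `a`, `b`, `τ`. -/
def rSection (α a b τ : ℂ) (p : ℂ × ℂ × ℂ) : ℂ × ℂ × ℂ × ℂ × ℂ :=
  let c := α * Complex.exp ((Complex.log (formB p / b) - Complex.log (formA p / a)) / 4)
  (c, c * (2 * p.2.1 / (p.1 + 1)), p.2.2 / c, (p.1 + 1) / 2 / c,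
    τ + (Complex.log (formA p / a) + Complex.log (formB p / b)) / 2)

theorem rSection_mem {α a b τ : ℂ} (hα : α ≠ 0) (ha : α ^ 2 * a = Complex.exp τ)
    (hb : b = α ^ 2 * Complex.exp τ) {p : ℂ × ℂ × ℂ} (hp : p ∈ YY) (hp1 : p.1 ≠ -1) :
    rSection α a b τ p ∈ EE ∧ rFun (rSection α a b τ p) = p := by
  obtain ⟨M, T, N⟩ := p
  have hM : M + 1 ≠ 0 := fun h => hp1 (eq_neg_of_add_eq_zero_left h)
  have hb0 : b ≠ 0 := by simp [hb, hα, Complex.exp_ne_zero]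
  have ha0 : a ≠ 0 := by
    rintro rfl
    exact Complex.exp_ne_zero τ (by simpa using ha.symm)
  obtain ⟨hD, hQ⟩ := hp
  replace hD : M ^ 2 - 4 * T * N = 1 := hD
  have hdet : 1 * ((M + 1) / 2) - N * (2 * T / (M + 1)) = 1 := by
    field_simp
    linear_combination hD
  have hr : (1 * ((M + 1) / 2) + N * (2 * T / (M + 1)), 2 * T / (M + 1) * ((M + 1) / 2), 1 * N) =
      (M, T, N) := by
    simp only [Prod.mk.injEq, one_mul, and_true]
    constructor
    · linear_combination -hdet
    · field_simp
  have hAB : formA (M, T, N) * formB (M, T, N) ≠ 0 := by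
    intro h
    have h1 := ll_mul_ll hdet
    rw [hr] at h1
    exact hQ (h1 ▸ by rw [← mul_zero (16 : ℂ), ← h]; rfl)
  have hA := left_ne_zero_of_mul hAB
  have hB := right_ne_zero_of_mul hAB
  have hlA := Complex.exp_log (div_ne_zero hA ha0)
  have hlB := Complex.exp_log (div_ne_zero hB hb0)
  simp only [rSection]
  set u := Complex.log (formA (M, T, N) / a)
  set w := Complex.log (formB (M, T, N) / b)
  have hc0 : α * Complex.exp ((w - u) / 4) ≠ 0 := mul_ne_zero hα (Complex.exp_ne_zero _)
  have hc2 : (α * Complex.exp ((w - u) / 4)) ^ 2 = α ^ 2 * Complex.exp ((w - u) / 2) := by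
    rw [mul_pow, ← Complex.exp_nat_mul]
    congr 2
    push_cast
    ring
  set c := α * Complex.exp ((w - u) / 4)
  refine ⟨mem_EE.2 ⟨?_, ?_, ?_⟩, ?_⟩
  · refine Eq.trans ?_ hdet
    field_simp
  · have h := ll_smul hc0 1 (2 * T / (M + 1)) ((M + 1) / 2)
    rw [mul_one] at h
    have h1 : formA (M, T, N) = a * Complex.exp u := by rw [hlA, mul_div_cancel₀ _ ha0]
    rw [h, hc2]
    change _ * formA (M, T, N) = _
    rw [h1, show α ^ 2 * Complex.exp ((w - u) / 2) * (a * Complex.exp u) =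
      α ^ 2 * a * (Complex.exp ((w - u) / 2) * Complex.exp u) by ring, ha, ← Complex.exp_add,
      ← Complex.exp_add]
    congr 1
    ring
  · have h := ll_smul (inv_ne_zero hc0) N ((M + 1) / 2) (-(2 * T / (M + 1)))
    have h1 : formB (M, T, N) = b * Complex.exp w := by rw [hlB, mul_div_cancel₀ _ hb0]
    have h2 : ll (N / c) ((M + 1) / 2 / c) (-(c * (2 * T / (M + 1)))) =
        (c ^ 2)⁻¹ * formB (M, T, N) := by
      rw [← inv_pow, formB, ← h]
      congr 1 <;> field_simp
    rw [h2, hc2, h1, hb, inv_mul_eq_iff_eq_mul₀ (by simp [hα, Complex.exp_ne_zero])]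
    rw [mul_assoc, mul_assoc, ← Complex.exp_add, ← Complex.exp_add]
    congr 2
    ring
  · simp only [rFun]
    rw [← hr]
    simp only [Prod.mk.injEq]
    refine ⟨?_, ?_, ?_⟩ <;> field_simp

theorem neg_mem_YY {p : ℂ × ℂ × ℂ} (hp : p ∈ YY) : -p ∈ YY := by
  refine ⟨by simpa using hp.1, ?_⟩
  rw [show QQ (-p) = QQ p by
    simp only [QQ, Prod.fst_neg, Prod.snd_neg]
    ring]
  exact hp.2

theorem exists_rFun_eq {p : ℂ × ℂ × ℂ} (hp : p ∈ YY) : ∃ e : EE, rFun e = p := by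
  by_cases h : p.1 = -1
  · have h1 := neg_mem_YY hp
    obtain ⟨h2, h3⟩ := rSection_mem (α := 1) (a := 1) (b := 1) (τ := 0) one_ne_zero (by simp)
      (by simp) h1 (by simp [h]; norm_num)
    exact ⟨genT • ⟨_, h2⟩, by rw [rFun_genT_smul, h3, neg_neg]⟩
  · obtain ⟨h2, h3⟩ := rSection_mem (α := 1) (a := 1) (b := 1) (τ := 0) one_ne_zero (by simp)
      (by simp) hp h
    exact ⟨⟨_, h2⟩, h3⟩

theorem surjective_rMap : Function.Surjective rMap := fun y =>
  (exists_rFun_eq y.2).imp fun _ h => Subtype.ext h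

theorem continuousAt_rSection {α a b τ : ℂ} {p : ℂ × ℂ × ℂ} (hp : p.1 ≠ -1) (hα : α ≠ 0)
    (ha : formA p / a = 1) (hb : formB p / b = 1) : ContinuousAt (rSection α a b τ) p := by
  have hM : p.1 + 1 ≠ 0 := fun h => hp (eq_neg_of_add_eq_zero_left h)
  have hA : ContinuousAt formA p := by
    unfold formA ll
    fun_prop (disch := assumption)
  have hB : ContinuousAt formB p := by
    unfold formB ll
    fun_prop (disch := assumption)
  have hlA : ContinuousAt (fun p => Complex.log (formA p / a)) p :=
    (hA.div_const a).clog (by rw [ha]; exact Complex.one_mem_slitPlane)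
  have hlB : ContinuousAt (fun p => Complex.log (formB p / b)) p :=
    (hB.div_const b).clog (by rw [hb]; exact Complex.one_mem_slitPlane)
  have hc : ContinuousAt (fun p => α * Complex.exp ((Complex.log (formB p / b) -
      Complex.log (formA p / a)) / 4)) p :=
    continuousAt_const.mul (((hlB.sub hlA).div_const 4).cexp)
  have hc0 : α * Complex.exp ((Complex.log (formB p / b) - Complex.log (formA p / a)) / 4) ≠ 0 :=
    mul_ne_zero hα (Complex.exp_ne_zero _)
  refine hc.prodMk ((hc.mul ?_).prodMk ((ContinuousAt.div₀ ?_ hc hc0).prodMk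
    ((ContinuousAt.div₀ ?_ hc hc0).prodMk (continuousAt_const.add ((hlA.add hlB).div_const 2)))))
  · fun_prop (disch := assumption)
  · fun_prop
  · fun_prop

theorem eventually_exists_rFun_eq (e : EE) {O : Set (ℂ × ℂ × ℂ × ℂ × ℂ)} (hO : O ∈ 𝓝 e.1) :
    ∀ᶠ p in 𝓝 (rFun e), p ∈ YY → ∃ e' : EE, e'.1 ∈ O ∧ rFun e' = p := by
  have main (e : EE) (h0 : (rFun e).1 ≠ -1) {O : Set (ℂ × ℂ × ℂ × ℂ × ℂ)} (hO : O ∈ 𝓝 e.1) :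
      ∀ᶠ p in 𝓝 (rFun e), p ∈ YY → ∃ e' : EE, e'.1 ∈ O ∧ rFun e' = p := by
    obtain ⟨⟨α, γ, β, δ, τ⟩, he⟩ := e
    obtain ⟨h1, h2, h3⟩ := mem_EE.1 he
    replace h0 : (rFun (α, γ, β, δ, τ)).1 ≠ -1 := h0
    change ∀ᶠ p in 𝓝 (rFun (α, γ, β, δ, τ)), _
    have hr : rFun (α, γ, β, δ, τ) = (α * δ + β * γ, γ * δ, α * β) := rfl
    have hM : α * δ + β * γ + 1 = 2 * (α * δ) := by linear_combination -h1
    have hαδ : α * δ ≠ 0 := by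
      intro h
      apply h0
      rw [hr]
      linear_combination hM + 2 * h
    have hα : α ≠ 0 := left_ne_zero_of_mul hαδ
    have hδ : δ ≠ 0 := right_ne_zero_of_mul hαδ
    have hX : (α * δ + β * γ + 1) / 2 = α * δ := by rw [hM, mul_div_cancel_left₀ _ two_ne_zero]
    have hY : 2 * (γ * δ) / (α * δ + β * γ + 1) = γ / α := by
      rw [hM]
      field_simp
    have hA : α ^ 2 * formA (rFun (α, γ, β, δ, τ)) = Complex.exp τ := by
      rw [← h2, hr, formA, hX, hY, ← ll_smul hα]
      congr 1 <;> field_simp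
    have hB : formB (rFun (α, γ, β, δ, τ)) = α ^ 2 * Complex.exp τ := by
      rw [← h3, hr, formB, hX, hY, ← ll_smul hα, neg_div]
    have hA0 : formA (rFun (α, γ, β, δ, τ)) ≠ 0 :=
      right_ne_zero_of_mul (hA ▸ Complex.exp_ne_zero τ)
    have hB0 : formB (rFun (α, γ, β, δ, τ)) ≠ 0 := by simp [hB, hα, Complex.exp_ne_zero]
    have hc := continuousAt_rSection (τ := τ) h0 hα (div_self hA0) (div_self hB0)
    have hs : rSection α (formA (rFun (α, γ, β, δ, τ))) (formB (rFun (α, γ, β, δ, τ))) τ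
        (rFun (α, γ, β, δ, τ)) = (α, γ, β, δ, τ) := by
      simp only [rSection, div_self hA0, div_self hB0, Complex.log_one, sub_zero, zero_div,
        Complex.exp_zero, mul_one, add_zero]
      rw [hr, hX, hY, mul_div_cancel₀ _ hα, mul_div_cancel_left₀ _ hα, mul_div_cancel_left₀ _ hα]
    rw [ContinuousAt, hs] at hc
    filter_upwards [hc hO, continuous_fst.continuousAt.eventually_ne h0] with p hp hp1 hpY
    obtain ⟨h4, h5⟩ := rSection_mem hα hA hB hpY hp1
    exact ⟨⟨_, h4⟩, hp, h5⟩
  by_cases h0 : (rFun e).1 = -1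
  · have h1 : (rFun (genT • e : EE)).1 ≠ -1 := by
      rw [rFun_genT_smul, Prod.fst_neg, h0]
      norm_num
    have hj : Continuous fun p : ℂ × ℂ × ℂ × ℂ × ℂ =>
        (-p.2.2.1, -p.2.2.2.1, p.1, p.2.1, p.2.2.2.2) := by fun_prop
    have h2 := main (genT • e) h1 (hj.continuousAt.preimage_mem_nhds (t := O)
      (by simpa [coe_genT_smul] using hO))
    rw [rFun_genT_smul] at h2
    filter_upwards [continuous_neg.continuousAt.eventually h2] with p hp hpY
    obtain ⟨e', h3, h4⟩ := hp (neg_mem_YY hpY)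
    refine ⟨genT ^ 2 • genT • e', ?_, ?_⟩
    · rw [coe_genT_sq_smul, coe_genT_smul]
      simpa using h3
    · rw [pow_two, mul_smul, rFun_genT_smul, rFun_genT_smul, rFun_genT_smul, h4]
      simp
  · exact main e h0 hO

theorem isOpenMap_rMap : IsOpenMap rMap := by
  refine isOpenMap_iff_nhds_le.2 fun e => Filter.le_map fun O hO => ?_
  obtain ⟨O', hO', h⟩ := mem_nhds_subtype _ _ _ |>.1 hO
  rw [nhds_subtype_eq_comap]
  refine ⟨_, eventually_exists_rFun_eq e hO', fun y hy => ?_⟩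
  obtain ⟨e', h1, h2⟩ := hy y.2
  exact ⟨e', h h1, Subtype.ext h2⟩

end

section

/-- The quotient map from nonzero vectors to the projective plane. -/
def mkP2 (v : {v : Fin 3 → ℂ // v ≠ 0}) : P2 := Projectivization.mk ℂ v.1 v.2

theorem isQuotientMap_mkP2 : IsQuotientMap mkP2 := isQuotientMap_quotient_mk'

/-- Linear coordinates in which the sextic is invariant under a torus. -/
def lc (v : Fin 3 → ℂ) : ℂ × ℂ × ℂ :=
  (2 * v 1 + 2 * v 2, v 1 - 2 * v 2, (18 * v 0 - 13 * v 1 + 2 * v 2) / 4)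

/-- The inverse of the coordinate change `lc`. -/
def lv (p : ℂ × ℂ × ℂ) : Fin 3 → ℂ :=
  ![(4 * p.2.2 + 13 * ((p.1 + p.2.1) / 3) - 2 * ((p.1 - 2 * p.2.1) / 6)) / 18,
    (p.1 + p.2.1) / 3, (p.1 - 2 * p.2.1) / 6]

theorem lc_lv (p : ℂ × ℂ × ℂ) : lc (lv p) = p := by
  simp only [lc, lv, Matrix.cons_val]
  refine Prod.ext ?_ (Prod.ext ?_ ?_) <;> ring

theorem lv_lc (v : Fin 3 → ℂ) : lv (lc v) = v := by
  ext i
  fin_cases i <;> simp [lc, lv] <;> ring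

theorem lc_smul (c : ℂ) (v : Fin 3 → ℂ) : lc (c • v) = c • lc v := by
  simp only [lc, Pi.smul_apply, smul_eq_mul, Prod.smul_mk]
  refine Prod.ext ?_ (Prod.ext ?_ ?_) <;> ring

theorem lv_smul (c : ℂ) (p : ℂ × ℂ × ℂ) : lv (c • p) = c • lv p := by
  rw [← lv_lc (c • lv p), lc_smul, lc_lv]

theorem continuous_lc : Continuous lc := by
  unfold lc
  fun_prop

theorem continuous_lv : Continuous lv := by
  unfold lv
  refine continuous_pi fun i => ?_
  fin_cases i <;> simp <;> fun_prop

/-- The equation of the conic in the coordinates `lc`. -/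
def conicF (p : ℂ × ℂ × ℂ) : ℂ := p.1 ^ 2 - 4 * p.2.1 * p.2.2

theorem continuous_conicF : Continuous conicF := by
  unfold conicF
  fun_prop

theorem conicF_smul (c : ℂ) (p : ℂ × ℂ × ℂ) : conicF (c • p) = c ^ 2 * conicF p := by
  simp only [conicF, Prod.smul_fst, Prod.smul_snd, smul_eq_mul]
  ring

theorem eval_sextic (v : Fin 3 → ℂ) : eval v (F₁ * Q₁) = -(conicF (lc v) *
    ((16 * (lc v).2.2 ^ 2 - 6 * (2 * (lc v).1 ^ 2 - 4 * (lc v).2.1 * (lc v).2.2) -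
      16 * (lc v).2.1 * (lc v).1 + 9 * (lc v).2.1 ^ 2) * conicF (lc v) -
      16 * (lc v).2.1 ^ 4)) / 324 := by
  simp only [F₁, Q₁, conicF, lc, map_mul, map_add, map_sub, map_pow, eval_X, map_ofNat]
  ring

theorem eval_sextic_smul (c : ℂ) (v : Fin 3 → ℂ) :
    eval (c • v) (F₁ * Q₁) = c ^ 6 * eval v (F₁ * Q₁) := by
  simp only [F₁, Q₁, map_mul, map_add, map_sub, map_pow, eval_X, map_ofNat, Pi.smul_apply,
    smul_eq_mul]
  ring

theorem eval_sextic_eq_QQ {v : Fin 3 → ℂ} (h : conicF (lc v) = 1) :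
    eval v (F₁ * Q₁) = -QQ (lc v) / 324 := by
  rw [eval_sextic, h, QQ]
  simp only [conicF] at h
  linear_combination 6 / 324 * h

theorem mk_mem_compl {v : Fin 3 → ℂ} (h : v ≠ 0) :
    Projectivization.mk ℂ v h ∈ (VV (F₁ * Q₁))ᶜ ↔ eval v (F₁ * Q₁) ≠ 0 := by
  rw [mem_compl_iff, not_iff_not]
  refine ⟨fun h1 => h1 v h rfl, fun h1 w hw h2 => ?_⟩
  obtain ⟨c, hc⟩ := (Projectivization.mk_eq_mk_iff' ℂ w v hw h).1 h2
  rw [← hc, eval_sextic_smul, h1, mul_zero]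

theorem smul_mem_YY {c : ℂ} {v : Fin 3 → ℂ} (h : c ^ 2 * conicF (lc v) = 1)
    (hv : eval v (F₁ * Q₁) ≠ 0) : c • lc v ∈ YY := by
  have h1 : conicF (lc (c • v)) = 1 := by rw [lc_smul, conicF_smul, h]
  refine ⟨by rw [← conicF_smul] at h; exact h, fun h2 => ?_⟩
  rw [← lc_smul] at h2
  have h3 := eval_sextic_eq_QQ h1
  rw [h2, eval_sextic_smul, neg_zero, zero_div, mul_eq_zero, or_iff_left hv] at h3
  rw [eq_zero_of_pow_eq_zero h3] at h
  norm_num at h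

theorem ne_zero_of_mem_YY {p : ℂ × ℂ × ℂ} (hp : p ∈ YY) : lv p ≠ 0 := by
  intro h
  have h1 : p = 0 := by
    rw [← lc_lv p, h]
    simp [lc]
  rw [h1] at hp
  simpa using hp.1

/-- The double covering of the complement of the sextic by the surface. -/
def sMap : C(YY, ↥(VV (F₁ * Q₁))ᶜ) where
  toFun p := ⟨mkP2 ⟨lv p, ne_zero_of_mem_YY p.2⟩, (mk_mem_compl _).2 (by
    have h1 : conicF (lc (lv p)) = 1 := by rw [lc_lv]; exact p.2.1
    rw [eval_sextic_eq_QQ h1, lc_lv]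
    exact div_ne_zero (neg_ne_zero.2 p.2.2) (by norm_num))⟩
  continuous_toFun := (isQuotientMap_mkP2.continuous.comp
    ((continuous_lv.comp continuous_subtype_val).subtype_mk _)).subtype_mk _

theorem sMap_eq_iff {p p' : YY} : sMap p = sMap p' ↔ p.1 = p'.1 ∨ p.1 = -p'.1 := by
  rw [Subtype.ext_iff]
  change mkP2 _ = mkP2 _ ↔ _
  rw [mkP2, mkP2, Projectivization.mk_eq_mk_iff']
  constructor
  · rintro ⟨c, hc⟩
    replace hc : c • lv p'.1 = lv p.1 := hc
    have h1 : p.1 = c • p'.1 := by rw [← lc_lv p.1, ← hc, lc_smul, lc_lv]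
    have h2 : conicF p.1 = 1 := p.2.1
    have h3 : conicF p'.1 = 1 := p'.2.1
    rw [h1, conicF_smul, h3, mul_one, sq_eq_one_iff] at h2
    rcases h2 with rfl | rfl
    · exact Or.inl (by rw [h1, one_smul])
    · exact Or.inr (by rw [h1, neg_one_smul])
  · rintro (h | h)
    · refine ⟨1, ?_⟩
      change (1 : ℂ) • lv p'.1 = lv p.1
      rw [one_smul, h]
    · refine ⟨-1, ?_⟩
      change (-1 : ℂ) • lv p'.1 = lv p.1
      rw [← lv_smul, h, neg_one_smul]

theorem surjective_sMap : Function.Surjective sMap := by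
  rintro ⟨P, hP⟩
  induction P using Projectivization.ind with
  | h v hv =>
    have h1 := (mk_mem_compl hv).1 hP
    have h2 : conicF (lc v) ≠ 0 := by
      intro h
      rw [eval_sextic, h] at h1
      simp at h1
    have h3 : (csq (conicF (lc v))⁻¹) ^ 2 * conicF (lc v) = 1 := by
      rw [csq_sq (inv_ne_zero h2), inv_mul_cancel₀ h2]
    refine ⟨⟨_, smul_mem_YY h3 h1⟩, Subtype.ext ?_⟩
    refine (Projectivization.mk_eq_mk_iff' ℂ _ _ _ _).2 ⟨csq (conicF (lc v))⁻¹, ?_⟩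
    change _ = lv (_ • lc v)
    rw [lv_smul, lv_lc]

theorem isOpenMap_sMap : IsOpenMap sMap := by
  rintro _ ⟨O, hO, rfl⟩
  have hopen : IsOpen (mkP2 '' {v | ∃ c : ℂ, c • lc v.1 ∈ YY ∩ O}) := by
    rw [← isQuotientMap_mkP2.isOpen_preimage]
    have h1 : mkP2 ⁻¹' (mkP2 '' {v | ∃ c : ℂ, c • lc v.1 ∈ YY ∩ O}) =
        {v | ∃ c : ℂ, c • lc v.1 ∈ YY ∩ O} := by
      refine Subset.antisymm ?_ (subset_preimage_image _ _)
      rintro w ⟨v, ⟨c, hc⟩, h⟩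
      obtain ⟨d, hd⟩ := (Projectivization.mk_eq_mk_iff' ℂ _ _ _ _).1 h
      exact ⟨c * d, by rwa [mul_smul, ← lc_smul, hd]⟩
    rw [h1, isOpen_iff_mem_nhds]
    rintro v ⟨c, hcY, hcO⟩
    have h2 : c ^ 2 * conicF (lc v.1) = 1 := by rw [← conicF_smul]; exact hcY.1
    have h3 : conicF (lc v.1) ≠ 0 := right_ne_zero_of_mul (h2.trans_ne one_ne_zero)
    have hl : Continuous fun w : {v : Fin 3 → ℂ // v ≠ 0} => lc w.1 :=
      continuous_lc.comp continuous_subtype_val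
    have hD : Continuous fun w : {v : Fin 3 → ℂ // v ≠ 0} => conicF (lc w.1) :=
      continuous_conicF.comp hl
    have h4 : conicF (lc v.1) / conicF (lc v.1) = 1 := div_self h3
    have hc : ContinuousAt (fun w : {v : Fin 3 → ℂ // v ≠ 0} =>
        (c * csq (conicF (lc v.1) / conicF (lc w.1))) • lc w.1) v := by
      refine (continuousAt_const.mul (ContinuousAt.comp (g := csq) ?_
        (continuousAt_const.div₀ hD.continuousAt h3))).smul hl.continuousAt
      rw [h4]
      exact continuousAt_csq Complex.one_mem_slitPlane
    have h5 : (c * csq (conicF (lc v.1) / conicF (lc v.1))) • lc v.1 = c • lc v.1 := by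
      rw [h4, csq, Complex.log_one, zero_div, Complex.exp_zero, mul_one]
    rw [ContinuousAt, h5] at hc
    filter_upwards [hc (hO.mem_nhds hcO), hD.continuousAt.eventually_ne h3,
      (continuous_QQ.continuousAt.tendsto.comp hc).eventually_ne hcY.2] with w hw hw1 hw2
    refine ⟨_, ⟨?_, hw2⟩, hw⟩
    change conicF _ = 1
    rw [conicF_smul, mul_pow, csq_sq (div_ne_zero h3 hw1), mul_assoc, div_mul_cancel₀ _ hw1, h2]
  have h6 : sMap '' (Subtype.val ⁻¹' O) =
      Subtype.val ⁻¹' (mkP2 '' {v | ∃ c : ℂ, c • lc v.1 ∈ YY ∩ O}) := by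
    ext x
    constructor
    · rintro ⟨p, hp, rfl⟩
      exact ⟨⟨lv p, ne_zero_of_mem_YY p.2⟩, ⟨1, by rw [one_smul, lc_lv]; exact ⟨p.2, hp⟩⟩, rfl⟩
    · rintro ⟨v, ⟨c, hcY, hcO⟩, h⟩
      refine ⟨⟨_, hcY⟩, hcO, Subtype.ext ?_⟩
      rw [← h]
      refine (Projectivization.mk_eq_mk_iff' ℂ _ _ _ _).2 ⟨c, ?_⟩
      change _ = lv (c • lc v.1)
      rw [lv_smul, lv_lc]
  rw [h6]
  exact hopen.preimage continuous_subtype_val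

end

section

/-- The covering map onto the complement of the sextic. -/
def qMap : C(EE, ↥(VV (F₁ * Q₁))ᶜ) := sMap.comp rMap

theorem surjective_qMap : Function.Surjective qMap := surjective_sMap.comp surjective_rMap

theorem qMap_eq_iff {e e' : EE} : qMap e = qMap e' ↔ rFun e = rFun e' ∨ rFun e = -rFun e' :=
  sMap_eq_iff

theorem qMap_smul (g : G1) (e : EE) : qMap (g • e) = qMap e := by
  have key {h : G1} (hh : ∀ e, qMap (h • e) = qMap e) (n : ℤ) (e : EE) :
      qMap (h ^ n • e) = qMap e := by
    have h1 : ∀ k ∈ Subgroup.zpowers h, ∀ e, qMap (k • e) = qMap e := by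
      intro k hk
      rw [Subgroup.zpowers_eq_closure] at hk
      induction hk using Subgroup.closure_induction with
      | mem k hk =>
        rw [mem_singleton_iff.1 hk]
        exact hh
      | one => simp
      | mul k l _ _ hk hl => exact fun e => by rw [mul_smul, hk, hl]
      | inv k _ hk => exact fun e => by rw [← hk (k⁻¹ • e), smul_inv_smul]
    exact h1 _ (zpow_mem (Subgroup.mem_zpowers h) n) e
  obtain ⟨j, n, rfl⟩ := exists_normalForm g
  rw [mul_smul, key (fun e => qMap_eq_iff.2 (Or.inr (rFun_genT_smul e))),
    key (fun e => qMap_eq_iff.2 (Or.inl (rFun_genA_smul e)))]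

theorem genT_smul_ne (e : EE) : genT • e ≠ e := by
  intro h
  have h1 := congrArg Subtype.val h
  obtain ⟨⟨α, γ, β, δ, τ⟩, he⟩ := e
  obtain ⟨h2, -, -⟩ := mem_EE.1 he
  simp only [coe_genT_smul, Prod.mk.injEq] at h1
  obtain ⟨rfl, rfl, -⟩ := h1
  simp at h2

theorem genT_sq_smul_ne (e : EE) : genT ^ 2 • e ≠ e := by
  intro h
  have h1 := congrArg Subtype.val h
  obtain ⟨⟨α, γ, β, δ, τ⟩, he⟩ := e
  obtain ⟨h2, -, -⟩ := mem_EE.1 he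
  simp only [coe_genT_sq_smul, Prod.mk.injEq, neg_eq_self] at h1
  obtain ⟨rfl, rfl, -⟩ := h1
  simp at h2

theorem genT_cube_smul_ne (e : EE) : genT ^ 3 • e ≠ e := by
  intro h
  apply genT_smul_ne e
  nth_rw 1 [← h]
  rw [← mul_smul, ← pow_succ', genT_pow_four, one_smul]

theorem exists_nhds_forall_smul_notMem {h : G1} {e : EE} (he : h • e ≠ e) :
    ∃ U ∈ 𝓝 e, ∀ u ∈ U, h • u ∉ U := by
  obtain ⟨A, B, hA, hB, hAB⟩ := t2_separation_nhds he
  refine ⟨_, Filter.inter_mem hB ((continuous_const_smul h).continuousAt.preimage_mem_nhds hA), ?_⟩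
  exact fun u hu hu' => disjoint_left.1 hAB hu.2 hu'.1

theorem genT_zpow_cases (j : ℤ) :
    genT ^ j = 1 ∨ genT ^ j = genT ∨ genT ^ j = genT ^ 2 ∨ genT ^ j = genT ^ 3 := by
  have h : genT ^ j = genT ^ (j % 4) := by
    conv_lhs => rw [← Int.emod_add_mul_ediv j 4, zpow_add, zpow_mul]
    rw [show genT ^ (4 : ℤ) = 1 from mod_cast genT_pow_four, one_zpow, mul_one]
  rw [h]
  have h0 := Int.emod_nonneg j (by norm_num : (4 : ℤ) ≠ 0)
  have h4 := Int.emod_lt_of_pos j (by norm_num : (0 : ℤ) < 4)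
  interval_cases j % 4
  · simp
  · simp
  · exact Or.inr (Or.inr (Or.inl rfl))
  · exact Or.inr (Or.inr (Or.inr rfl))

theorem isQuotientCoveringMap_qMap : IsQuotientCoveringMap qMap G1 where
  toIsQuotientMap := (isOpenMap_sMap.comp isOpenMap_rMap).isQuotientMap qMap.continuous
    surjective_qMap
  toContinuousConstSMul := inferInstance
  apply_eq_iff_mem_orbit {e e'} := by
    constructor
    · intro h
      rcases qMap_eq_iff.1 h with h | h
      · exact mem_orbit_of_rFun_eq h
      · rw [← rFun_genT_smul] at h
        rw [← MulAction.orbit_smul genT e']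
        exact mem_orbit_of_rFun_eq h
    · rintro ⟨g, rfl⟩
      exact qMap_smul g e'
  disjoint e := by
    obtain ⟨U₁, h1, h1'⟩ := exists_nhds_forall_smul_notMem (genT_smul_ne e)
    obtain ⟨U₂, h2, h2'⟩ := exists_nhds_forall_smul_notMem (genT_sq_smul_ne e)
    obtain ⟨U₃, h3, h3'⟩ := exists_nhds_forall_smul_notMem (genT_cube_smul_ne e)
    have hτ : Continuous fun u : EE => u.1.2.2.2.2 := by fun_prop
    refine ⟨(fun u : EE => u.1.2.2.2.2) ⁻¹' Metric.ball e.1.2.2.2.2 1 ∩ (U₁ ∩ (U₂ ∩ U₃)),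
      Filter.inter_mem (hτ.continuousAt.preimage_mem_nhds (Metric.ball_mem_nhds _ one_pos))
        (Filter.inter_mem h1 (Filter.inter_mem h2 h3)), ?_⟩
    rintro g ⟨_, ⟨u, ⟨hu, hu1, hu2, hu3⟩, rfl⟩, hv, hv1, hv2, hv3⟩
    obtain ⟨j, n, rfl⟩ := exists_normalForm g
    dsimp only at hv hv1 hv2 hv3
    have hn : n = 0 := by
      rw [mem_preimage, tau_normalForm_smul, Metric.mem_ball] at hv
      rw [mem_preimage, Metric.mem_ball] at hu
      have h4 := dist_triangle_right (u.1.2.2.2.2 + n * (Real.pi * Complex.I)) u.1.2.2.2.2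
        e.1.2.2.2.2
      rw [dist_self_add_left, norm_mul, norm_mul, Complex.norm_I, mul_one, Complex.norm_real,
        Complex.norm_intCast, Real.norm_of_nonneg Real.pi_pos.le] at h4
      have h5 := Real.pi_gt_three
      have h6 : |(n : ℝ)| < 1 := by nlinarith [abs_nonneg (n : ℝ)]
      exact Int.abs_lt_one_iff.1 (mod_cast h6)
    subst hn
    rw [zpow_zero, mul_one] at hv1 hv2 hv3 ⊢
    rcases genT_zpow_cases j with h | h | h | h
    · exact h
    · exact absurd (h ▸ hv1) (h1' u hu1)
    · exact absurd (h ▸ hv2) (h2' u hu2)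
    · exact absurd (h ▸ hv3) (h3' u hu3)

end

section

theorem joined_of_continuous {Z : Type*} [TopologicalSpace Z] (f : C(ℝ, Z)) :
    Joined (f 0) (f 1) :=
  ⟨⟨f.comp ⟨Subtype.val, continuous_subtype_val⟩, rfl, rfl⟩⟩

theorem Joined.smul_const {G Z : Type*} [TopologicalSpace Z] [SMul G Z]
    [ContinuousConstSMul G Z] {x y : Z} (h : Joined x y) (g : G) : Joined (g • x) (g • y) :=
  ⟨h.somePath.map (continuous_const_smul g)⟩

theorem one_add_mem_slitPlane {z : ℂ} (hz : ‖z‖ < 1) : 1 + z ∈ Complex.slitPlane :=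
  Complex.mem_slitPlane_of_norm_lt_one hz

/-- A curve of upper triangular matrices in `EE`. -/
def triangularCurve (τ : ℂ) : ℂ × ℂ × ℂ × ℂ × ℂ :=
  (Complex.exp (τ / 2), 0,
    csq (3 / 4) * (Complex.exp (-(τ / 2)) * csq (1 + 4 / 3 * Complex.exp (2 * τ))),
    Complex.exp (-(τ / 2)), τ)

theorem norm_four_thirds_exp_lt {τ : ℂ} (hτ : τ.re = -1) :
    ‖4 / 3 * Complex.exp (2 * τ)‖ < 1 := by
  rw [norm_mul, Complex.norm_exp]
  have h1 : (2 * τ).re = -2 := by simp [hτ]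
  have h2 : Real.exp (-2) * Real.exp 2 = 1 := by rw [← Real.exp_add]; simp
  have h3 := Real.add_one_le_exp 2
  have h4 := Real.exp_pos (-2)
  rw [h1]
  norm_num
  nlinarith

theorem triangularCurve_mem {τ : ℂ} (hτ : τ.re = -1) : triangularCurve τ ∈ EE := by
  have h0 := one_add_mem_slitPlane (norm_four_thirds_exp_lt hτ)
  have h1 : Complex.exp (τ / 2) * Complex.exp (-(τ / 2)) = 1 := by
    rw [← Complex.exp_add, add_neg_cancel, Complex.exp_zero]
  have h2 : Complex.exp (τ / 2) ^ 2 = Complex.exp τ := by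
    rw [← Complex.exp_nat_mul]
    congr 1
    push_cast
    ring
  have h3 : Complex.exp (2 * τ) = Complex.exp (τ / 2) ^ 4 := by
    rw [← Complex.exp_nat_mul]
    congr 1
    push_cast
    ring
  refine mem_EE.2 ⟨by rw [mul_zero, sub_zero, h1], by simp [ll, h2], ?_⟩
  simp only [ll, mul_pow]
  rw [csq_sq (by norm_num), csq_sq (Complex.slitPlane_ne_zero h0), h3, ← h2]
  linear_combination Complex.exp (τ / 2) ^ 2 * (Complex.exp (τ / 2) * Complex.exp (-(τ / 2)) + 1) * h1

theorem continuousOn_triangularCurve : ContinuousOn triangularCurve {τ | τ.re = -1} := by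
  unfold triangularCurve
  have h : ContinuousOn (fun τ => csq (1 + 4 / 3 * Complex.exp (2 * τ))) {τ | τ.re = -1} := by
    intro τ hτ
    refine ContinuousAt.continuousWithinAt (ContinuousAt.comp (g := csq)
      (continuousAt_csq (one_add_mem_slitPlane (norm_four_thirds_exp_lt hτ))) ?_)
    fun_prop
  fun_prop

theorem triangularCurve_add {τ : ℂ} : triangularCurve (τ + Real.pi * Complex.I) =
    (Complex.I * (triangularCurve τ).1, Complex.I * (triangularCurve τ).2.1,
      -(Complex.I * (triangularCurve τ).2.2.1), -(Complex.I * (triangularCurve τ).2.2.2.1),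
      (triangularCurve τ).2.2.2.2 + Real.pi * Complex.I) := by
  have h1 : Complex.exp ((τ + Real.pi * Complex.I) / 2) = Complex.I * Complex.exp (τ / 2) := by
    rw [add_div, Complex.exp_add, mul_div_right_comm, Complex.exp_pi_div_two_mul_I, mul_comm]
  have h2 : Complex.exp (-((τ + Real.pi * Complex.I) / 2)) =
      -(Complex.I * Complex.exp (-(τ / 2))) := by
    rw [Complex.exp_neg, h1, mul_inv, Complex.inv_I, ← Complex.exp_neg, neg_mul]
  have h3 : Complex.exp (2 * (τ + Real.pi * Complex.I)) = Complex.exp (2 * τ) := by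
    rw [mul_add, ← mul_assoc, Complex.exp_periodic]
  simp only [triangularCurve, h1, h2, h3, Prod.mk.injEq, mul_zero, true_and, and_true]
  ring

theorem exists_joined_genA_smul : ∃ e : EE, Joined e (genA • e) := by
  have hre (s : ℝ) : ((-1 : ℂ) + s * (Real.pi * Complex.I)).re = -1 := by simp
  let f : C(ℝ, EE) := ⟨fun s => ⟨triangularCurve (-1 + s * (Real.pi * Complex.I)),
    triangularCurve_mem (hre s)⟩, (continuousOn_triangularCurve.comp_continuous (by fun_prop)
      fun s => hre s).subtype_mk _⟩
  refine ⟨f 0, ?_⟩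
  convert joined_of_continuous f
  refine Subtype.ext ?_
  rw [coe_genA_smul]
  change _ = triangularCurve (-1 + ((1 : ℝ) : ℂ) * (Real.pi * Complex.I))
  rw [Complex.ofReal_one, one_mul, triangularCurve_add]
  simp [f]

/-- The relative error of the first form along `isotropicCurve`, for both signs `s = ±1`. -/
def isotropicError (s w : ℂ) : ℂ :=
  (3 * Complex.exp (-(4 * w)) + s * Complex.I * Complex.exp (-(6 * w))) / 16

/-- A logarithm of the two forms along `isotropicCurve`. -/
def isotropicLog (s w : ℂ) : ℂ := 2 * w + Complex.log (1 + isotropicError s w)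

/-- A curve in `EE` consisting of matrices whose rows are isotropic up to rescaling. -/
def isotropicCurve (w : ℂ) : ℂ × ℂ × ℂ × ℂ × ℂ :=
  let u := isotropicLog 1 w
  let v := isotropicLog (-1) w - Real.pi * Complex.I
  (Complex.exp ((v - u) / 4) * Complex.exp w,
    Complex.exp ((v - u) / 4) * (-(Complex.I / 2) * Complex.exp (-w)),
    Complex.exp (-((v - u) / 4)) * (-Complex.I * Complex.exp w),
    Complex.exp (-((v - u) / 4)) * (1 / 2 * Complex.exp (-w)), (u + v) / 2)

theorem norm_isotropicError_lt {s w : ℂ} (hs : ‖s‖ = 1) (hw : w.re = 0) :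
    ‖isotropicError s w‖ < 1 := by
  rw [isotropicError, norm_div]
  have h := norm_add_le (3 * Complex.exp (-(4 * w))) (s * Complex.I * Complex.exp (-(6 * w)))
  simp only [norm_mul, Complex.norm_exp, hs, Complex.norm_I] at h
  simp [hw] at h
  rw [div_lt_one (by simp)]
  refine h.trans_lt ?_
  norm_num

theorem isotropicCurve_mem {w : ℂ} (hw : w.re = 0) : isotropicCurve w ∈ EE := by
  have h1 := Complex.slitPlane_ne_zero
    (one_add_mem_slitPlane (norm_isotropicError_lt (s := 1) norm_one hw))
  have h2 := Complex.slitPlane_ne_zero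
    (one_add_mem_slitPlane (norm_isotropicError_lt (s := -1) (by simp) hw))
  have hI := Complex.I_sq
  have hy : Complex.exp w * Complex.exp (-w) = 1 := by
    rw [← Complex.exp_add, add_neg_cancel, Complex.exp_zero]
  have h3 (s : ℂ) : isotropicError s w =
      (3 * Complex.exp (-w) ^ 4 + s * Complex.I * Complex.exp (-w) ^ 6) / 16 := by
    rw [isotropicError, ← Complex.exp_nat_mul, ← Complex.exp_nat_mul]
    congr! 4
    · push_cast; ring
    · push_cast; ring
  have h4 : Complex.exp (isotropicLog 1 w) = Complex.exp w ^ 2 * (1 + isotropicError 1 w) := by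
    rw [isotropicLog, Complex.exp_add, Complex.exp_log h1, ← Complex.exp_nat_mul, Nat.cast_ofNat]
  have h5 : Complex.exp (isotropicLog (-1) w - Real.pi * Complex.I) =
      -(Complex.exp w ^ 2 * (1 + isotropicError (-1) w)) := by
    rw [isotropicLog, Complex.exp_sub, Complex.exp_pi_mul_I, Complex.exp_add, Complex.exp_log h2,
      ← Complex.exp_nat_mul, Nat.cast_ofNat, div_neg, div_one]
  rw [h3] at h4 h5
  simp only [isotropicCurve]
  set u := isotropicLog 1 w
  set v := isotropicLog (-1) w - Real.pi * Complex.I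
  have hk : Complex.exp ((v - u) / 4) * Complex.exp (-((v - u) / 4)) = 1 := by
    rw [← Complex.exp_add, add_neg_cancel, Complex.exp_zero]
  have hl : Complex.exp ((u + v) / 2) = Complex.exp ((v - u) / 4) ^ 2 * Complex.exp u := by
    rw [← Complex.exp_nat_mul, ← Complex.exp_add]
    congr 1
    push_cast
    ring
  have hl' : Complex.exp ((u + v) / 2) = Complex.exp (-((v - u) / 4)) ^ 2 * Complex.exp v := by
    rw [← Complex.exp_nat_mul, ← Complex.exp_add]
    congr 1
    push_cast
    ring
  have hll {k k' : ℂ} (h : k * k' = 1) (x y z : ℂ) : ll (k * x) (k * y) (k' * z) =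
      k ^ 2 * ll x y z := by
    simp only [ll]
    linear_combination k ^ 2 * y ^ 3 * z * h
  refine mem_EE.2 ⟨?_, ?_, ?_⟩
  · linear_combination (Complex.exp w * Complex.exp (-w)) * hk + hy -
      Complex.exp ((v - u) / 4) * Complex.exp (-((v - u) / 4)) *
        (Complex.exp w * Complex.exp (-w)) / 2 * hI
  · rw [hll hk, hl, h4]
    congr 1
    simp only [ll]
    linear_combination -(3 / 16 * Complex.exp (-w) ^ 2 + Complex.I / 16 * Complex.exp (-w) ^ 4) *
      (hI + (Complex.exp w * Complex.exp (-w) + 1) * hy)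
  · rw [← mul_neg, hll (mul_comm _ _ |>.trans hk), hl', h5]
    congr 1
    simp only [ll]
    linear_combination Complex.exp w ^ 2 * hI +
      (3 / 16 * Complex.exp (-w) ^ 2 - Complex.I / 16 * Complex.exp (-w) ^ 4) *
        ((Complex.exp w * Complex.exp (-w) + 1) * hy)

theorem continuousOn_isotropicCurve : ContinuousOn isotropicCurve {w | w.re = 0} := by
  have h {s : ℂ} (hs : ‖s‖ = 1) : ContinuousOn (isotropicLog s) {w | w.re = 0} := by
    unfold isotropicLog
    refine ContinuousOn.add (by fun_prop) (ContinuousOn.clog ?_ fun w hw =>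
      one_add_mem_slitPlane (norm_isotropicError_lt hs hw))
    unfold isotropicError
    fun_prop
  have h1 := h (s := 1) norm_one
  have h2 := h (s := -1) (by simp)
  have h3 : ContinuousOn (fun w => (isotropicLog (-1) w - Real.pi * Complex.I -
      isotropicLog 1 w) / 4) {w | w.re = 0} :=
    ((h2.sub continuousOn_const).sub h1).div_const 4
  have h4 : ContinuousOn (fun w => (isotropicLog 1 w + (isotropicLog (-1) w -
      Real.pi * Complex.I)) / 2) {w | w.re = 0} :=
    (h1.add (h2.sub continuousOn_const)).div_const 2
  unfold isotropicCurve
  dsimp only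
  fun_prop

theorem isotropicCurve_quarter_turn :
    isotropicCurve (-(Real.pi / 2 * Complex.I)) =
      (-(Complex.I * (isotropicCurve 0).2.2.1), -(Complex.I * (isotropicCurve 0).2.2.2.1),
        -(Complex.I * (isotropicCurve 0).1), -(Complex.I * (isotropicCurve 0).2.1),
        (isotropicCurve 0).2.2.2.2 - Real.pi * Complex.I) := by
  have hI := Complex.I_sq
  have e1 : Complex.exp (-(Real.pi / 2 * Complex.I)) = -Complex.I := by
    rw [Complex.exp_neg, Complex.exp_pi_div_two_mul_I, Complex.inv_I]
  have e4 : Complex.exp (-(4 * -(Real.pi / 2 * Complex.I))) = 1 := by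
    rw [show -(4 * -(Real.pi / 2 * Complex.I)) = 2 * Real.pi * Complex.I by ring,
      Complex.exp_two_pi_mul_I]
  have e6 : Complex.exp (-(6 * -(Real.pi / 2 * Complex.I))) = -1 := by
    rw [show -(6 * -(Real.pi / 2 * Complex.I)) = Real.pi * Complex.I + 2 * Real.pi * Complex.I by
      ring, Complex.exp_periodic, Complex.exp_pi_mul_I]
  have hlog (s : ℂ) : isotropicLog s (-(Real.pi / 2 * Complex.I)) =
      isotropicLog (-s) 0 - Real.pi * Complex.I := by
    simp only [isotropicLog, isotropicError, e4, e6, mul_zero, neg_zero, Complex.exp_zero]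
    ring_nf
  simp only [isotropicCurve, hlog, neg_neg, e1, neg_zero, Complex.exp_zero]
  set u := isotropicLog 1 0
  set v := isotropicLog (-1) 0
  have h1 : Complex.exp ((u - Real.pi * Complex.I - Real.pi * Complex.I -
      (v - Real.pi * Complex.I)) / 4) =
      -Complex.I * Complex.exp (-((v - Real.pi * Complex.I - u) / 4)) := by
    rw [← e1, ← Complex.exp_add]
    congr 1
    ring
  have h2 : Complex.exp (-((u - Real.pi * Complex.I - Real.pi * Complex.I -
      (v - Real.pi * Complex.I)) / 4)) =
      Complex.I * Complex.exp ((v - Real.pi * Complex.I - u) / 4) := by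
    refine Eq.trans ?_ (congrArg (· * _) Complex.exp_pi_div_two_mul_I)
    rw [← Complex.exp_add]
    congr 1
    ring
  rw [h1, h2, Complex.exp_pi_div_two_mul_I]
  simp only [Prod.mk.injEq]
  refine ⟨?_, ?_, ?_, ?_, ?_⟩
  · ring
  · linear_combination Complex.exp (-((v - Real.pi * Complex.I - u) / 4)) * Complex.I / 2 * hI
  · linear_combination Complex.exp ((v - Real.pi * Complex.I - u) / 4) * Complex.I * hI
  · ring
  · ring

theorem exists_joined_genT_smul_genA_smul : ∃ e : EE, Joined (genT • e) (genA • e) := by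
  have hre (s : ℝ) : (-(s * (Real.pi / 2 * Complex.I))).re = 0 := by simp
  let f : C(ℝ, EE) := ⟨fun s => ⟨isotropicCurve (-(s * (Real.pi / 2 * Complex.I))),
    isotropicCurve_mem (hre s)⟩, (continuousOn_isotropicCurve.comp_continuous (by fun_prop)
      fun s => hre s).subtype_mk _⟩
  refine ⟨f 0, ?_⟩
  have h : genT • f 0 = genA • f 1 := by
    have h0 : (f 0).1 = isotropicCurve 0 := by simp [f]
    have h1 : (f 1).1 = isotropicCurve (-(Real.pi / 2 * Complex.I)) := by simp [f]
    refine Subtype.ext ?_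
    rw [coe_genT_smul, coe_genA_smul, h0, h1, isotropicCurve_quarter_turn]
    simp [← mul_assoc]
  rw [h]
  exact ((joined_of_continuous f).smul_const genA).symm

theorem exists_joined_smul (e e' : EE) : ∃ g : G1, Joined e (g • e') := by
  have hq := isQuotientCoveringMap_qMap
  have hc := hq.isCoveringMap
  let γ : Path (qMap e) (qMap e') :=
    ((PathConnectedSpace.joined (rMap e) (rMap e')).somePath).map sMap.continuous
  have h0 : γ.toContinuousMap 0 = qMap e := γ.source
  have h1 : qMap (hc.liftPath γ.toContinuousMap e h0 1) = qMap e' :=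
    (congrFun (hc.liftPath_lifts γ.toContinuousMap e h0) 1).trans γ.target
  obtain ⟨g, hg⟩ := hq.apply_eq_iff_mem_orbit.1 h1
  exact ⟨g, ⟨⟨hc.liftPath γ.toContinuousMap e h0, hc.liftPath_zero _ _ _, hg.symm⟩⟩⟩

instance : PathConnectedSpace EE := by
  obtain ⟨e, he⟩ := exists_joined_genA_smul
  obtain ⟨e', he'⟩ := exists_joined_genT_smul_genA_smul
  obtain ⟨h, hh⟩ := exists_joined_smul e' e
  let S : Subgroup G1 :=
    { carrier := {g | Joined (g • e) e}
      one_mem' := by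
        rw [mem_ofPred_eq, one_smul]
      mul_mem' := fun {g k} hg hk => by
        rw [mem_ofPred_eq, mul_smul]
        exact (hk.smul_const g).trans hg
      inv_mem' := fun {g} hg => by
        have h1 := hg.smul_const g⁻¹
        rw [inv_smul_smul] at h1
        exact h1.symm }
  have hA : genA ∈ S := he.symm
  have hT : genT ∈ S := by
    have h1 : h⁻¹ * genA⁻¹ * genT * h ∈ S := by
      have h2 := (((hh.smul_const genT).symm.trans he').trans (hh.smul_const genA)).smul_const
        (h⁻¹ * genA⁻¹)
      change Joined _ _
      simpa only [mul_smul, inv_smul_smul] using h2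
    obtain ⟨j, n, rfl⟩ := exists_normalForm h
    have h2 : genT ^ (2 * j + 1) ∈ S := by
      have h3 := mul_mem hA (mul_mem (mul_mem (zpow_mem hA n) h1) (zpow_mem hA (-n)))
      have h4 := genA_conj_zpow (-j)
      rw [neg_neg] at h4
      have h6 : genA * (genA ^ n * ((genT ^ j * genA ^ n)⁻¹ * genA⁻¹ * genT *
          (genT ^ j * genA ^ n)) * genA ^ (-n)) =
          genA * genT ^ (-j) * genA⁻¹ * genT * genT ^ j := by group
      rw [h6, h4] at h3
      rwa [show (2 * j + 1 : ℤ) = j + 1 + j by ring, zpow_add, zpow_add, zpow_one]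
    have h5 := zpow_mem h2 (2 * j + 1)
    rwa [← zpow_mul, show (2 * j + 1) * (2 * j + 1) = 4 * (j ^ 2 + j) + 1 by ring, zpow_add,
      zpow_mul, show genT ^ (4 : ℤ) = 1 from mod_cast genT_pow_four, one_zpow, one_mul,
      zpow_one] at h5
  have key (x : EE) : Joined x e := by
    obtain ⟨g, hg⟩ := exists_joined_smul x e
    obtain ⟨j, n, rfl⟩ := exists_normalForm g
    exact hg.trans (mul_mem (zpow_mem hT j) (zpow_mem hA n))
  exact ⟨⟨e⟩, fun x y => (key x).trans (key y).symm⟩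

end

section

theorem genA_zpow_eq_one {n : ℤ} (h : genA ^ n = 1) : n = 0 := by
  obtain ⟨e, -⟩ := surjective_rMap surfaceBase
  have h1 := tau_normalForm_smul 0 n e
  rw [h, zpow_zero, mul_one, one_smul, left_eq_add, mul_eq_zero] at h1
  simpa [Real.pi_ne_zero] using h1

instance : SimplyConnectedSpace EE := by
  obtain ⟨e, he⟩ := surjective_rMap surfaceBase
  obtain ⟨x, y, hc, hxy, hcl⟩ : ∃ x y : FundamentalGroup YY (rMap e), Commute x y ∧
      x ^ 2 = y ^ 2 ∧ Subgroup.closure {x, y} = ⊤ := by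
    rw [he]
    exact exists_surface_generators
  refine simplyConnectedSpace_of_factor isQuotientCoveringMap_qMap rMap sMap (fun _ => rfl) hc hxy
    hcl (a := genA) (z := genT ^ 2) (fun n => genA_zpow_eq_one) ?_ ?_ ?_ ?_
  · rw [← pow_mul, genT_pow_four]
  · intro h
    apply genT_sq_smul_ne e
    rw [h, one_smul]
  · exact Subtype.ext (rFun_genA_smul e)
  · refine Subtype.ext ?_
    change rFun (genT ^ 2 • e : EE) = rFun e
    rw [pow_two, mul_smul, rFun_genT_smul, rFun_genT_smul, neg_neg]

end

/-- For every basepoint x₀ in the complement X₁ = ℙ² ∖ C⁽¹⁾ of the sextic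
C⁽¹⁾ = V(F₁·Q₁), the fundamental group π₁(X₁, x₀) is isomorphic to
G₁ = ⟨a, b | a²(ab)² = 1, ab²a⁻¹b⁻² = 1⟩. -/
theorem stmt_5 (x₀ : ↥(VV (F₁ * Q₁))ᶜ) :
    Nonempty (FundamentalGroup (↥(VV (F₁ * Q₁))ᶜ) x₀ ≃* G1) := by
  obtain ⟨e, he⟩ := surjective_qMap x₀
  exact ⟨(isQuotientCoveringMap_qMap.fundamentalGroupEquiv ⟨e, he⟩).trans (MulEquiv.inv' G1).symm⟩
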